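/- r₂(H) = 2 if and only if n has one of the following forms, where p, p₁, p₂ denote distinct primes ≡ 1 (mod 4) and q, q₁, q₂, q₃ distinct primes ≡ 3 (mod 4): (1) n = p with (2/p) = 1 and (2/p)₄ = (p/2)₄; (2) n = p₁p₂ with either (2/p₁) = (2/p₂) = −1, or ((2/p_i) = −(2/p_j) = −1 and (2/p_j)₄ ≠ (p_j/2)₄ for some ordering {i,j} = {1,2}); (3) n = q₁q₂ with (2/q₁) = (2/q₂) = 1; (4) n = q₁q₂q₃ with at most one of the symbols (2/q₁), (2/q₂), (2/q₃) equal to 1; (5) n = p₁p₂q with (2/p₁) = (2/p₂) = −1; (6) n = pq with (2/p) = 1; (7) n = p·q₁q₂ with (2/p) = −1 and ((2/q₁) = −1 or (2/q₂) = −1). -/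

import Mathlib

/-- `ε` is the fundamental unit of the real quadratic field `ℚ(√l)` (viewed inside `ℝ`):
it lies in `ℚ(√l)`, it is a unit of the ring of integers (both `ε` and `ε⁻¹` are
algebraic integers), `ε > 1`, and it is the smallest such unit. -/
def IsFundamentalUnit (l : ℕ) (ε : ℝ) : Prop :=
  1 < ε ∧ ε ∈ IntermediateField.adjoin ℚ ({Real.sqrt (l : ℝ)} : Set ℝ) ∧
    IsIntegral ℤ ε ∧ IsIntegral ℤ ε⁻¹ ∧
    ∀ x : ℝ, 1 < x → x ∈ IntermediateField.adjoin ℚ ({Real.sqrt (l : ℝ)} : Set ℝ) →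
      IsIntegral ℤ x → IsIntegral ℤ x⁻¹ → ε ≤ x

/-- The Legendre symbol `(a/p)`, via Euler's criterion (so that no `Fact p.Prime`
instance is needed): for an odd prime `p` it is `1` if `a` is a nonzero square mod `p`,
`0` if `p ∣ a`, and `-1` otherwise. -/
def legSym (p : ℕ) (a : ℤ) : ℤ :=
  if (a : ZMod p) ^ ((p - 1) / 2) = 1 then 1 else if (a : ZMod p) = 0 then 0 else -1

/-- The rational fourth power residue symbol `(a/p)₄ ∈ {±1}`, meaningful when
`(a/p) = 1`; it is determined by `(a/p)₄ ≡ a ^ ((p-1)/4) (mod p)`. -/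
def quartSym (p : ℕ) (a : ℤ) : ℤ :=
  if (a : ZMod p) ^ ((p - 1) / 4) = 1 then 1 else -1

/-- The cardinality of the 2-torsion subgroup of the class group of `K`.
For a number field `K` this equals `2 ^ r₂(H)`, where `r₂(H)` is the rank of the
2-class group `H` of `K` (i.e. `dim_{𝔽₂} Cl(K)/Cl(K)²`); in particular
`r₂(H) = r` iff this cardinality is `2 ^ r`. -/
noncomputable def twoTorsCard (K : IntermediateField ℚ ℝ) : ℕ :=
  Nat.card {x : ClassGroup (NumberField.RingOfIntegers K) // x ^ 2 = 1}

set_option linter.unusedSectionVars false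

section

open scoped nonZeroDivisors

/-- Adjoining to a subgroup of a commutative group an element outside it whose square lies in it
doubles the subgroup. -/
theorem Subgroup.relIndex_sup_zpowers_eq_two {G : Type*} [CommGroup G] {H : Subgroup G} {x : G}
    (hx : x ∉ H) (hx2 : x ^ 2 ∈ H) : H.relIndex (H ⊔ Subgroup.zpowers x) = 2 := by
  rw [Subgroup.relIndex_eq_two_iff_exists_notMem_and]
  refine ⟨x, Subgroup.mem_sup_right (Subgroup.mem_zpowers x), hx, fun b hb => ?_⟩
  obtain ⟨h, hh, y, hy, rfl⟩ := Subgroup.mem_sup.1 hb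
  obtain ⟨m, rfl⟩ := Subgroup.mem_zpowers_iff.1 hy
  obtain ⟨k, rfl | rfl⟩ := Int.even_or_odd' m
  · right
    rw [zpow_mul]
    exact H.mul_mem hh (H.zpow_mem (by exact_mod_cast hx2) k)
  · left
    have : h * x ^ (2 * k + 1) * x = h * (x ^ 2) ^ (k + 1) := by
      rw [mul_assoc, ← zpow_add_one, ← zpow_natCast, ← zpow_mul]
      congr 2
      push_cast; ring
    rw [this]
    exact H.mul_mem hh (H.zpow_mem hx2 _)

/-- The group of invertible fractional ideals of a Dedekind domain has no `2`-torsion. -/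
theorem FractionalIdeal.units_sq_injective (O K : Type*) [CommRing O] [IsDedekindDomain O] [Field K]
    [Algebra O K] [IsFractionRing O K] :
    Function.Injective (powMonoidHom 2 : (FractionalIdeal O⁰ K)ˣ →* (FractionalIdeal O⁰ K)ˣ) := by
  have key : ∀ J : FractionalIdeal O⁰ K, J ^ 2 = 1 → J ≤ 1 := by
    intro J hJ
    have h1 : (J + 1) * (J + 1) = (J + 1) * 1 := by
      have : (J + 1) * (J + 1) = J ^ 2 + (J + J) + 1 := by ring
      rw [this, hJ]
      have hadd : ∀ I : FractionalIdeal O⁰ K, I + I = I := fun I => sup_idem I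
      rw [hadd, mul_one, add_comm 1 J, add_assoc, hadd]
    have h0 : J + 1 ≠ 0 := by
      intro h
      have : (1 : FractionalIdeal O⁰ K) ≤ 0 := by
        rw [← h]; exact le_sup_right (a := J)
      exact one_ne_zero (le_antisymm this (FractionalIdeal.zero_le _))
    have := mul_left_cancel₀ h0 h1
    calc J ≤ J + 1 := le_sup_left (b := 1)
      _ = 1 := this
  rw [injective_iff_map_eq_one]
  intro J hJ
  have hJ' : (J : FractionalIdeal O⁰ K) ^ 2 = 1 := by
    have := congrArg Units.val hJ
    simpa using this
  have h1 := key _ hJ'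
  apply Units.ext
  apply le_antisymm h1
  calc ((1 : (FractionalIdeal O⁰ K)ˣ) : FractionalIdeal O⁰ K) = J * J := by
        rw [← sq, hJ']; rfl
    _ ≤ J * 1 := by gcongr
    _ = J := mul_one _

section ClassGroup

variable (O K : Type*) [CommRing O] [IsDedekindDomain O] [Field K] [Algebra O K]
  [IsFractionRing O K]

/-- The nonzero elements of `K` generating the square of a fractional ideal. -/
noncomputable def idealSquares : Subgroup Kˣ :=
  (powMonoidHom 2 : (FractionalIdeal O⁰ K)ˣ →* (FractionalIdeal O⁰ K)ˣ).range.comap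
    (toPrincipalIdeal O K)

/-- The units of `O`, as a subgroup of `Kˣ`. -/
noncomputable def integralUnits : Subgroup Kˣ :=
  (Units.map (algebraMap O K : O →* K)).range

/-- The squares in `Kˣ`. -/
def unitSquares (K : Type*) [Field K] : Subgroup Kˣ := (powMonoidHom 2 : Kˣ →* Kˣ).range

theorem ker_toPrincipalIdeal : (toPrincipalIdeal O K).ker = integralUnits O K := by
  ext x
  rw [MonoidHom.mem_ker, toPrincipalIdeal_eq_iff, Units.val_one]
  constructor
  · intro h
    have h1 : (x : K) ∈ (1 : FractionalIdeal O⁰ K) := by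
      rw [← h]; exact FractionalIdeal.mem_spanSingleton_self _ _
    have h2 : (1 : K) ∈ FractionalIdeal.spanSingleton O⁰ (x : K) := by
      rw [h]; exact FractionalIdeal.one_mem_one _
    obtain ⟨a, ha⟩ := FractionalIdeal.mem_one_iff O⁰ |>.1 h1
    obtain ⟨b, hb⟩ := FractionalIdeal.mem_spanSingleton _ |>.1 h2
    have hab : a * b = 1 := by
      apply IsFractionRing.injective O K
      rw [map_mul, ha, map_one, ← hb, Algebra.smul_def, mul_comm]
    exact ⟨⟨a, b, hab, by rw [mul_comm, hab]⟩, Units.ext ha⟩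
  · rintro ⟨u, rfl⟩
    have h1 : FractionalIdeal.spanSingleton O⁰ (algebraMap O K u) *
        FractionalIdeal.spanSingleton O⁰ (algebraMap O K ((u⁻¹ : Oˣ) : O)) = 1 := by
      rw [FractionalIdeal.spanSingleton_mul_spanSingleton, ← map_mul]; simp
    apply le_antisymm
    · rw [FractionalIdeal.spanSingleton_le_iff_mem]
      exact (FractionalIdeal.mem_one_iff O⁰).2 ⟨u, rfl⟩
    · rw [← FractionalIdeal.spanSingleton_one, FractionalIdeal.spanSingleton_le_iff_mem,
        FractionalIdeal.mem_spanSingleton]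
      exact ⟨((u⁻¹ : Oˣ) : O), by rw [Algebra.smul_def]; simp⟩

theorem unitSquares_le_idealSquares : unitSquares K ≤ idealSquares O K := by
  rintro _ ⟨x, rfl⟩
  exact ⟨toPrincipalIdeal O K x, by simp⟩

theorem integralUnits_le_idealSquares : integralUnits O K ≤ idealSquares O K := by
  rw [← ker_toPrincipalIdeal]
  intro x hx
  rw [idealSquares, Subgroup.mem_comap, (MonoidHom.mem_ker).1 hx]
  exact one_mem _

theorem card_twoTorsion_classGroup :
    Nat.card {x : ClassGroup O // x ^ 2 = 1} =
      (unitSquares K ⊔ integralUnits O K).relIndex (idealSquares O K) := by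
  set sq := (powMonoidHom 2 : (FractionalIdeal O⁰ K)ˣ →* (FractionalIdeal O⁰ K)ˣ) with hsq
  set T := (powMonoidHom 2 : ClassGroup O →* ClassGroup O).ker with hT
  set q := (ClassGroup.mk (R := O) (K := K)) with hq
  set pr := toPrincipalIdeal O K with hpr
  have hsurj : Function.Surjective q := by
    intro c
    refine ClassGroup.induction K (fun I => ⟨I, rfl⟩) c
  have hker : q.ker = pr.range := by
    ext I
    rw [MonoidHom.mem_ker, ClassGroup.mk_eq_one_iff, mem_principal_ideals_iff]
    constructor
    · intro h
      obtain ⟨x, hx⟩ := (FractionalIdeal.isPrincipal_iff _).1 h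
      exact ⟨x, hx.symm⟩
    · rintro ⟨x, hx⟩
      exact (FractionalIdeal.isPrincipal_iff _).2 ⟨x, hx.symm⟩
  have h1 : Nat.card {x : ClassGroup O // x ^ 2 = 1} = q.ker.relIndex (T.comap q) := by
    rw [Subgroup.relIndex_ker, Subgroup.map_comap_eq_self_of_surjective hsurj]
    rfl
  have hcomap : T.comap q = pr.range.comap sq := by
    rw [← hker]; ext I
    simp [hT, hsq, MonoidHom.mem_ker]
  have hinj := FractionalIdeal.units_sq_injective O K
  rw [h1, hcomap, hker, ← Subgroup.relIndex_map_map_of_injective _ _ hinj,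
    Subgroup.map_comap_eq]
  have e1 : pr.range.map sq = (unitSquares K).map pr := by
    ext I
    constructor
    · rintro ⟨_, ⟨x, rfl⟩, rfl⟩
      exact ⟨x ^ 2, ⟨x, rfl⟩, by simp [hsq]⟩
    · rintro ⟨_, ⟨x, rfl⟩, rfl⟩
      exact ⟨pr x, ⟨x, rfl⟩, by simp [hsq]⟩
  have e2 : sq.range ⊓ pr.range = (idealSquares O K).map pr := by
    rw [idealSquares, Subgroup.map_comap_eq, inf_comm]
  rw [e1, e2, Subgroup.relIndex_map_map, ker_toPrincipalIdeal,
    sup_eq_left.2 (integralUnits_le_idealSquares O K)]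
/-- The index of the squares in the group of elements generating squares of ideals. -/
theorem relIndex_unitSquares_idealSquares :
    (unitSquares K).relIndex (idealSquares O K) =
      (unitSquares K).relIndex (integralUnits O K) *
        Nat.card {x : ClassGroup O // x ^ 2 = 1} := by
  rw [card_twoTorsion_classGroup O K, ← Subgroup.relIndex_sup_right (integralUnits O K)
    (unitSquares K), sup_comm]
  exact (Subgroup.relIndex_mul_relIndex _ _ _ le_sup_left
    (sup_le (unitSquares_le_idealSquares O K) (integralUnits_le_idealSquares O K))).symm

end ClassGroup

section Square

variable {O K : Type*} [CommRing O] [IsDedekindDomain O] [Field K] [Algebra O K]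
  [IsFractionRing O K]

theorem FractionalIdeal.le_one_of_sq_le_one {J : FractionalIdeal O⁰ K} (hJ : J ^ 2 ≤ 1) :
    J ≤ 1 := by
  have h1 : (J + 1) * (J + 1) = (J + 1) * 1 := by
    have : (J + 1) * (J + 1) = J ^ 2 + 1 + (J + J) := by ring
    rw [this]
    have hadd : ∀ I : FractionalIdeal O⁰ K, I + I = I := fun I => sup_idem I
    have h2 : J ^ 2 + 1 = 1 := sup_eq_right.2 hJ
    rw [hadd, mul_one, h2, add_comm]
  have h0 : J + 1 ≠ 0 := by
    intro h
    have : (1 : FractionalIdeal O⁰ K) ≤ 0 := by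
      rw [← h]; exact le_sup_right (a := J)
    exact one_ne_zero (le_antisymm this (FractionalIdeal.zero_le _))
  have := mul_left_cancel₀ h0 h1
  calc J ≤ J + 1 := le_sup_left (b := 1)
    _ = 1 := this

/-- For an integral element, generating the square of a fractional ideal is the same as generating
the square of an ideal. -/
theorem mem_idealSquares_iff {a : O} {x : Kˣ} (hx : (x : K) = algebraMap O K a) :
    x ∈ idealSquares O K ↔ ∃ I : Ideal O, I ^ 2 = Ideal.span {a} := by
  have ha : a ≠ 0 := by rintro rfl; exact x.ne_zero (by rw [hx, map_zero])
  constructor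
  · rintro ⟨J, hJ⟩
    have hJ' : (J : FractionalIdeal O⁰ K) ^ 2 = (Ideal.span {a} : Ideal O) := by
      have := congrArg Units.val hJ
      rw [coe_toPrincipalIdeal, hx] at this
      rw [FractionalIdeal.coeIdeal_span_singleton, ← this]
      simp
    have hle : (J : FractionalIdeal O⁰ K) ≤ 1 :=
      FractionalIdeal.le_one_of_sq_le_one (hJ'.le.trans FractionalIdeal.coeIdeal_le_one)
    obtain ⟨I, hI⟩ := FractionalIdeal.le_one_iff_exists_coeIdeal.1 hle
    refine ⟨I, ?_⟩
    rw [← hI, ← FractionalIdeal.coeIdeal_pow] at hJ'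
    exact FractionalIdeal.coeIdeal_injective hJ'
  · rintro ⟨I, hI⟩
    have hI0 : I ≠ 0 := by
      rintro rfl
      rw [zero_pow two_ne_zero] at hI
      exact ha (Ideal.span_singleton_eq_bot.1 hI.symm)
    refine ⟨Units.mk0 (I : FractionalIdeal O⁰ K) (FractionalIdeal.coeIdeal_ne_zero.2 hI0), ?_⟩
    apply Units.ext
    rw [coe_toPrincipalIdeal, hx, ← FractionalIdeal.coeIdeal_span_singleton, ← hI,
      FractionalIdeal.coeIdeal_pow]
    simp

end Square

/-- `K` is the fraction field of `O` and a quadratic extension of the fraction field of `R`, with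
nontrivial automorphism `σ`, restricting to `τ` on `O`, and generated by the square root `θ` of
`d`. -/
structure IsQuadraticInvolution {R O K : Type*} [CommRing R] [CommRing O] [Field K] [Algebra R O]
    [Algebra O K] [Algebra R K] (σ : K →+* K) (τ : O →+* O) (θ : O) (d : R) : Prop where
  inj : Function.Injective (algebraMap R K)
  compat : ∀ y : O, algebraMap O K (τ y) = σ (algebraMap O K y)
  invol : ∀ x, σ (σ x) = x
  fixed_iff : ∀ x, σ x = x ↔ ∃ r s : R, s ≠ 0 ∧ x * algebraMap R K s = algebraMap R K r
  map_theta : τ θ = -θ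
  theta_sq : θ ^ 2 = algebraMap R O d
  d_ne : d ≠ 0
  two_ne : (2 : R) ≠ 0

/-- The units of `K` fixed by `σ`. -/
def fixedUnits {K : Type*} [Field K] (σ : K →+* K) : Subgroup Kˣ :=
  (Units.map (σ : K →* K)).eqLocus (MonoidHom.id _)

/-- The squares of the units of `K` fixed by `σ`. -/
def fixedSquares {K : Type*} [Field K] (σ : K →+* K) : Subgroup Kˣ :=
  (fixedUnits σ).map (powMonoidHom 2)

/-- The norm map `x ↦ x * σ x`. -/
def involutionNorm {K : Type*} [Field K] (σ : K →+* K) : Kˣ →* Kˣ :=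
  MonoidHom.id _ * Units.map (σ : K →* K)

theorem mem_fixedUnits {K : Type*} [Field K] {σ : K →+* K} {x : Kˣ} :
    x ∈ fixedUnits σ ↔ σ x = x := by
  exact Units.ext_iff

theorem coe_involutionNorm {K : Type*} [Field K] (σ : K →+* K) (x : Kˣ) :
    (involutionNorm σ x : K) = x * σ x := rfl

theorem mem_fixedSquares {K : Type*} [Field K] {σ : K →+* K} {x : Kˣ} :
    x ∈ fixedSquares σ ↔ ∃ y : Kˣ, σ y = y ∧ (x : K) = y ^ 2 := by
  constructor
  · rintro ⟨y, hy, rfl⟩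
    exact ⟨y, mem_fixedUnits.1 hy, by simp⟩
  · rintro ⟨y, hy, hxy⟩
    exact ⟨y, mem_fixedUnits.2 hy, Units.ext (by simp [hxy])⟩

theorem fixedSquares_le_fixedUnits {K : Type*} [Field K] (σ : K →+* K) :
    fixedSquares σ ≤ fixedUnits σ := by
  rintro _ ⟨y, hy, rfl⟩
  exact Subgroup.pow_mem _ hy 2

theorem fixedSquares_le_unitSquares {K : Type*} [Field K] (σ : K →+* K) :
    fixedSquares σ ≤ unitSquares K := by
  rintro _ ⟨y, hy, rfl⟩
  exact ⟨y, rfl⟩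

namespace IsQuadraticInvolution

variable {R O K : Type*} [CommRing R] [CommRing O] [IsDedekindDomain O]
  [Field K] [Algebra R O] [Algebra O K] [Algebra R K] [IsScalarTower R O K] [IsFractionRing O K]
  {σ : K →+* K} {τ : O →+* O} {θ : O} {d : R}

section

variable (h : IsQuadraticInvolution (R := R) σ τ θ d)
include h

theorem injO : Function.Injective (algebraMap R O) := by
  intro a b hab
  apply h.inj
  rw [IsScalarTower.algebraMap_apply R O K, hab, ← IsScalarTower.algebraMap_apply]

theorem two_ne_zero' : (2 : K) ≠ 0 := by
  have := h.inj.ne h.two_ne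
  rwa [map_zero, map_ofNat] at this

theorem sigma_algebraMap (r : R) [Nontrivial R] : σ (algebraMap R K r) = algebraMap R K r :=
  (h.fixed_iff _).2 ⟨r, 1, one_ne_zero, by simp⟩

theorem tau_algebraMap [Nontrivial R] (r : R) : τ (algebraMap R O r) = algebraMap R O r := by
  apply IsFractionRing.injective O K
  rw [h.compat, ← IsScalarTower.algebraMap_apply, h.sigma_algebraMap]

theorem tau_tau (y : O) : τ (τ y) = y := by
  apply IsFractionRing.injective O K
  rw [h.compat, h.compat, h.invol]

theorem theta_ne : θ ≠ 0 := by
  intro h0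
  have := h.theta_sq
  rw [h0, zero_pow two_ne_zero] at this
  exact h.d_ne (h.injO (by rw [← this, map_zero]))

theorem sigma_theta : σ (algebraMap O K θ) = - algebraMap O K θ := by
  rw [← h.compat, h.map_theta, map_neg]

/-- Hilbert's Theorem 90, in the form: an element whose norm is the square of a fixed element is
the product of a fixed element and a square. -/
theorem comap_involutionNorm [Nontrivial R] :
    (fixedSquares σ).comap (involutionNorm σ) = fixedUnits σ ⊔ unitSquares K := by
  apply le_antisymm
  · intro x hx
    obtain ⟨c, hc, hxc⟩ := mem_fixedSquares.1 (Subgroup.mem_comap.1 hx)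
    rw [coe_involutionNorm] at hxc
    -- `y = x / c` has norm one
    set y : K := x / c with hy
    have hyn : y * σ y = 1 := by
      rw [hy, map_div₀, hc]
      field_simp
      exact hxc
    have hc0 := c.ne_zero
    -- it suffices to find `l` with `l = y * σ l`
    have main : ∃ l : K, l ≠ 0 ∧ l = y * σ l := by
      by_cases hy1 : 1 + y = 0
      · refine ⟨algebraMap O K θ, ?_, ?_⟩
        · simpa using h.theta_ne
        · rw [h.sigma_theta, eq_neg_of_add_eq_zero_right hy1]; ring
      · exact ⟨1 + y, hy1, by rw [map_add, map_one, mul_add, hyn]; ring⟩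
    obtain ⟨l, hl0, hl⟩ := main
    have hl' : σ l ≠ 0 := by simpa using hl0
    rw [Subgroup.mem_sup]
    refine ⟨c * (Units.mk0 (l * σ l) (mul_ne_zero hl0 hl'))⁻¹, ?_, (Units.mk0 l hl0) ^ 2,
      ⟨_, rfl⟩, ?_⟩
    · refine mul_mem (mem_fixedUnits.2 hc) (inv_mem (mem_fixedUnits.2 ?_))
      simp only [Units.val_mk0, map_mul, h.invol]
      ring
    · apply Units.ext
      push_cast [Units.val_mk0]
      have : (x : K) = c * y := by rw [hy]; field_simp
      clear_value y
      rw [this, mul_assoc]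
      congr 1
      rw [inv_mul_eq_iff_eq_mul₀ (mul_ne_zero hl0 hl')]
      linear_combination l * hl
  · refine sup_le ?_ ?_
    · intro x hx
      have := mem_fixedUnits.1 hx
      rw [Subgroup.mem_comap, mem_fixedSquares]
      exact ⟨x, this, by rw [coe_involutionNorm, this, sq]⟩
    · rintro _ ⟨x, rfl⟩
      rw [Subgroup.mem_comap, mem_fixedSquares]
      refine ⟨involutionNorm σ x, ?_, by simp⟩
      rw [coe_involutionNorm, map_mul, h.invol, mul_comm]

theorem relIndex_fixedSquares_inf [IsDomain R] :
    (fixedSquares σ).relIndex (unitSquares K ⊓ fixedUnits σ) = 2 := by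
  have hθ : algebraMap O K θ ≠ 0 := by simpa using h.theta_ne
  set T := Units.mk0 _ hθ with hT
  have hTn : σ T ≠ T := by
    rw [hT, Units.val_mk0, h.sigma_theta]
    intro h'
    have : 2 * algebraMap O K θ = 0 := by linear_combination -h'
    rcases mul_eq_zero.1 this with h2 | h2
    · exact h.two_ne_zero' h2
    · exact hθ h2
  have h1 : unitSquares K ⊓ fixedUnits σ = fixedSquares σ ⊔ Subgroup.zpowers (T ^ 2) := by
    apply le_antisymm
    · rintro _ ⟨⟨x, rfl⟩, hx⟩
      have hx' : (σ x) ^ 2 = (x : K) ^ 2 := by simpa [mem_fixedUnits] using hx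
      rcases sq_eq_sq_iff_eq_or_eq_neg.1 hx' with h1 | h1
      · exact Subgroup.mem_sup_left (mem_fixedSquares.2 ⟨x, h1, by simp⟩)
      · rw [Subgroup.mem_sup]
        refine ⟨(x * T⁻¹) ^ 2, mem_fixedSquares.2 ⟨x * T⁻¹, ?_, by simp⟩, T ^ 2,
          Subgroup.mem_zpowers _, ?_⟩
        · simp only [Units.val_mul, Units.val_inv_eq_inv_val, map_mul, map_inv₀, h1, hT,
            Units.val_mk0, h.sigma_theta, inv_neg, neg_mul_neg]
        · simp [mul_pow]
    · refine sup_le (le_inf (fixedSquares_le_unitSquares σ) (fixedSquares_le_fixedUnits σ)) ?_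
      rw [Subgroup.zpowers_le]
      refine ⟨⟨T, rfl⟩, mem_fixedUnits.2 ?_⟩
      simp [hT, h.sigma_theta]
  rw [h1]
  apply Subgroup.relIndex_sup_zpowers_eq_two
  · intro hmem
    obtain ⟨y, hy, hyT⟩ := mem_fixedSquares.1 hmem
    rw [Units.val_pow_eq_pow_val] at hyT
    rcases sq_eq_sq_iff_eq_or_eq_neg.1 hyT with h1 | h1
    · exact hTn (by rw [h1, hy])
    · exact hTn (by rw [h1, map_neg, hy])
  · refine mem_fixedSquares.2 ⟨T ^ 2, ?_, by simp⟩
    simp [hT, h.sigma_theta]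

end

end IsQuadraticInvolution

namespace IsQuadraticInvolution

variable {R O K : Type*} [CommRing R] [IsDomain R] [IsPrincipalIdealRing R] [CommRing O]
  [IsDedekindDomain O] [Field K] [Algebra R O] [Algebra O K] [Algebra R K] [IsScalarTower R O K]
  [IsFractionRing O K] [IsIntegralClosure O R K] {σ : K →+* K} {τ : O →+* O} {θ : O} {d : R}

section

variable (h : IsQuadraticInvolution (R := R) σ τ θ d)
include h

/-- An integral element fixed by the involution comes from the base ring. -/
theorem exists_algebraMap_eq {y : O} (hy : τ y = y) : ∃ r : R, algebraMap R O r = y := by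
  have hy' : σ (algebraMap O K y) = algebraMap O K y := by rw [← h.compat, hy]
  obtain ⟨r, s, hs, hrs⟩ := (h.fixed_iff _).1 hy'
  have hyint : IsIntegral R (algebraMap O K y) := (IsIntegralClosure.isIntegral_iff (A := O)).2
    ⟨y, rfl⟩
  -- transfer to the fraction field of `R`
  have hs' : algebraMap R K s ≠ 0 := by
    intro h0; exact hs (h.inj (by rw [h0, map_zero]))
  let f : FractionRing R →+* K := IsFractionRing.lift h.inj
  have hf : f.comp (algebraMap R (FractionRing R)) = algebraMap R K := by
    ext a; exact IsFractionRing.lift_algebraMap h.inj a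
  set q : FractionRing R := algebraMap R _ r / algebraMap R _ s with hq
  have hfq : f q = algebraMap O K y := by
    rw [hq, map_div₀]
    change (f.comp _) r / (f.comp _) s = _
    rw [hf, ← hrs]; field_simp
  have hintq : IsIntegral R q := by
    obtain ⟨p, hp, hpe⟩ := hyint
    refine ⟨p, hp, f.injective ?_⟩
    rw [Polynomial.hom_eval₂, hf, hfq, hpe, map_zero]
  obtain ⟨a, ha⟩ := IsIntegrallyClosed.isIntegral_iff.1 hintq
  refine ⟨a, IsFractionRing.injective O K ?_⟩
  rw [← hfq, ← ha, ← IsScalarTower.algebraMap_apply]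
  exact (congrFun (congrArg DFunLike.coe hf) a).symm

theorem exists_mk_of_sq {x : K} {z : O} (hx : x ^ 2 = algebraMap O K z) :
    ∃ y : O, algebraMap O K y = x := by
  have : IsIntegral R (x ^ 2) := (IsIntegralClosure.isIntegral_iff (A := O)).2 ⟨z, hx.symm⟩
  exact (IsIntegralClosure.isIntegral_iff (A := O)).1 (this.of_pow two_pos)

theorem exists_mk_of_quadratic {x : K} {b c : R}
    (hx : x ^ 2 - algebraMap R K b * x + algebraMap R K c = 0) :
    ∃ y : O, algebraMap O K y = x := by
  apply (IsIntegralClosure.isIntegral_iff (A := O) (R := R)).1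
  refine ⟨Polynomial.X ^ 2 - Polynomial.C b * Polynomial.X + Polynomial.C c, ?_, ?_⟩
  · monicity!
  · simpa using hx

/-- Divisibility in `O` between elements of the base ring is divisibility in the base ring. -/
theorem dvd_of_algebraMap_dvd {a b : R} (hab : algebraMap R O a ∣ algebraMap R O b) : a ∣ b := by
  obtain ⟨y, hy⟩ := hab
  by_cases ha : a = 0
  · rw [ha, map_zero, zero_mul] at hy
    have : b = 0 := h.injO (by rw [hy, map_zero])
    rw [this]; exact dvd_zero a
  · have ha' : algebraMap R O a ≠ 0 := fun h0 => ha (h.injO (by rw [h0, map_zero]))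
    have : τ y = y := by
      apply mul_left_cancel₀ ha'
      rw [← hy, ← h.tau_algebraMap b, hy, map_mul, h.tau_algebraMap]
    obtain ⟨c, hc⟩ := h.exists_algebraMap_eq this
    exact ⟨c, h.injO (by rw [hy, map_mul, hc])⟩

/-- A prime of the base ring which does not divide `2 d` is unramified. -/
theorem not_sq_eq_span {r r' π : R} (hπ : Prime π) (hr : r = π * r') (hr' : ¬ π ∣ r')
    (hπ2 : ¬ π ∣ 2) (hπd : ¬ π ∣ d) (I : Ideal O) (hI : I ^ 2 = Ideal.span {algebraMap R O r}) :
    False := by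
  have hr0 : r ≠ 0 := by
    rintro rfl
    rcases mul_eq_zero.1 hr.symm with h1 | h1
    · exact hπ.ne_zero h1
    · exact hr' (h1 ▸ dvd_zero π)
  have hr0' : algebraMap R O r ≠ 0 := fun h0 => hr0 (h.injO (by rw [h0, map_zero]))
  have hmem : ∀ x ∈ I, ∀ y ∈ I, algebraMap R O r ∣ x * y := by
    intro x hx y hy
    rw [← Ideal.mem_span_singleton, ← hI, sq]
    exact Ideal.mul_mem_mul hx hy
  have hdiv : ∀ t a : R, ∀ y : O, ∀ z : O, algebraMap R O t = y →
      y ^ 2 = algebraMap R O (a * r) * z → π ∣ t := by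
    intro t a y z hty hyz
    have : π ∣ t ^ 2 := by
      apply h.dvd_of_algebraMap_dvd
      rw [map_pow, hty, hyz, hr, map_mul, map_mul]
      exact ⟨algebraMap R O a * algebraMap R O r' * z, by ring⟩
    exact hπ.dvd_of_dvd_pow this
  have hI2 : ∀ x ∈ I, algebraMap R O π ∣ algebraMap R O (2 * d) * x := by
    intro x hx
    obtain ⟨y, hy⟩ := hmem x hx x hx
    have hy' : τ x * τ x = algebraMap R O r * τ y := by
      rw [← map_mul, hy, map_mul, h.tau_algebraMap]
    obtain ⟨z, hz⟩ : algebraMap R O r ∣ x * τ x := by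
      have hrK : algebraMap O K (algebraMap R O r) ≠ 0 := by simpa using hr0'
      obtain ⟨z, hz⟩ := h.exists_mk_of_sq (x := algebraMap O K (x * τ x) /
        algebraMap O K (algebraMap R O r)) (z := y * τ y) (by
          rw [div_pow, div_eq_iff (pow_ne_zero 2 hrK), ← map_pow, ← map_pow, ← map_mul]
          congr 1
          linear_combination τ x * τ x * hy + algebraMap R O r * y * hy')
      refine ⟨z, IsFractionRing.injective O K ?_⟩
      rw [map_mul, map_mul _ _ z, hz, mul_div_cancel₀ _ hrK, map_mul]
    obtain ⟨t, ht⟩ := h.exists_algebraMap_eq (y := x + τ x) (by rw [map_add, h.tau_tau, add_comm])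
    obtain ⟨w, hw⟩ := h.exists_algebraMap_eq (y := (x - τ x) * θ)
      (by rw [map_mul, map_sub, h.tau_tau, h.map_theta]; ring)
    obtain ⟨t', ht'⟩ := hdiv t 1 _ (y + 2 * z + τ y) ht (by
      rw [one_mul]; linear_combination hy + hy' + 2 * hz)
    obtain ⟨w', hw'⟩ := hdiv w d _ (y - 2 * z + τ y) hw (by
      rw [mul_pow, h.theta_sq, map_mul]
      linear_combination algebraMap R O d * (hy + hy' - 2 * hz))
    refine ⟨algebraMap R O d * algebraMap R O t' + algebraMap R O w' * θ, ?_⟩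
    rw [ht', map_mul] at ht
    rw [hw', map_mul] at hw
    rw [map_mul, map_ofNat]
    linear_combination (-algebraMap R O d) * ht - θ * hw - (x - τ x) * h.theta_sq
  have hle : Ideal.span {algebraMap R O (2 * d)} * I ≤ Ideal.span {algebraMap R O π} := by
    rw [Ideal.span_singleton_mul_le_iff]
    intro x hx
    rw [Ideal.mem_span_singleton]
    exact hI2 x hx
  have hle2 := Ideal.mul_mono hle hle
  rw [mul_mul_mul_comm, ← sq I, hI, Ideal.span_singleton_mul_span_singleton,
    Ideal.span_singleton_mul_span_singleton, Ideal.span_singleton_mul_span_singleton,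
    Ideal.span_singleton_le_span_singleton, ← map_mul, ← map_mul, ← map_mul] at hle2
  have h3 := h.dvd_of_algebraMap_dvd hle2
  rw [hr, show 2 * d * (2 * d) * (π * r') = π * (2 * d * (2 * d) * r') by ring] at h3
  have h4 := (mul_dvd_mul_iff_left hπ.ne_zero).1 h3
  rcases hπ.dvd_or_dvd h4 with h5 | h5
  · rcases hπ.dvd_or_dvd h5 with h6 | h6 <;> rcases hπ.dvd_or_dvd h6 with h7 | h7
    all_goals first | exact hπ2 h7 | exact hπd h7
  · exact hr' h5

/-- A prime of the base ring dividing `d` exactly once is ramified. -/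
theorem exists_sq_eq_span {π d' : R} (hπ : Prime π) (hd : d = π * d') (hd' : ¬ π ∣ d') :
    ∃ I : Ideal O, I ^ 2 = Ideal.span {algebraMap R O π} := by
  have hcop : IsCoprime π d' := (hπ.irreducible.coprime_iff_not_dvd).2 hd'
  obtain ⟨a, b, hab⟩ := hcop
  have hθ := h.theta_sq
  rw [hd, map_mul] at hθ
  have hab' : algebraMap R O a * algebraMap R O π + algebraMap R O b * algebraMap R O d' = 1 := by
    rw [← map_mul, ← map_mul, ← map_add, hab, map_one]
  refine ⟨Ideal.span {algebraMap R O π, θ}, le_antisymm ?_ ?_⟩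
  · rw [sq, Ideal.span_pair_mul_span_pair, Ideal.span_le]
    rintro x (rfl | rfl | rfl | rfl) <;> rw [SetLike.mem_coe, Ideal.mem_span_singleton]
    · exact ⟨_, rfl⟩
    · exact ⟨_, rfl⟩
    · exact ⟨θ, mul_comm _ _⟩
    · exact ⟨algebraMap R O d', by rw [← sq, hθ]⟩
  · rw [Ideal.span_singleton_le_iff_mem, sq]
    have h1 : algebraMap R O π ∈ Ideal.span {algebraMap R O π, θ} :=
      Ideal.subset_span (by simp)
    have h2 : θ ∈ Ideal.span {algebraMap R O π, θ} := Ideal.subset_span (by simp)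
    have h3 : algebraMap R O π = algebraMap R O a * (algebraMap R O π * algebraMap R O π) +
        algebraMap R O b * (θ * θ) := by
      linear_combination (-algebraMap R O π) * hab' - algebraMap R O b * hθ
    have h4 := add_mem (Ideal.mul_mem_left _ (algebraMap R O a) (Ideal.mul_mem_mul h1 h1))
      (Ideal.mul_mem_left _ (algebraMap R O b) (Ideal.mul_mem_mul h2 h2))
    rwa [← h3] at h4

/-- For an ideal whose square is principal, the norm of a generator of the square is a unit times
the square of an element of the base ring. -/
theorem norm_eq_unit_mul_sq {a : O} (ha : a ≠ 0) {I : Ideal O} (hI : I ^ 2 = Ideal.span {a}) :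
    ∃ (g : R) (u : Oˣ), g ≠ 0 ∧ a * τ a = u * algebraMap R O g ^ 2 := by
  -- `g` generates the norm of `I`
  have hn : ∀ x : O, ∃ r : R, algebraMap R O r = x * τ x := fun x =>
    h.exists_algebraMap_eq (by rw [map_mul, h.tau_tau, mul_comm])
  choose N hN using hn
  obtain ⟨g, hg⟩ := (IsPrincipalIdealRing.principal (Ideal.span (N '' I))).principal
  rw [Ideal.submodule_span_eq] at hg
  have hIτ : (I.map τ) ^ 2 = Ideal.span {τ a} := by
    rw [← Ideal.map_pow, hI, Ideal.map_span, Set.image_singleton]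
  have hgN : ∀ x ∈ I, g ∣ N x := fun x hx => by
    rw [← Ideal.mem_span_singleton, ← hg]
    exact Ideal.subset_span ⟨x, hx, rfl⟩
  have hτI : I ≠ ⊥ := by
    rintro rfl
    rw [Ideal.bot_pow two_ne_zero] at hI
    exact ha (Ideal.span_singleton_eq_bot.1 hI.symm)
  have hτinj : ∀ x : O, τ x = 0 → x = 0 := fun x hx => by rw [← h.tau_tau x, hx, map_zero]
  have hg0 : g ≠ 0 := by
    rintro rfl
    obtain ⟨x, hx, hx0⟩ := Submodule.exists_mem_ne_zero_of_ne_bot hτI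
    have := hgN x hx
    rw [zero_dvd_iff] at this
    have h1 := hN x
    rw [this, map_zero] at h1
    rcases mul_eq_zero.1 h1.symm with h2 | h2
    · exact hx0 h2
    · exact hx0 (hτinj x h2)
  have hgO : algebraMap R O g ≠ 0 := fun h0 => hg0 (h.injO (by rw [h0, map_zero]))
  have hgK : algebraMap R K g ≠ 0 := fun h0 => hg0 (h.inj (by rw [h0, map_zero]))
  have key : I * I.map τ = Ideal.span {algebraMap R O g} := by
    apply le_antisymm
    · have : I.map τ = Ideal.span (τ '' I) := rfl
      rw [this]
      nth_rewrite 1 [← Ideal.span_eq I]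
      rw [Ideal.span_mul_span', Ideal.span_le]
      rintro _ ⟨x, hx, _, ⟨y, hy, rfl⟩, rfl⟩
      change x * τ y ∈ _
      rw [SetLike.mem_coe, Ideal.mem_span_singleton]
      obtain ⟨n1, h1⟩ := hgN x hx
      obtain ⟨n2, h2⟩ := hgN y hy
      obtain ⟨n3, h3⟩ := hgN (x + y) (add_mem hx hy)
      have e1 := hN x
      have e2 := hN y
      have e3 := hN (x + y)
      rw [h1, map_mul] at e1
      rw [h2, map_mul] at e2
      rw [h3, map_mul, map_add] at e3
      have tr : x * τ y + y * τ x = algebraMap R O g * (algebraMap R O (n3 - n1 - n2)) := by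
        rw [map_sub, map_sub]
        linear_combination e1 + e2 - e3
      have nm : (x * τ y) * (y * τ x) = algebraMap R O g ^ 2 * algebraMap R O (n1 * n2) := by
        rw [map_mul]
        linear_combination (-y * τ y) * e1 - algebraMap R O g * algebraMap R O n1 * e2
      obtain ⟨z, hz⟩ := h.exists_mk_of_quadratic (x := algebraMap O K (x * τ y) / algebraMap R K g)
        (b := n3 - n1 - n2) (c := n1 * n2) (by
          have trK := congrArg (algebraMap O K) tr
          have nmK := congrArg (algebraMap O K) nm
          simp only [map_add, map_mul, map_pow, ← IsScalarTower.algebraMap_apply R O K]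
            at trK nmK ⊢
          field_simp
          linear_combination (algebraMap O K x * algebraMap O K (τ y)) * trK - nmK)
      refine ⟨z, IsFractionRing.injective O K ?_⟩
      rw [map_mul _ _ z, hz, ← IsScalarTower.algebraMap_apply, mul_div_cancel₀ _ hgK]
    · have h1 : Ideal.span (N '' I) ≤ (I * I.map τ).comap (algebraMap R O) := by
        rw [Ideal.span_le]
        rintro _ ⟨x, hx, rfl⟩
        rw [SetLike.mem_coe, Ideal.mem_comap, hN]
        exact Ideal.mul_mem_mul hx (Ideal.mem_map_of_mem τ hx)
      rw [Ideal.span_singleton_le_iff_mem, ← Ideal.mem_comap]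
      apply h1
      rw [hg]
      exact Ideal.mem_span_singleton_self g
  have h2 : Ideal.span {a * τ a} = Ideal.span {algebraMap R O g ^ 2} := by
    rw [← Ideal.span_singleton_mul_span_singleton, ← hI, ← hIτ, ← mul_pow, key,
      Ideal.span_singleton_pow]
  obtain ⟨u, hu⟩ := (Ideal.span_singleton_eq_span_singleton.1 h2).symm
  exact ⟨g, u, hg0, by rw [← hu, mul_comm]⟩

end

end IsQuadraticInvolution

namespace IsQuadraticInvolution

variable {R O K : Type*} [CommRing R] [IsDomain R] [IsPrincipalIdealRing R] [CommRing O]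
  [IsDedekindDomain O] [Field K] [Algebra R O] [Algebra O K] [Algebra R K] [IsScalarTower R O K]
  [IsFractionRing O K] [IsIntegralClosure O R K] {σ : K →+* K} {τ : O →+* O} {θ : O} {d : R}

section

variable (h : IsQuadraticInvolution (R := R) σ τ θ d)
include h

theorem map_ne_zero' {r : R} (hr : r ≠ 0) : algebraMap R K r ≠ 0 :=
  fun h0 => hr (h.inj (by rw [h0, map_zero]))

theorem exists_coprime_of_fixed {x : K} (hx : σ x = x) :
    ∃ b c : R, c ≠ 0 ∧ IsCoprime b c ∧ x * algebraMap R K c = algebraMap R K b := by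
  obtain ⟨r, s, hs, hrs⟩ := (h.fixed_iff x).1 hx
  obtain ⟨g, hg⟩ := (IsPrincipalIdealRing.principal (Ideal.span {r, s})).principal
  rw [Ideal.submodule_span_eq] at hg
  have hr : r ∈ Ideal.span {g} := hg ▸ Ideal.subset_span (by simp)
  have hs' : s ∈ Ideal.span {g} := hg ▸ Ideal.subset_span (by simp)
  have hgm : g ∈ Ideal.span {r, s} := hg ▸ Ideal.mem_span_singleton_self g
  obtain ⟨b, rfl⟩ := Ideal.mem_span_singleton.1 hr
  obtain ⟨c, rfl⟩ := Ideal.mem_span_singleton.1 hs'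
  obtain ⟨u, v, huv⟩ := Ideal.mem_span_pair.1 hgm
  have hg0 : g ≠ 0 := left_ne_zero_of_mul hs
  refine ⟨b, c, right_ne_zero_of_mul hs, ⟨u, v, ?_⟩, ?_⟩
  · apply mul_left_cancel₀ hg0
    linear_combination huv
  · apply mul_left_cancel₀ (h.map_ne_zero' hg0)
    rw [map_mul, map_mul] at hrs
    linear_combination hrs

theorem exists_unit_of_fixed {x : Kˣ} (hx : x ∈ integralUnits O K ⊓ fixedUnits σ) :
    ∃ u : Rˣ, (x : K) = algebraMap R K u := by
  obtain ⟨⟨y, hy⟩, hxf⟩ := hx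
  have hyx : algebraMap O K y = x := by rw [← hy]; rfl
  have hyx' : algebraMap O K (y⁻¹ : Oˣ) = (x⁻¹ : Kˣ) := by rw [← hy]; rfl
  rw [SetLike.mem_coe] at hxf
  have fix : ∀ (z : Oˣ) (w : Kˣ), algebraMap O K z = w → σ w = w →
      ∃ r : R, algebraMap R K r = w := by
    intro z w hzw hw
    obtain ⟨r, hr⟩ := h.exists_algebraMap_eq (y := (z : O))
      (IsFractionRing.injective O K (by rw [h.compat, hzw, hw]))
    exact ⟨r, by rw [IsScalarTower.algebraMap_apply R O K, hr, hzw]⟩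
  obtain ⟨r, hr⟩ := fix y x hyx (mem_fixedUnits.1 hxf)
  obtain ⟨s, hs⟩ := fix y⁻¹ x⁻¹ hyx' (mem_fixedUnits.1 (inv_mem hxf))
  have hrs : r * s = 1 := h.inj (by rw [map_mul, hr, hs, map_one, Units.mul_inv])
  exact ⟨⟨r, s, hrs, by rw [mul_comm, hrs]⟩, hr.symm⟩

theorem map_involutionNorm_sup :
    (idealSquares O K).map (involutionNorm σ) ⊔ fixedSquares σ =
      integralUnits O K ⊓ fixedUnits σ ⊓ (involutionNorm σ).range ⊔ fixedSquares σ := by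
  have hfixN : ∀ x : Kˣ, involutionNorm σ x ∈ fixedUnits σ := fun x => by
    rw [mem_fixedUnits, coe_involutionNorm, map_mul, h.invol, mul_comm]
  apply le_antisymm
  · refine sup_le ?_ le_sup_right
    rintro _ ⟨x, hx, rfl⟩
    obtain ⟨a, s, hs, hxas⟩ := IsFractionRing.div_surjective (A := O) (x : K)
    have hs0 : algebraMap O K s ≠ 0 := by
      simpa using nonZeroDivisors.ne_zero hs
    set w : Kˣ := Units.mk0 _ hs0 with hw
    have hxw : ((x * w ^ 2 : Kˣ) : K) = algebraMap O K (a * s) := by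
      rw [Units.val_mul, Units.val_pow_eq_pow_val, hw, Units.val_mk0, ← hxas, map_mul]
      field_simp
    have hmem : x * w ^ 2 ∈ idealSquares O K :=
      mul_mem hx (unitSquares_le_idealSquares O K ⟨w, rfl⟩)
    obtain ⟨I, hI⟩ := (mem_idealSquares_iff hxw).1 hmem
    have has : a * s ≠ 0 := by
      intro h0; rw [h0, map_zero] at hxw; exact Units.ne_zero _ hxw
    obtain ⟨g, u, hg, hgu⟩ := h.norm_eq_unit_mul_sq has hI
    have hg0 := h.map_ne_zero' hg
    set G : Kˣ := Units.mk0 _ hg0 with hG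
    have hGf : G ∈ fixedUnits σ := mem_fixedUnits.2 (h.sigma_algebraMap g)
    set U : Kˣ := Units.map (algebraMap O K : O →* K) u with hU
    have hUn : U = involutionNorm σ (x * w ^ 2 * G⁻¹) := by
      rw [map_mul, map_inv, eq_mul_inv_iff_mul_eq]
      apply Units.ext
      rw [Units.val_mul, coe_involutionNorm, coe_involutionNorm, hxw, ← h.compat, ← map_mul, hgu,
        mem_fixedUnits.1 hGf, map_mul, map_pow, ← IsScalarTower.algebraMap_apply]
      simp [hU, hG, sq]
    have : involutionNorm σ x = U * (G * (involutionNorm σ w)⁻¹) ^ 2 := by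
      have hGG : involutionNorm σ G = G ^ 2 := by
        apply Units.ext
        rw [coe_involutionNorm, mem_fixedUnits.1 hGf, Units.val_pow_eq_pow_val, sq]
      rw [hUn, map_mul, map_mul, map_inv, map_pow, hGG]
      rw [mul_pow, inv_pow]
      simp [mul_assoc]
    rw [this]
    refine mul_mem (Subgroup.mem_sup_left ⟨⟨⟨u, rfl⟩, ?_⟩, ?_⟩) (Subgroup.mem_sup_right
      ⟨_, mul_mem hGf (inv_mem (hfixN w)), rfl⟩)
    · rw [hUn]
      exact hfixN _
    · exact ⟨_, hUn.symm⟩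
  · refine sup_le ?_ le_sup_right
    rintro _ ⟨hu, ⟨γ, rfl⟩⟩
    obtain ⟨u, hu⟩ := h.exists_unit_of_fixed hu
    rw [coe_involutionNorm] at hu
    obtain ⟨b, c, hc, hbc, htr⟩ := h.exists_coprime_of_fixed (x := γ + σ γ)
      (by rw [map_add, h.invol, add_comm])
    have hc0 := h.map_ne_zero' hc
    obtain ⟨y, hy⟩ := h.exists_mk_of_quadratic (x := algebraMap R K c * γ) (b := b)
      (c := u * c ^ 2) (by
        rw [map_mul, map_pow, ← hu, ← htr]; ring)
    have hyq : y ^ 2 - algebraMap R O b * y + algebraMap R O (u * c ^ 2) = 0 := by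
      apply IsFractionRing.injective O K
      rw [map_add, map_sub, map_mul, map_pow, hy, map_zero, ← IsScalarTower.algebraMap_apply,
        ← IsScalarTower.algebraMap_apply, map_mul, map_pow, ← hu, ← htr]
      ring
    rw [map_mul, map_pow] at hyq
    set C : Kˣ := Units.mk0 _ hc0 with hC
    have hCf : C ∈ fixedUnits σ := mem_fixedUnits.2 (h.sigma_algebraMap c)
    have hmem : C * γ ∈ idealSquares O K := by
      rw [mem_idealSquares_iff (a := y) (by rw [hy]; simp [hC])]
      refine ⟨Ideal.span {algebraMap R O c, y}, le_antisymm ?_ ?_⟩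
      · rw [sq, Ideal.span_pair_mul_span_pair, Ideal.span_le]
        rintro x (rfl | rfl | rfl | rfl) <;> rw [SetLike.mem_coe, Ideal.mem_span_singleton]
        · have huu : algebraMap R O (u⁻¹ : Rˣ) * algebraMap R O u = 1 := by
            rw [← map_mul, Units.inv_mul, map_one]
          refine ⟨algebraMap R O (u⁻¹ : Rˣ) * (algebraMap R O b - y), ?_⟩
          linear_combination (-algebraMap R O c ^ 2) * huu + algebraMap R O (u⁻¹ : Rˣ) * hyq
        · exact ⟨_, mul_comm _ _⟩
        · exact ⟨_, rfl⟩
        · exact ⟨_, rfl⟩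
      · rw [Ideal.span_singleton_le_iff_mem, sq]
        have h1 : algebraMap R O c ∈ Ideal.span {algebraMap R O c, y} :=
          Ideal.subset_span (by simp)
        have h2 : y ∈ Ideal.span {algebraMap R O c, y} := Ideal.subset_span (by simp)
        obtain ⟨v, w, hvw⟩ := hbc
        have hvw' :
            algebraMap R O v * algebraMap R O b + algebraMap R O w * algebraMap R O c = 1 := by
          rw [← map_mul, ← map_mul, ← map_add, hvw, map_one]
        have h3 := add_mem (add_mem
          (Ideal.mul_mem_left _ (algebraMap R O v) (Ideal.mul_mem_mul h2 h2))
          (Ideal.mul_mem_left _ (algebraMap R O v * algebraMap R O u) (Ideal.mul_mem_mul h1 h1)))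
          (Ideal.mul_mem_left _ (algebraMap R O w) (Ideal.mul_mem_mul h1 h2))
        convert h3 using 1
        linear_combination (-y) * hvw' - algebraMap R O v * hyq
    have h1 : involutionNorm σ γ = involutionNorm σ (C * γ) * (C⁻¹) ^ 2 := by
      have hGG : involutionNorm σ C = C ^ 2 := by
        apply Units.ext
        rw [coe_involutionNorm, mem_fixedUnits.1 hCf, Units.val_pow_eq_pow_val, sq]
      rw [map_mul, hGG, inv_pow, mul_comm (C ^ 2), mul_inv_cancel_right]
    rw [h1]
    exact mul_mem (Subgroup.mem_sup_left ⟨_, hmem, rfl⟩)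
      (Subgroup.mem_sup_right ⟨_, inv_mem hCf, rfl⟩)

/-- The ambiguous class number formula, in terms of indices of subgroups of `Kˣ`. -/
theorem relIndex_mul_relIndex_norm :
    (fixedSquares σ).relIndex (idealSquares O K ⊓ fixedUnits σ) *
      (fixedSquares σ).relIndex
        (integralUnits O K ⊓ fixedUnits σ ⊓ (involutionNorm σ).range) =
      2 * (unitSquares K).relIndex (idealSquares O K) := by
  set A := idealSquares O K
  set S := unitSquares K
  set F := fixedUnits σ
  set Q := fixedSquares σ
  have hSA : S ≤ A := unitSquares_le_idealSquares O K
  have hQS : Q ≤ S := fixedSquares_le_unitSquares σ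
  have hQF : Q ≤ F := fixedSquares_le_fixedUnits σ
  have e1 : S.relIndex (A ⊓ F ⊔ S) * (A ⊓ F ⊔ S).relIndex A = S.relIndex A :=
    Subgroup.relIndex_mul_relIndex _ _ _ le_sup_right (sup_le inf_le_left hSA)
  have e2 : A ⊓ F ⊔ S = (F ⊔ S) ⊓ A := by
    rw [sup_comm F S, sup_inf_assoc_of_le F hSA, inf_comm F A, sup_comm]
  have e3 : (A ⊓ F ⊔ S).relIndex A =
      Q.relIndex (integralUnits O K ⊓ F ⊓ (involutionNorm σ).range) := by
    rw [e2, Subgroup.inf_relIndex_right, ← h.comap_involutionNorm, Subgroup.relIndex_comap,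
      ← Subgroup.relIndex_sup_right, h.map_involutionNorm_sup, Subgroup.relIndex_sup_right]
  have e4 : S.relIndex (A ⊓ F ⊔ S) = (S ⊓ F).relIndex (A ⊓ F) := by
    rw [Subgroup.relIndex_sup_right, ← Subgroup.inf_relIndex_right, ← inf_assoc,
      inf_eq_left.2 hSA]
  have e5 : Q.relIndex (S ⊓ F) * (S ⊓ F).relIndex (A ⊓ F) = Q.relIndex (A ⊓ F) :=
    Subgroup.relIndex_mul_relIndex _ _ _ (le_inf hQS hQF) (inf_le_inf_right F hSA)
  rw [h.relIndex_fixedSquares_inf] at e5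
  rw [← e1, e3, e4, ← e5, mul_assoc]

end

end IsQuadraticInvolution

/-- The unit of `K` given by a nonzero element of `R` (and `1` for the elements mapping to `0`). -/
noncomputable def baseUnit {R : Type*} (K : Type*) [CommRing R] [Field K] [Algebra R K] (r : R) :
    Kˣ := by
  classical exact if h : algebraMap R K r = 0 then 1 else Units.mk0 _ h

/-- The elements of `Kˣ` of the form `r * c ^ 2 / s ^ 2`, with `r` not divisible by `π`. -/
def coprimeModSquares {R : Type*} (K : Type*) [CommRing R] [IsDomain R] [Field K] [Algebra R K]
    (π : R) (hπ : Prime π) : Subgroup Kˣ where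
  carrier := {x | ∃ r s c : R, ¬ π ∣ r ∧ s ≠ 0 ∧ c ≠ 0 ∧
    (x : K) * algebraMap R K s ^ 2 = algebraMap R K r * algebraMap R K c ^ 2}
  one_mem' := ⟨1, 1, 1, fun h => hπ.not_isUnit (isUnit_of_dvd_one h), one_ne_zero, one_ne_zero,
    by simp⟩
  mul_mem' := by
    rintro x y ⟨r, s, c, hr, hs, hc, hx⟩ ⟨r', s', c', hr', hs', hc', hy⟩
    refine ⟨r * r', s * s', c * c', fun h => ?_, mul_ne_zero hs hs', mul_ne_zero hc hc', ?_⟩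
    · rcases hπ.dvd_or_dvd h with h | h
      · exact hr h
      · exact hr' h
    · simp only [map_mul, Units.val_mul, mul_pow]
      linear_combination (y * algebraMap R K s' ^ 2 : K) * hx +
        (algebraMap R K r * algebraMap R K c ^ 2) * hy
  inv_mem' := by
    rintro x ⟨r, s, c, hr, hs, hc, hx⟩
    have hr0 : r ≠ 0 := fun h => hr (h ▸ dvd_zero π)
    refine ⟨r, r * c, s, hr, mul_ne_zero hr0 hc, hs, ?_⟩
    have hx0 : ((x⁻¹ : Kˣ) : K) * x = 1 := by simp
    rw [map_mul, mul_pow]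
    linear_combination (-(x⁻¹ : Kˣ) * algebraMap R K r : K) * hx +
      (algebraMap R K r * algebraMap R K s ^ 2) * hx0

theorem Prime.mul_sq_ne_mul_sq {R : Type*} [CommRing R] [IsDomain R] [IsPrincipalIdealRing R]
    {π r s c : R} (hπ : Prime π) (hr : ¬ π ∣ r) (hs : s ≠ 0) (hc : c ≠ 0) :
    π * s ^ 2 ≠ r * c ^ 2 := by
  intro heq
  have hfin : ∀ a : R, a ≠ 0 → FiniteMultiplicity π a := fun a ha =>
    FiniteMultiplicity.of_prime_left hπ ha
  have hr0 : r ≠ 0 := fun h => hr (h ▸ dvd_zero π)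
  have h1 := congrArg (multiplicity π) heq
  rw [multiplicity_mul hπ (hfin _ (mul_ne_zero hπ.ne_zero (pow_ne_zero 2 hs))),
    multiplicity_mul hπ (hfin _ (mul_ne_zero hr0 (pow_ne_zero 2 hc))),
    (hfin s hs).multiplicity_pow hπ, (hfin c hc).multiplicity_pow hπ, multiplicity_self,
    multiplicity_eq_zero.2 hr] at h1
  omega

namespace IsQuadraticInvolution

variable {R O K : Type*} [CommRing R] [IsDomain R] [IsPrincipalIdealRing R] [CommRing O]
  [IsDedekindDomain O] [Field K] [Algebra R O] [Algebra O K] [Algebra R K] [IsScalarTower R O K]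
  [IsFractionRing O K] [IsIntegralClosure O R K] {σ : K →+* K} {τ : O →+* O} {θ : O} {d : R}

section

variable (h : IsQuadraticInvolution (R := R) σ τ θ d)
include h

theorem coe_baseUnit {r : R} (hr : r ≠ 0) : (baseUnit K r : K) = algebraMap R K r := by
  rw [baseUnit, dif_neg (h.map_ne_zero' hr), Units.val_mk0]

theorem baseUnit_mul {r s : R} (hr : r ≠ 0) (hs : s ≠ 0) :
    baseUnit K (r * s) = baseUnit K r * baseUnit K s := by
  apply Units.ext
  rw [Units.val_mul, h.coe_baseUnit hr, h.coe_baseUnit hs, h.coe_baseUnit (mul_ne_zero hr hs),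
    map_mul]

theorem baseUnit_mem {r : R} (hr : r ≠ 0) : baseUnit K r ∈ fixedUnits σ := by
  rw [mem_fixedUnits, h.coe_baseUnit hr, h.sigma_algebraMap]

theorem baseUnit_unit_mem {r : R} (hr : IsUnit r) :
    baseUnit K r ∈ integralUnits O K ⊓ fixedUnits σ := by
  refine ⟨?_, h.baseUnit_mem hr.ne_zero⟩
  obtain ⟨u, rfl⟩ := hr
  refine ⟨Units.map (algebraMap R O : R →* O) u, ?_⟩
  apply Units.ext
  rw [h.coe_baseUnit u.ne_zero, IsScalarTower.algebraMap_apply R O K]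
  rfl

theorem coe_baseUnit' {r : R} (hr : r ≠ 0) :
    (baseUnit K r : K) = algebraMap O K (algebraMap R O r) := by
  rw [h.coe_baseUnit hr, IsScalarTower.algebraMap_apply R O K]

/-- The group of classes of fixed elements whose ideal is a square is generated by the units and
the ramified primes. -/
theorem baseUnit_mem_of_mem_idealSquares {P : Set R} (hP : ∀ π ∈ P, Prime π)
    (hPd : ∀ π ∈ P, ∃ d', d = π * d' ∧ ¬ π ∣ d')
    (hP2 : ∀ π, Prime π → π ∣ 2 * d → ∃ π' ∈ P, Associated π π') (a : R) (ha : a ≠ 0)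
    (hmem : baseUnit K a ∈ idealSquares O K) :
    baseUnit K a ∈ integralUnits O K ⊓ fixedUnits σ ⊔ fixedSquares σ ⊔
      Subgroup.closure (baseUnit K '' P) := by
  have hwf : WellFounded (DvdNotUnit : R → R → Prop) := wellFounded_dvdNotUnit
  induction a using hwf.induction with
  | _ a ih =>
  by_cases hu : IsUnit a
  · exact Subgroup.mem_sup_left (Subgroup.mem_sup_left (h.baseUnit_unit_mem hu))
  obtain ⟨π, hπi, hπa⟩ := WfDvdMonoid.exists_irreducible_factor hu ha
  have hπ := hπi.prime
  by_cases hπd : π ∣ 2 * d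
  · obtain ⟨π', hπ'P, hass⟩ := hP2 π hπ hπd
    have hπ' := hP π' hπ'P
    obtain ⟨a', rfl⟩ := hass.dvd_iff_dvd_left.1 hπa
    have ha' : a' ≠ 0 := right_ne_zero_of_mul ha
    obtain ⟨d', hd, hd'⟩ := hPd π' hπ'P
    have hAπ : baseUnit K π' ∈ idealSquares O K :=
      (mem_idealSquares_iff (h.coe_baseUnit' hπ'.ne_zero)).2 (h.exists_sq_eq_span hπ' hd hd')
    rw [h.baseUnit_mul hπ'.ne_zero ha'] at hmem ⊢
    refine mul_mem (Subgroup.mem_sup_right (Subgroup.subset_closure ⟨π', hπ'P, rfl⟩))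
      (ih a' ?_ ha' ?_)
    · exact ⟨ha', π', hπ'.not_isUnit, mul_comm _ _⟩
    · exact ((idealSquares O K).mul_mem_cancel_left hAπ).1 hmem
  · obtain ⟨a', rfl⟩ := hπa
    obtain ⟨I, hI⟩ := (mem_idealSquares_iff (h.coe_baseUnit' ha)).1 hmem
    have hπa' : π ∣ a' := by
      by_contra hna
      exact h.not_sq_eq_span hπ rfl hna (fun h2 => hπd (h2.mul_right d))
        (fun h2 => hπd (h2.mul_left 2)) I hI
    obtain ⟨b, rfl⟩ := hπa'
    have hb : b ≠ 0 := right_ne_zero_of_mul (right_ne_zero_of_mul ha)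
    have h0 := hπ.ne_zero
    rw [h.baseUnit_mul h0 (mul_ne_zero h0 hb), h.baseUnit_mul h0 hb, ← mul_assoc, ← sq] at hmem ⊢
    refine mul_mem (Subgroup.mem_sup_left (Subgroup.mem_sup_right
      ⟨_, h.baseUnit_mem h0, rfl⟩)) (ih b ?_ hb ?_)
    · exact ⟨hb, π * π, fun hh => hπ.not_isUnit (isUnit_of_mul_isUnit_left hh),
        by rw [← mul_assoc, mul_comm]⟩
    · exact ((idealSquares O K).mul_mem_cancel_left
        (unitSquares_le_idealSquares O K ⟨_, rfl⟩)).1 hmem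

theorem idealSquares_inf_fixedUnits {P : Set R} (hP : ∀ π ∈ P, Prime π)
    (hPd : ∀ π ∈ P, ∃ d', d = π * d' ∧ ¬ π ∣ d')
    (hP2 : ∀ π, Prime π → π ∣ 2 * d → ∃ π' ∈ P, Associated π π') :
    idealSquares O K ⊓ fixedUnits σ = integralUnits O K ⊓ fixedUnits σ ⊔ fixedSquares σ ⊔
      Subgroup.closure (baseUnit K '' P) := by
  apply le_antisymm
  · rintro x ⟨hxA, hxF⟩
    obtain ⟨r, s, hs, hrs⟩ := (h.fixed_iff x).1 (mem_fixedUnits.1 hxF)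
    have hr : r ≠ 0 := by
      rintro rfl
      rw [map_zero] at hrs
      exact mul_ne_zero x.ne_zero (h.map_ne_zero' hs) hrs
    have hx : x = baseUnit K (r * s) * (baseUnit K s)⁻¹ ^ 2 := by
      rw [inv_pow, eq_mul_inv_iff_mul_eq, h.baseUnit_mul hr hs]
      apply Units.ext
      simp only [Units.val_mul, Units.val_pow_eq_pow_val, h.coe_baseUnit hr, h.coe_baseUnit hs]
      rw [← hrs]; ring
    have hA : baseUnit K (r * s) ∈ idealSquares O K := by
      rw [hx] at hxA
      exact ((idealSquares O K).mul_mem_cancel_right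
        (unitSquares_le_idealSquares O K ⟨_, rfl⟩)).1 hxA
    rw [hx]
    exact mul_mem (h.baseUnit_mem_of_mem_idealSquares hP hPd hP2 _ (mul_ne_zero hr hs) hA)
      (Subgroup.mem_sup_left (Subgroup.mem_sup_right ⟨_, inv_mem (h.baseUnit_mem hs), rfl⟩))
  · refine sup_le (sup_le (inf_le_inf_right _ (integralUnits_le_idealSquares O K))
      (le_inf ((fixedSquares_le_unitSquares σ).trans (unitSquares_le_idealSquares O K))
        (fixedSquares_le_fixedUnits σ))) ?_
    rw [Subgroup.closure_le]
    rintro _ ⟨π, hπ, rfl⟩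
    obtain ⟨d', hd, hd'⟩ := hPd π hπ
    have hπ0 := (hP π hπ).ne_zero
    exact ⟨(mem_idealSquares_iff (h.coe_baseUnit' hπ0)).2
      (h.exists_sq_eq_span (hP π hπ) hd hd'), h.baseUnit_mem hπ0⟩

theorem relIndex_sup_closure (P : Finset R) (hP : ∀ π ∈ P, Prime π)
    (hPP : ∀ π ∈ P, ∀ π' ∈ P, π ≠ π' → ¬ π ∣ π') :
    (integralUnits O K ⊓ fixedUnits σ ⊔ fixedSquares σ).relIndex
      (integralUnits O K ⊓ fixedUnits σ ⊔ fixedSquares σ ⊔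
        Subgroup.closure (baseUnit K '' (P : Set R))) = 2 ^ P.card := by
  classical
  induction P using Finset.induction_on with
  | empty => simp
  | insert π P hπP ih =>
    have ih := ih (fun x hx => hP x (Finset.mem_insert_of_mem hx)) (fun x hx y hy =>
      hPP x (Finset.mem_insert_of_mem hx) y (Finset.mem_insert_of_mem hy))
    have hπ : Prime π := hP π (Finset.mem_insert_self _ _)
    rw [Finset.coe_insert, Set.image_insert_eq, Set.insert_eq, Subgroup.closure_union,
      ← Subgroup.zpowers_eq_closure, sup_comm (Subgroup.zpowers _), ← sup_assoc]
    rw [← Subgroup.relIndex_mul_relIndex _ _ _ (le_sup_left) (le_sup_left), ih,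
      Finset.card_insert_of_notMem hπP, pow_succ]
    congr 1
    apply Subgroup.relIndex_sup_zpowers_eq_two
    · intro hmem
      have hle : integralUnits O K ⊓ fixedUnits σ ⊔ fixedSquares σ ⊔
          Subgroup.closure (baseUnit K '' (P : Set R)) ≤ coprimeModSquares K π hπ := by
        refine sup_le (sup_le ?_ ?_) ?_
        · intro x hx
          obtain ⟨u, hu⟩ := h.exists_unit_of_fixed hx
          exact ⟨u, 1, 1, fun hd => hπ.not_isUnit (isUnit_of_dvd_unit hd u.isUnit), one_ne_zero,
            one_ne_zero, by simp [hu]⟩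
        · intro x hx
          obtain ⟨y, hy, hxy⟩ := mem_fixedSquares.1 hx
          obtain ⟨r, s, hs, hrs⟩ := (h.fixed_iff y).1 hy
          refine ⟨1, s, r, fun hd => hπ.not_isUnit (isUnit_of_dvd_one hd), hs, ?_, ?_⟩
          · rintro rfl
            rw [map_zero] at hrs
            exact mul_ne_zero y.ne_zero (h.map_ne_zero' hs) hrs
          · rw [hxy, ← hrs, map_one]; ring
        · rw [Subgroup.closure_le]
          rintro _ ⟨π', hπ', rfl⟩
          refine ⟨π', 1, 1, hPP π (Finset.mem_insert_self _ _) π'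
            (Finset.mem_insert_of_mem hπ') (by rintro rfl; exact hπP hπ'), one_ne_zero,
            one_ne_zero, ?_⟩
          rw [h.coe_baseUnit (hP π' (Finset.mem_insert_of_mem hπ')).ne_zero]
      obtain ⟨r, s, c, hr, hs, hc, heq⟩ := hle hmem
      rw [h.coe_baseUnit hπ.ne_zero, ← map_pow, ← map_pow, ← map_mul, ← map_mul] at heq
      exact hπ.mul_sq_ne_mul_sq hr hs hc (h.inj heq)
    · exact Subgroup.mem_sup_left (Subgroup.mem_sup_right ⟨_, h.baseUnit_mem hπ.ne_zero, rfl⟩)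

/-- The ambiguous class number formula. -/
theorem ambiguous_class_number (P : Finset R) (hP : ∀ π ∈ P, Prime π)
    (hPP : ∀ π ∈ P, ∀ π' ∈ P, π ≠ π' → ¬ π ∣ π')
    (hPd : ∀ π ∈ P, ∃ d', d = π * d' ∧ ¬ π ∣ d')
    (hP2 : ∀ π, Prime π → π ∣ 2 * d → ∃ π' ∈ P, Associated π π') :
    (fixedSquares σ).relIndex (integralUnits O K ⊓ fixedUnits σ) * 2 ^ P.card *
      (fixedSquares σ).relIndex
        (integralUnits O K ⊓ fixedUnits σ ⊓ (involutionNorm σ).range) =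
      2 * ((unitSquares K).relIndex (integralUnits O K) *
        Nat.card {x : ClassGroup O // x ^ 2 = 1}) := by
  rw [← relIndex_unitSquares_idealSquares, ← h.relIndex_mul_relIndex_norm,
    h.idealSquares_inf_fixedUnits (P := P) hP hPd hP2]
  congr 1
  rw [← h.relIndex_sup_closure P hP hPP, ← Subgroup.relIndex_sup_right (H := _ ⊓ _),
    Subgroup.relIndex_mul_relIndex _ _ _ le_sup_right le_sup_left]

end

end IsQuadraticInvolution

end

namespace Zsqrtd

theorem two_ne_mul_self (n : ℤ) : (2 : ℤ) ≠ n * n := by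
  intro h
  have h1 : n < 2 := by nlinarith
  have h2 : -2 < n := by nlinarith
  interval_cases n <;> omega

theorem norm_eq_zero_two {x : ℤ√2} : x.norm = 0 ↔ x = 0 :=
  norm_eq_zero two_ne_mul_self x

instance isDomain_two : IsDomain (ℤ√2) := by
  have : NoZeroDivisors (ℤ√2) := ⟨fun {a b} h => by
    have h1 := congrArg norm h
    rw [norm_mul, norm_zero, mul_eq_zero, norm_eq_zero_two, norm_eq_zero_two] at h1
    exact h1⟩
  have : Nontrivial (ℤ√2) := ⟨0, 1, fun h => by simpa using congrArg re h⟩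
  exact NoZeroDivisors.to_isDomain _

theorem _root_.Int.exists_two_mul_abs_sub_le (a : ℤ) {b : ℤ} (hb : b ≠ 0) :
    ∃ q : ℤ, 2 * |a - b * q| ≤ |b| := by
  refine ⟨round (a / b : ℚ), ?_⟩
  have h := abs_sub_round (a / b : ℚ)
  have hb' : (b : ℚ) ≠ 0 := by exact_mod_cast hb
  have h1 : (2 : ℚ) * |(a : ℚ) - b * round (a / b : ℚ)| ≤ |(b : ℚ)| := by
    have : (a : ℚ) - b * round (a / b : ℚ) = b * (a / b - round (a / b : ℚ)) := by field_simp
    rw [this, abs_mul]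
    nlinarith [abs_nonneg (b : ℚ)]
  exact_mod_cast h1

/-- Rounded division in a quadratic ring. -/
theorem exists_rounded_quotient {d : ℤ} {x : ℤ√d} (hx : x.norm ≠ 0) (y : ℤ√d) :
    ∃ (q : ℤ√d) (s t : ℤ), 2 * |s| ≤ |x.norm| ∧ 2 * |t| ≤ |x.norm| ∧
      (y - x * q).norm * x.norm = s ^ 2 - d * t ^ 2 := by
  obtain ⟨q₁, h₁⟩ := Int.exists_two_mul_abs_sub_le (y * star x).re hx
  obtain ⟨q₂, h₂⟩ := Int.exists_two_mul_abs_sub_le (y * star x).im hx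
  refine ⟨⟨q₁, q₂⟩, _, _, h₁, h₂, ?_⟩
  simp only [norm_def, re_sub, im_sub, re_mul, im_mul, re_star, im_star]
  ring

instance isPrincipalIdealRing_two : IsPrincipalIdealRing (ℤ√2) := by
  refine ⟨fun I => ?_⟩
  by_cases hI : I = ⊥
  · exact ⟨0, by rw [hI]; simp⟩
  obtain ⟨x₀, hx₀, hx₀'⟩ := Submodule.exists_mem_ne_zero_of_ne_bot hI
  have hex : ∃ m : ℕ, ∃ x ∈ I, x ≠ 0 ∧ x.norm.natAbs = m := ⟨_, x₀, hx₀, hx₀', rfl⟩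
  classical
  obtain ⟨x, hx, hx0, hxm⟩ := Nat.find_spec hex
  refine ⟨x, _root_.le_antisymm (fun y hy => ?_) ?_⟩
  · rw [Ideal.submodule_span_eq, Ideal.mem_span_singleton]
    have hn : x.norm ≠ 0 := norm_eq_zero_two.not.2 hx0
    obtain ⟨q, s, t, hs, ht, hst⟩ := exists_rounded_quotient hn y
    by_cases h0 : y - x * q = 0
    · exact ⟨q, sub_eq_zero.1 h0⟩
    · exfalso
      have hlt := Nat.find_min' hex
        ⟨y - x * q, I.sub_mem hy (I.mul_mem_right q hx), h0, rfl⟩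
      rw [← hxm] at hlt
      have hlt' : |x.norm| ≤ |(y - x * q).norm| := by
        rw [Int.abs_eq_natAbs, Int.abs_eq_natAbs]; exact_mod_cast hlt
      have h1 : |(y - x * q).norm| * |x.norm| = |s ^ 2 - 2 * t ^ 2| := by rw [← abs_mul, hst]
      have hpos : 0 < |x.norm| := abs_pos.2 hn
      have h2 : |s ^ 2 - 2 * t ^ 2| < |x.norm| ^ 2 := by
        have e1 : s ^ 2 = |s| ^ 2 := (sq_abs s).symm
        have e2 : t ^ 2 = |t| ^ 2 := (sq_abs t).symm
        have := abs_nonneg s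
        have := abs_nonneg t
        rw [e1, e2, abs_lt]
        constructor <;> nlinarith
      nlinarith
  · rw [Ideal.submodule_span_eq, Ideal.span_singleton_le_iff_mem]
    exact hx

/-- The fundamental unit `1 + √2`. -/
def fundUnit : (ℤ√2)ˣ := ⟨⟨1, 1⟩, ⟨-1, 1⟩, by ext <;> simp, by ext <;> simp⟩

theorem coe_fundUnit : (fundUnit : ℤ√2) = ⟨1, 1⟩ := rfl

theorem norm_fundUnit : (fundUnit : ℤ√2).norm = -1 := by simp [coe_fundUnit, norm_def]

theorem exists_eq_fundUnit_pow (b : ℕ) : ∀ (a : ℕ) (u : (ℤ√2)ˣ), (u : ℤ√2) = ⟨a, b⟩ →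
    ∃ m : ℕ, u = fundUnit ^ m := by
  induction b using Nat.strong_induction_on with
  | _ b ih =>
  intro a u hu
  have hnorm : (u : ℤ√2).norm = 1 ∨ (u : ℤ√2).norm = -1 := by
    have := norm_eq_one_iff.2 u.isUnit
    omega
  simp only [hu, norm_def] at hnorm
  rcases Nat.eq_zero_or_pos b with rfl | hb
  · refine ⟨0, Units.ext ?_⟩
    have : (a : ℤ) = 1 := by rcases hnorm with h | h <;> push_cast at h <;> nlinarith
    rw [hu, this]
    rfl
  · have h1 : b ≤ a := by
      by_contra! hlt
      have : (a : ℤ) + 1 ≤ b := by exact_mod_cast hlt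
      rcases hnorm with h | h <;> nlinarith
    have h2 : a ≤ 2 * b := by
      by_contra! hlt
      have : 2 * (b : ℤ) + 1 ≤ a := by exact_mod_cast hlt
      rcases hnorm with h | h <;> nlinarith
    have h3 : a < 2 * b := by
      refine lt_of_le_of_ne h2 fun h => ?_
      have : (a : ℤ) = 2 * b := by exact_mod_cast h
      rw [this] at hnorm
      rcases hnorm with h | h <;> nlinarith
    obtain ⟨m, hm⟩ := ih (a - b) (by omega) (2 * b - a) (u * fundUnit⁻¹) (by
      have : ((fundUnit⁻¹ : (ℤ√2)ˣ) : ℤ√2) = ⟨-1, 1⟩ := rfl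
      rw [Units.val_mul, this, hu]
      ext
      · simp; omega
      · simp; omega)
    exact ⟨m + 1, by rw [pow_succ, ← hm, inv_mul_cancel_right]⟩

/-- The units of `ℤ√2` modulo squares are generated by `-1` and `1 + √2`. -/
theorem unit_eq_mul_sq (u : (ℤ√2)ˣ) : ∃ w : (ℤ√2)ˣ,
    u = w ^ 2 ∨ u = -w ^ 2 ∨ u = fundUnit * w ^ 2 ∨ u = -(fundUnit * w ^ 2) := by
  -- the case of nonnegative coordinates
  have hpow : ∀ m : ℕ, ∃ w : (ℤ√2)ˣ, fundUnit ^ m = w ^ 2 ∨ fundUnit ^ m = fundUnit * w ^ 2 := by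
    intro m
    rcases Nat.even_or_odd' m with ⟨k, rfl | rfl⟩
    · exact ⟨fundUnit ^ k, Or.inl (by rw [← pow_mul, mul_comm])⟩
    · exact ⟨fundUnit ^ k, Or.inr (by rw [← pow_mul, pow_succ, mul_comm 2 k, mul_comm])⟩
  have habs : ∀ a b : ℤ, IsUnit (⟨a, b⟩ : ℤ√2) → ∃ m : ℕ, (fundUnit : ℤ√2) ^ m = ⟨|a|, |b|⟩ := by
    intro a b hab
    have : IsUnit (⟨|a|, |b|⟩ : ℤ√2) := by
      rw [← norm_eq_one_iff] at hab ⊢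
      simpa [norm_def, mul_assoc] using hab
    obtain ⟨v, hv⟩ := this
    obtain ⟨m, hm⟩ := exists_eq_fundUnit_pow b.natAbs a.natAbs v (by
      rw [hv, Int.abs_eq_natAbs, Int.abs_eq_natAbs])
    exact ⟨m, by rw [← hv, hm, Units.val_pow_eq_pow_val]⟩
  obtain ⟨m, hm⟩ := habs (u : ℤ√2).re (u : ℤ√2).im u.isUnit
  set a := (u : ℤ√2).re with ha
  set b := (u : ℤ√2).im with hb
  have hcases : (u : ℤ√2) = fundUnit ^ m ∨ (u : ℤ√2) = -fundUnit ^ m ∨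
      (u : ℤ√2) = star ((fundUnit : ℤ√2) ^ m) ∨ (u : ℤ√2) = -star ((fundUnit : ℤ√2) ^ m) := by
    rw [hm]
    have hu : (u : ℤ√2) = ⟨a, b⟩ := rfl
    rw [hu]
    rcases abs_choice a with h1 | h1 <;> rcases abs_choice b with h2 | h2 <;> rw [h1, h2]
    · left; rfl
    · right; right; left; ext <;> simp
    · right; right; right; ext <;> simp
    · right; left; ext <;> simp
  have hstar : star ((fundUnit : ℤ√2) ^ m) = ((-fundUnit⁻¹ : (ℤ√2)ˣ) : ℤ√2) ^ m := by
    rw [star_pow]; rfl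
  obtain ⟨w, hw⟩ := hpow m
  have hneg : (-fundUnit⁻¹) ^ m = fundUnit ^ m * (fundUnit⁻¹ ^ m) ^ 2 ∨
      (-fundUnit⁻¹) ^ m = -(fundUnit ^ m * (fundUnit⁻¹ ^ m) ^ 2) := by
    have h1 : fundUnit ^ m * (fundUnit⁻¹ ^ m) ^ 2 = fundUnit⁻¹ ^ m := by
      rw [sq, ← mul_assoc, ← mul_pow, mul_inv_cancel, one_pow, one_mul]
    rw [h1]
    rcases Nat.even_or_odd m with h | h
    · left; rw [h.neg_pow]
    · right; rw [h.neg_pow]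
  have hcases' : ∃ v : (ℤ√2)ˣ, u = fundUnit ^ m * v ^ 2 ∨ u = -(fundUnit ^ m * v ^ 2) := by
    rcases hcases with h | h | h | h
    · exact ⟨1, Or.inl (Units.ext (by rw [h]; simp))⟩
    · exact ⟨1, Or.inr (Units.ext (by rw [h]; simp))⟩
    · rw [hstar, ← Units.val_pow_eq_pow_val, Units.val_inj] at h
      rcases hneg with h' | h'
      · exact ⟨_, Or.inl (h.trans h')⟩
      · exact ⟨_, Or.inr (h.trans h')⟩
    · rw [hstar, ← Units.val_pow_eq_pow_val, ← Units.val_neg, Units.val_inj] at h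
      rcases hneg with h' | h'
      · exact ⟨_, Or.inr (h.trans (by rw [h']))⟩
      · exact ⟨_, Or.inl (h.trans (by rw [h', neg_neg]))⟩
  obtain ⟨v, hv⟩ := hcases'
  refine ⟨w * v, ?_⟩
  rw [mul_pow, ← mul_assoc]
  rcases hw with h | h <;> rw [h] at hv <;> tauto

end Zsqrtd

/-- The number of primes of `ℤ√2` above the odd prime `p`. -/
def primeWeight (p : ℕ) : ℕ := if p % 8 = 1 ∨ p % 8 = 7 then 2 else 1

namespace Zsqrtd

theorem isUnit_of_norm {x : ℤ√2} (h : x.norm.natAbs = 1) : IsUnit x := norm_eq_one_iff.1 h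

theorem prime_of_norm {x : ℤ√2} {p : ℕ} (hp : p.Prime) (hx : x.norm.natAbs = p) : Prime x := by
  apply Irreducible.prime
  refine ⟨fun h => hp.one_lt.ne' (by rw [← hx, norm_eq_one_iff.2 h]), fun a b hab => ?_⟩
  rw [hab, norm_mul, Int.natAbs_mul] at hx
  rcases (Nat.prime_mul_iff.1 (hx ▸ hp)) with h | h
  · exact Or.inr (isUnit_of_norm h.2)
  · exact Or.inl (isUnit_of_norm h.2)

theorem norm_natCast_mul (n : ℕ) : (n : ℤ√2).norm = n * n := norm_natCast n

theorem intCast_dvd_iff {z : ℤ} {a : ℤ√2} : (z : ℤ√2) ∣ a ↔ z ∣ a.re ∧ z ∣ a.im :=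
  intCast_dvd z a

theorem natCast_prime {p : ℕ} (hp : p.Prime) (h8 : p % 8 = 3 ∨ p % 8 = 5) :
    Prime (p : ℤ√2) := by
  have hpI : Prime (p : ℤ) := Nat.prime_iff_prime_int.1 hp
  have := Fact.mk hp
  have h2 : p ≠ 2 := by rintro rfl; omega
  have key : ∀ x : ℤ√2, (p : ℤ) ∣ x.norm → (p : ℤ√2) ∣ x := by
    intro x hx
    have hx' : ((x.re : ZMod p)) ^ 2 = 2 * (x.im : ZMod p) ^ 2 := by
      rw [← sub_eq_zero]
      have := (ZMod.intCast_zmod_eq_zero_iff_dvd x.norm p).2 hx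
      rw [norm_def] at this
      push_cast at this
      linear_combination this
    have him : (x.im : ZMod p) = 0 := by
      by_contra h0
      have : IsSquare (2 : ZMod p) := ⟨x.re / x.im, by
        rw [div_mul_div_comm, eq_div_iff (mul_ne_zero h0 h0)]; linear_combination -hx'⟩
      rw [ZMod.exists_sq_eq_two_iff h2] at this
      omega
    rw [him] at hx'
    have hre : (x.re : ZMod p) = 0 := by simpa using hx'
    rw [show (p : ℤ√2) = ((p : ℤ) : ℤ√2) by simp, intCast_dvd_iff]
    exact ⟨(ZMod.intCast_zmod_eq_zero_iff_dvd _ p).1 hre,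
      (ZMod.intCast_zmod_eq_zero_iff_dvd _ p).1 him⟩
  refine ⟨by simpa using hp.ne_zero, fun h => ?_, fun a b hab => ?_⟩
  · rw [← norm_eq_one_iff, norm_natCast_mul, Int.natAbs_mul, Int.natAbs_natCast] at h
    exact hp.one_lt.ne' (Nat.eq_one_of_mul_eq_one_left h)
  · obtain ⟨c, hc⟩ := hab
    have := congrArg norm hc
    rw [norm_mul, norm_mul, norm_natCast_mul, mul_assoc] at this
    rcases hpI.dvd_or_dvd (Dvd.intro _ this.symm) with h | h
    · exact Or.inl (key a h)
    · exact Or.inr (key b h)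

theorem exists_norm_eq {p : ℕ} (hp : p.Prime) (h8 : p % 8 = 1 ∨ p % 8 = 7) :
    ∃ x : ℤ√2, x.norm.natAbs = p := by
  have := Fact.mk hp
  have h2 : p ≠ 2 := by rintro rfl; omega
  obtain ⟨m, hm⟩ := (ZMod.exists_sq_eq_two_iff h2).2 h8
  obtain ⟨m, rfl⟩ := ZMod.intCast_surjective m
  have hdvd : (p : ℤ) ∣ m * m - 2 := by
    rw [← ZMod.intCast_zmod_eq_zero_iff_dvd]; push_cast; rw [← hm]; ring
  have hp1 : ¬ (p : ℤ) ∣ 1 := fun h => by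
    have := Int.natAbs_dvd_natAbs.2 h
    simp at this
    exact hp.one_lt.ne' this
  have hnp : ¬ Prime (p : ℤ√2) := by
    intro hpr
    have : (p : ℤ√2) ∣ ⟨m, 1⟩ * ⟨m, -1⟩ := by
      rw [show (p : ℤ√2) = ((p : ℤ) : ℤ√2) by simp, intCast_dvd_iff]
      constructor
      · simpa [← sub_eq_add_neg] using hdvd
      · simp
    rcases hpr.dvd_or_dvd this with h | h <;>
      rw [show (p : ℤ√2) = ((p : ℤ) : ℤ√2) by simp, intCast_dvd_iff] at h
    · exact hp1 h.2
    · exact hp1 (by simpa using h.2)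
  have hni : ¬ Irreducible (p : ℤ√2) := fun h => hnp h.prime
  have hnu : ¬ IsUnit (p : ℤ√2) := by
    intro h
    rw [← norm_eq_one_iff, norm_natCast_mul, Int.natAbs_mul, Int.natAbs_natCast] at h
    exact hp.one_lt.ne' (Nat.eq_one_of_mul_eq_one_left h)
  rw [irreducible_iff] at hni
  push Not at hni
  obtain ⟨a, b, hab, ha, hb⟩ := hni hnu
  have := congrArg (fun x => x.norm.natAbs) hab
  simp only [norm_mul, norm_natCast_mul, Int.natAbs_mul, Int.natAbs_natCast] at this
  rw [← norm_eq_one_iff] at ha hb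
  exact ⟨a, ((hp.mul_eq_prime_sq_iff ha hb).1 (by rw [← this, sq])).1⟩

theorem exists_prime_factors {p : ℕ} (hp : p.Prime) (h2 : p ≠ 2) : ∃ T : Finset (ℤ√2),
    (∀ π ∈ T, Prime π) ∧ (∀ π ∈ T, ∀ π' ∈ T, π ≠ π' → ¬ π ∣ π') ∧ T.card = primeWeight p ∧
    Associated (p : ℤ√2) (∏ π ∈ T, π) := by
  classical
  by_cases h8 : p % 8 = 1 ∨ p % 8 = 7
  · obtain ⟨x, hx⟩ := exists_norm_eq hp h8
    have hpx := prime_of_norm hp hx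
    have hx' : (star x).norm.natAbs = p := by rw [norm_conj, hx]
    have hpx' := prime_of_norm hp hx'
    have hass : Associated (p : ℤ√2) (x * star x) := by
      rw [← norm_eq_mul_conj]
      rcases Int.natAbs_eq_iff.1 hx with h | h <;> rw [h]
      · simp
      · exact ⟨-1, by simp⟩
    have hnd : ¬ x ∣ star x := by
      intro h
      have h1 : x ∣ x + star x := dvd_add dvd_rfl h
      have h2' : x + star x = ((2 * x.re : ℤ) : ℤ√2) := by
        ext
        · simp; ring
        · simp
      rw [h2'] at h1
      obtain ⟨c, hc⟩ := h1
      have h3 := congrArg norm hc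
      rw [norm_intCast, norm_mul] at h3
      have hpn : (p : ℤ) ∣ x.norm := Int.natCast_dvd.2 (by rw [hx])
      have h4 : (p : ℤ) ∣ 2 * x.re * (2 * x.re) := h3 ▸ hpn.mul_right _
      have hpI : Prime (p : ℤ) := Nat.prime_iff_prime_int.1 hp
      have hp2 : ¬ (p : ℤ) ∣ 2 := fun h => h2 ((Nat.prime_dvd_prime_iff_eq hp Nat.prime_two).1
        (by exact_mod_cast h))
      have hre : (p : ℤ) ∣ x.re := by
        rcases hpI.dvd_or_dvd h4 with h | h <;> rcases hpI.dvd_or_dvd h with h | h <;>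
          first | exact absurd h hp2 | exact h
      have him : (p : ℤ) ∣ x.im := by
        have : (p : ℤ) ∣ 2 * (x.im * x.im) := by
          have : 2 * (x.im * x.im) = x.re * x.re - x.norm := by rw [norm_def]; ring
          rw [this]
          exact dvd_sub (hre.mul_right _) hpn
        rcases hpI.dvd_or_dvd this with h | h
        · exact absurd h hp2
        · rcases hpI.dvd_or_dvd h with h | h <;> exact h
      obtain ⟨e, he⟩ := intCast_dvd_iff.2 ⟨hre, him⟩
      have h5 := congrArg (fun x => x.norm.natAbs) he
      simp only [norm_mul, norm_intCast, hx, Int.natAbs_mul, Int.natAbs_natCast] at h5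
      have h6 : 1 = p * e.norm.natAbs := by
        apply Nat.eq_of_mul_eq_mul_left hp.pos; rw [← mul_assoc, ← h5, mul_one]
      exact hp.one_lt.ne' (Nat.eq_one_of_mul_eq_one_right h6.symm)
    have hnd' : ¬ star x ∣ x := fun h => hnd (by
      obtain ⟨c, hc⟩ := h
      refine ⟨star c, ?_⟩
      conv_lhs => rw [hc]
      rw [star_mul', star_star])
    have hne : x ≠ star x := fun h => hnd (by rw [← h])
    refine ⟨{x, star x}, ?_, ?_, ?_, ?_⟩
    · simp [hpx, hpx']
    · simp only [Finset.mem_insert, Finset.mem_singleton]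
      rintro π (rfl | rfl) π' (rfl | rfl) h
      · exact absurd rfl h
      · exact hnd
      · exact hnd'
      · exact absurd rfl h
    · rw [Finset.card_pair hne, primeWeight, if_pos h8]
    · rw [Finset.prod_pair hne]; exact hass
  · have hodd := hp.eq_two_or_odd.resolve_left h2
    refine ⟨{(p : ℤ√2)}, ?_, ?_, ?_, ?_⟩
    · simpa using natCast_prime hp (by omega)
    · simp
    · rw [primeWeight, if_neg h8, Finset.card_singleton]
    · simp

/-- The prime `√2`. -/
def sqrtTwo : ℤ√2 := ⟨0, 1⟩

theorem sqrtTwo_mul_self : sqrtTwo * sqrtTwo = 2 := by ext <;> simp [sqrtTwo]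

theorem prime_sqrtTwo : Prime sqrtTwo :=
  prime_of_norm Nat.prime_two (by simp [sqrtTwo, norm_def])

theorem isCoprime_natCast {m n : ℕ} (h : m.Coprime n) : IsCoprime (m : ℤ√2) (n : ℤ√2) := by
  have := (Nat.isCoprime_iff_coprime.2 h).map (Int.castRingHom (ℤ√2))
  simpa using this

/-- The element `n * √2 * (1 + √2)`. -/
def radicand (n : ℕ) : ℤ√2 := n * (sqrtTwo * fundUnit)

theorem radicand_eq (n : ℕ) : radicand n = ⟨2 * n, n⟩ := by
  have : sqrtTwo * (fundUnit : ℤ√2) = ⟨2, 1⟩ := by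
    rw [coe_fundUnit]; ext <;> simp [sqrtTwo]
  rw [radicand, this]
  ext <;> simp; ring

/-- The primes dividing `radicand n`. -/
theorem exists_ramified_primes {n : ℕ} (hodd : Odd n) (hsq : Squarefree n) :
    ∃ P : Finset (ℤ√2), (∀ π ∈ P, Prime π) ∧ (∀ π ∈ P, ∀ π' ∈ P, π ≠ π' → ¬ π ∣ π') ∧
      (∀ π ∈ P, ∃ d', radicand n = π * d' ∧ ¬ π ∣ d') ∧
      (∀ π, Prime π → π ∣ 2 * radicand n → ∃ π' ∈ P, Associated π π') ∧
      P.card = 1 + ∑ p ∈ n.primeFactors, primeWeight p := by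
  classical
  have hn0 : n ≠ 0 := hsq.ne_zero
  have hne2 : ∀ p ∈ n.primeFactors, p ≠ 2 := by
    rintro p hp rfl
    exact (Nat.not_even_iff_odd.2 hodd) (even_iff_two_dvd.2 (Nat.dvd_of_mem_primeFactors hp))
  have hT : ∀ p : ℕ, ∃ T : Finset (ℤ√2), p ∈ n.primeFactors →
    (∀ π ∈ T, Prime π) ∧ (∀ π ∈ T, ∀ π' ∈ T, π ≠ π' → ¬ π ∣ π') ∧ T.card = primeWeight p ∧
    Associated (p : ℤ√2) (∏ π ∈ T, π) := by
    intro p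
    by_cases hp : p ∈ n.primeFactors
    · obtain ⟨T, hT⟩ := exists_prime_factors (Nat.prime_of_mem_primeFactors hp) (hne2 p hp)
      exact ⟨T, fun _ => hT⟩
    · exact ⟨∅, fun h => absurd h hp⟩
  choose T hT using hT
  have hTdvd : ∀ p ∈ n.primeFactors, ∀ π ∈ T p, π ∣ p := fun p hp π hπ =>
    (hT p hp).2.2.2.dvd_iff_dvd_right.2 (Finset.dvd_prod_of_mem _ hπ)
  have hnot : ∀ π : ℤ√2, Prime π → ∀ a b : ℕ, a.Coprime b → π ∣ a → ¬ π ∣ b := by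
    intro π hπ a b hab h1 h2
    exact hπ.not_isUnit ((isCoprime_natCast hab).isUnit_of_dvd' h1 h2)
  have hnot2 : ∀ p ∈ n.primeFactors, ∀ π ∈ T p, ¬ π ∣ 2 := by
    intro p hp π hπ h
    have hpp := Nat.prime_of_mem_primeFactors hp
    refine hnot π ((hT p hp).1 π hπ) p 2 ?_ (hTdvd p hp π hπ) (by simpa using h)
    exact (Nat.coprime_primes hpp Nat.prime_two).2 (hne2 p hp)
  have hsqrt2 : ∀ p ∈ n.primeFactors, ∀ π ∈ T p, ¬ π ∣ sqrtTwo := by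
    intro p hp π hπ h
    exact hnot2 p hp π hπ (sqrtTwo_mul_self ▸ h.mul_right _)
  have hsqrt2n : ¬ sqrtTwo ∣ (n : ℤ√2) := by
    refine hnot _ prime_sqrtTwo 2 n ?_ ?_
    · rw [Nat.coprime_two_left]; exact hodd
    · exact ⟨sqrtTwo, by rw [sqrtTwo_mul_self]; simp⟩
  have hndvd : ∀ p ∈ n.primeFactors, ∀ q ∈ n.primeFactors, p ≠ q → ∀ π ∈ T p, ∀ π' ∈ T q,
      ¬ π ∣ π' := by
    intro p hp q hq hpq π hπ π' hπ' h
    refine hnot π ((hT p hp).1 π hπ) p q ?_ (hTdvd p hp π hπ) (h.trans (hTdvd q hq π' hπ'))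
    exact (Nat.coprime_primes (Nat.prime_of_mem_primeFactors hp)
      (Nat.prime_of_mem_primeFactors hq)).2 hpq
  have hdisj : sqrtTwo ∉ n.primeFactors.biUnion T := by
    rw [Finset.mem_biUnion]
    rintro ⟨p, hp, h⟩
    exact hsqrt2 p hp _ h dvd_rfl
  refine ⟨insert sqrtTwo (n.primeFactors.biUnion T), ?_, ?_, ?_, ?_, ?_⟩
  · intro π hπ
    rcases Finset.mem_insert.1 hπ with rfl | hπ
    · exact prime_sqrtTwo
    · obtain ⟨p, hp, hπ⟩ := Finset.mem_biUnion.1 hπ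
      exact (hT p hp).1 π hπ
  · intro π hπ π' hπ' hne
    rcases Finset.mem_insert.1 hπ with rfl | hπ <;> rcases Finset.mem_insert.1 hπ' with rfl | hπ'
    · exact absurd rfl hne
    · obtain ⟨p, hp, hπ'⟩ := Finset.mem_biUnion.1 hπ'
      intro h
      exact hsqrt2n (h.trans ((hTdvd p hp _ hπ').trans
        (by exact_mod_cast Nat.cast_dvd_cast (Nat.dvd_of_mem_primeFactors hp))))
    · obtain ⟨p, hp, hπ⟩ := Finset.mem_biUnion.1 hπ
      exact hsqrt2 p hp π hπ
    · obtain ⟨p, hp, hπ⟩ := Finset.mem_biUnion.1 hπ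
      obtain ⟨q, hq, hπ'⟩ := Finset.mem_biUnion.1 hπ'
      by_cases hpq : p = q
      · subst hpq
        exact (hT p hp).2.1 π hπ π' hπ' hne
      · exact hndvd p hp q hq hpq π hπ π' hπ'
  · intro π hπ
    rcases Finset.mem_insert.1 hπ with rfl | hπ
    · refine ⟨n * fundUnit, by rw [radicand]; ring, fun h => ?_⟩
      exact hsqrt2n ((Units.dvd_mul_right).1 h)
    · obtain ⟨p, hp, hπ⟩ := Finset.mem_biUnion.1 hπ
      have hπp := (hT p hp).1 π hπ
      obtain ⟨m, hm⟩ := Nat.dvd_of_mem_primeFactors hp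
      have hcop : p.Coprime m := by
        rw [hm] at hsq
        exact Nat.coprime_of_squarefree_mul hsq
      obtain ⟨u, hu⟩ := (hT p hp).2.2.2.symm
      have hd : radicand n =
          π * ((∏ ρ ∈ (T p).erase π, ρ) * u * m * (sqrtTwo * fundUnit)) := by
        rw [radicand, hm, Nat.cast_mul, ← hu, ← Finset.mul_prod_erase _ _ hπ]; ring
      refine ⟨_, hd, fun h => ?_⟩
      rcases hπp.dvd_or_dvd h with h | h
      · rcases hπp.dvd_or_dvd h with h | h
        · rw [Units.dvd_mul_right, hπp.dvd_finsetProd_iff] at h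
          obtain ⟨ρ, hρ, hd⟩ := h
          exact (hT p hp).2.1 π hπ ρ (Finset.mem_of_mem_erase hρ)
            (Finset.ne_of_mem_erase hρ).symm hd
        · exact hnot π hπp p m hcop (hTdvd p hp π hπ) h
      · exact hsqrt2 p hp π hπ (Units.dvd_mul_right.1 h)
  · intro π hπ h
    rw [radicand, ← sqrtTwo_mul_self] at h
    have hcase : π ∣ sqrtTwo ∨ π ∣ (n : ℤ√2) := by
      rcases hπ.dvd_or_dvd h with h | h
      · rcases hπ.dvd_or_dvd h with h | h <;> exact Or.inl h
      · rcases hπ.dvd_or_dvd h with h | h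
        · exact Or.inr h
        · exact Or.inl (Units.dvd_mul_right.1 h)
    rcases hcase with h | h
    · exact ⟨sqrtTwo, Finset.mem_insert_self _ _, hπ.associated_of_dvd prime_sqrtTwo h⟩
    · rw [← Nat.prod_primeFactors_of_squarefree hsq, Nat.cast_prod, hπ.dvd_finsetProd_iff] at h
      obtain ⟨p, hp, h⟩ := h
      rw [(hT p hp).2.2.2.dvd_iff_dvd_right, hπ.dvd_finsetProd_iff] at h
      obtain ⟨ρ, hρ, h⟩ := h
      exact ⟨ρ, Finset.mem_insert_of_mem (Finset.mem_biUnion.2 ⟨p, hp, hρ⟩),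
        hπ.associated_of_dvd ((hT p hp).1 ρ hρ) h⟩
  · rw [Finset.card_insert_of_notMem hdisj, add_comm, Finset.card_biUnion]
    · congr 1
      exact Finset.sum_congr rfl fun p hp => (hT p hp).2.2.1
    · intro p hp q hq hpq
      rw [Function.onFun, Finset.disjoint_left]
      intro π hπ hπ'
      exact hndvd p hp q hq hpq π hπ π hπ' dvd_rfl

end Zsqrtd

theorem Prime.exists_dvd_sub_sq {R : Type*} [CommRing R] [IsDomain R] [IsPrincipalIdealRing R]
    {π d d' u : R} (hπ : Prime π) (hd : d = π * d') (hd' : ¬ π ∣ d') {x y z : R} (hz : z ≠ 0)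
    (h : u * z ^ 2 = x ^ 2 - d * y ^ 2) : ∃ c, π ∣ u - c ^ 2 := by
  obtain ⟨k, z', hz', rfl⟩ := WfDvdMonoid.max_power_factor hz hπ.irreducible
  clear hz
  induction k generalizing x y with
  | zero =>
    obtain ⟨a, b, hab⟩ := (hπ.irreducible.coprime_iff_not_dvd).2 hz'
    rw [pow_zero, one_mul] at h
    refine ⟨b * x, u * a * (1 + b * z') - d' * b ^ 2 * y ^ 2, ?_⟩
    have e1 : a * π = 1 - b * z' := by rw [← hab]; ring
    have e2 : x ^ 2 = u * z' ^ 2 + d * y ^ 2 := by rw [h]; ring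
    rw [hd] at e2
    linear_combination (-b ^ 2) * e2 - u * (1 + b * z') * e1
  | succ k ih =>
    have hx : π ∣ x := hπ.dvd_of_dvd_pow (n := 2)
      ⟨u * π * (π ^ k * z') ^ 2 + d' * y ^ 2, by
        rw [hd] at h
        linear_combination -h⟩
    obtain ⟨x', rfl⟩ := hx
    have hy : π ∣ d' * y ^ 2 := ⟨x' ^ 2 - u * (π ^ k * z') ^ 2, mul_left_cancel₀ hπ.ne_zero (by
      rw [hd] at h
      linear_combination h)⟩
    obtain ⟨y', rfl⟩ := hπ.dvd_of_dvd_pow ((hπ.dvd_or_dvd hy).resolve_left hd')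
    refine ih (x := x') (y := y') (mul_left_cancel₀ (pow_ne_zero 2 hπ.ne_zero) ?_)
    linear_combination h

/-- `u` is the norm of an element of the extension of the fraction field of `R` obtained by
adjoining a square root of `d`. -/
def IsNormFrom {R : Type*} [CommRing R] (d u : R) : Prop :=
  ∃ x y z : R, z ≠ 0 ∧ u * z ^ 2 = x ^ 2 - d * y ^ 2

namespace IsNormFrom

variable {R : Type*} [CommRing R] [IsDomain R] {d u v : R}

theorem mul (hu : IsNormFrom d u) (hv : IsNormFrom d v) : IsNormFrom d (u * v) := by
  obtain ⟨x, y, z, hz, h⟩ := hu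
  obtain ⟨x', y', z', hz', h'⟩ := hv
  refine ⟨x * x' + d * (y * y'), x * y' + x' * y, z * z', mul_ne_zero hz hz', ?_⟩
  linear_combination (v * z' ^ 2) * h + (x ^ 2 - d * y ^ 2) * h'

theorem of_mul_right (h : IsNormFrom d (u * v)) (hv : IsNormFrom d v) (h0 : v ≠ 0) :
    IsNormFrom d u := by
  obtain ⟨x, y, z, hz, h⟩ := h.mul hv
  exact ⟨x, y, v * z, mul_ne_zero h0 hz, by rw [← h]; ring⟩

theorem one (d : R) : IsNormFrom d 1 := ⟨1, 0, 1, one_ne_zero, by ring⟩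

theorem prod {ι : Type*} (s : Finset ι) (f : ι → R) (h : ∀ i ∈ s, IsNormFrom d (f i)) :
    IsNormFrom d (∏ i ∈ s, f i) :=
  Finset.prod_induction _ _ (fun _ _ => mul) (one d) h

end IsNormFrom

namespace Zsqrtd

theorem exists_radicand_eq_mul {n : ℕ} (hodd : Odd n) (hsq : Squarefree n) {π : ℤ√2}
    (hπ : Prime π) (h : π ∣ n) : ∃ d', radicand n = π * d' ∧ ¬ π ∣ d' := by
  obtain ⟨P, -, -, hPd, hP2, -⟩ := exists_ramified_primes hodd hsq
  obtain ⟨π', hπ', u, rfl⟩ := hP2 π hπ ((h.mul_right _).mul_left _)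
  obtain ⟨d', hd, hd'⟩ := hPd _ hπ'
  refine ⟨u * d', ?_, fun h => hd' ?_⟩
  · rw [hd, mul_assoc]
  · rwa [Units.mul_right_dvd, ← Units.dvd_mul_left]

theorem _root_.IsNormFrom.isSquare_lift {n p : ℕ} (hodd : Odd n) (hsq : Squarefree n)
    (hp : p.Prime) (hpn : p ∣ n) {u : ℤ√2} (hu : IsNormFrom (radicand n) u) {m : ZMod p}
    (hm : m * m = (2 : ℤ)) :
    IsSquare (lift ⟨m, hm⟩ u) := by
  have := Fact.mk hp
  have h2 : p ≠ 2 := by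
    rintro rfl
    exact (Nat.not_even_iff_odd.2 hodd) (even_iff_two_dvd.2 hpn)
  obtain ⟨T, hT, -, -, hTp⟩ := exists_prime_factors hp h2
  set φ := lift (R := ZMod p) ⟨m, hm⟩
  have h0 : φ (∏ π ∈ T, π) = 0 := by
    obtain ⟨v, hv⟩ := hTp
    rw [← hv, map_mul, map_natCast, ZMod.natCast_self, zero_mul]
  rw [map_prod, Finset.prod_eq_zero_iff] at h0
  obtain ⟨π, hπT, hπ0⟩ := h0
  have hπp : π ∣ (p : ℤ√2) := hTp.dvd_iff_dvd_right.2 (Finset.dvd_prod_of_mem _ hπT)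
  obtain ⟨d', hd, hd'⟩ := exists_radicand_eq_mul hodd hsq (hT π hπT)
    (hπp.trans (Nat.cast_dvd_cast hpn))
  obtain ⟨x, y, z, hz, h⟩ := hu
  obtain ⟨c, e, hc⟩ := (hT π hπT).exists_dvd_sub_sq hd hd' hz h
  refine ⟨φ c, ?_⟩
  rw [← sub_eq_zero, ← sq, ← map_pow, ← map_sub, hc, map_mul, hπ0, zero_mul]

theorem _root_.IsNormFrom.isSquare_norm {n p : ℕ} (hodd : Odd n) (hsq : Squarefree n)
    (hp : p.Prime) (hp8 : p % 8 = 3) (hpn : p ∣ n) {u : ℤ√2}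
    (hu : IsNormFrom (radicand n) u) : IsSquare (u.norm : ZMod p) := by
  have hπ := natCast_prime hp (Or.inl hp8)
  obtain ⟨d', hd, hd'⟩ := exists_radicand_eq_mul hodd hsq hπ (Nat.cast_dvd_cast hpn)
  obtain ⟨x, y, z, hz, h⟩ := hu
  obtain ⟨c, e, hc⟩ := hπ.exists_dvd_sub_sq hd hd' hz h
  refine ⟨c.norm, ?_⟩
  have h1 : u = p * e + c ^ 2 := by rw [← hc]; ring
  have h2 : star u = p * star e + star c ^ 2 := by
    rw [h1, star_add, star_mul, star_pow, star_natCast, mul_comm]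
  have h3 : ((p : ℤ) : ℤ√2) ∣ ((u.norm - c.norm * c.norm : ℤ) : ℤ√2) := by
    rw [Int.cast_sub, Int.cast_mul, norm_eq_mul_conj, norm_eq_mul_conj]
    refine ⟨p * e * star e + e * star c ^ 2 + c ^ 2 * star e, ?_⟩
    rw [h2, h1]; push_cast; ring
  rw [intCast_dvd_intCast] at h3
  rw [← sub_eq_zero, ← Int.cast_mul, ← Int.cast_sub]
  exact (ZMod.intCast_zmod_eq_zero_iff_dvd _ _).2 h3

theorem not_isSquare_neg_one {p : ℕ} (hp : p.Prime) (h4 : p % 4 = 3) :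
    ¬ IsSquare (-1 : ZMod p) := by
  have := Fact.mk hp
  rw [ZMod.exists_sq_eq_neg_one_iff]
  omega

section SevenModEight

variable {n p : ℕ} (hodd : Odd n) (hsq : Squarefree n) (hp : p.Prime) (hp8 : p % 8 = 7)
  (hpn : p ∣ n)

include hodd hsq hp hp8 hpn

theorem not_isNormFrom_of_mod_eight_eq_seven {u : ℤ√2} (hu : u.norm = -1) :
    ¬ IsNormFrom (radicand n) u := by
  intro h
  have := Fact.mk hp
  obtain ⟨m, hm⟩ := (ZMod.exists_sq_eq_two_iff (p := p) (by omega)).2 (Or.inr hp8)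
  have h1 := h.isSquare_lift hodd hsq hp hpn (m := m) (by rw [← hm]; norm_num)
  have h2 := h.isSquare_lift hodd hsq hp hpn (m := -m) (by rw [neg_mul_neg, ← hm]; norm_num)
  apply not_isSquare_neg_one hp (by omega)
  suffices -1 = lift ⟨m, _⟩ u * lift ⟨-m, _⟩ u from this ▸ h1.mul h2
  have : ((u.norm : ℤ) : ZMod p) = -1 := by rw [hu]; simp
  rw [← this, norm_def]
  simp only [lift_apply_apply]
  push_cast
  linear_combination (u.im * u.im : ZMod p) * (-hm)

theorem not_isNormFrom_neg_one_of_mod_eight_eq_seven :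
    ¬ IsNormFrom (radicand n) (-1) := by
  intro h
  have := Fact.mk hp
  obtain ⟨m, hm⟩ := (ZMod.exists_sq_eq_two_iff (p := p) (by omega)).2 (Or.inr hp8)
  have h1 := h.isSquare_lift hodd hsq hp hpn (m := m) (by rw [← hm]; norm_num)
  apply not_isSquare_neg_one hp (by omega)
  simpa using h1

end SevenModEight

theorem not_isNormFrom_of_mod_eight_eq_three {n p : ℕ} (hodd : Odd n) (hsq : Squarefree n)
    (hp : p.Prime) (hp8 : p % 8 = 3) (hpn : p ∣ n) {u : ℤ√2} (hu : u.norm = -1) :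
    ¬ IsNormFrom (radicand n) u := by
  intro h
  apply not_isSquare_neg_one hp (by omega)
  have := h.isSquare_norm hodd hsq hp hp8 hpn
  rw [hu] at this
  simpa using this

end Zsqrtd

section Residues

variable {p : ℕ}

theorem ZMod.exists_pow_four_eq_neg_one [Fact p.Prime] (hp8 : p % 8 = 1) :
    ∃ ζ : ZMod p, ζ ^ 4 = -1 := by
  obtain ⟨i, hi⟩ := (ZMod.exists_sq_eq_neg_one_iff (p := p)).2 (by omega)
  have hi0 : i ≠ 0 := by rintro rfl; simp at hi
  obtain ⟨ζ, hζ⟩ := (ZMod.euler_criterion p hi0).2 (by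
    rw [show p / 2 = 4 * (p / 8) by omega, pow_mul]
    have : i ^ 4 = 1 := by linear_combination (1 - i * i) * hi
    rw [this, one_pow])
  exact ⟨ζ, by rw [hi, hζ]; ring⟩

theorem ZMod.neg_one_ne_one' [Fact p.Prime] (h2 : p ≠ 2) : (-1 : ZMod p) ≠ 1 := by
  have : Fact (2 < p) := ⟨lt_of_le_of_ne (Fact.out : p.Prime).two_le h2.symm⟩
  exact ZMod.neg_one_ne_one

theorem isSquare_one_add_sqrt_neg_one_iff [Fact p.Prime] (hp8 : p % 8 = 1) {ζ : ZMod p}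
    (hζ : ζ ^ 4 = -1) :
    IsSquare (1 + ζ ^ 2) ↔ quartSym p 2 = (-1) ^ ((p - 1) / 8) := by
  have hne : (-1 : ZMod p) ≠ 1 := ZMod.neg_one_ne_one' (by omega)
  have hm : (ζ - ζ ^ 3) ^ 2 = 2 := by linear_combination (ζ ^ 2 - 2) * hζ
  have h20 : (2 : ZMod p) ≠ 0 := fun h => hne (by linear_combination -h)
  have hm0 : ζ - ζ ^ 3 ≠ 0 := by
    intro h
    rw [h] at hm
    exact h20 (by rw [← hm]; ring)
  have hζ0 : ζ ≠ 0 := by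
    rintro rfl
    simp at hζ
  have he : 1 + ζ ^ 2 = ζ * (ζ - ζ ^ 3) := by linear_combination hζ
  have hsq : ((2 : ZMod p) ^ ((p - 1) / 4)) ^ 2 = 1 := by
    rw [← pow_mul, ← hm, ← pow_mul,
      show 2 * ((p - 1) / 4 * 2) = p - 1 by omega, ZMod.pow_card_sub_one_eq_one hm0]
  rw [ZMod.euler_criterion p (he ▸ mul_ne_zero hζ0 hm0), he, mul_pow,
    show p / 2 = 4 * ((p - 1) / 8) by omega, pow_mul, hζ,
    show 4 * ((p - 1) / 8) = 2 * ((p - 1) / 4) by omega, pow_mul, hm, quartSym]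
  push_cast
  rw [sq, mul_self_eq_one_iff] at hsq
  rcases Nat.even_or_odd ((p - 1) / 8) with hk | hk <;>
  rcases hsq with h | h <;> simp [hk.neg_one_pow, h, hne]

theorem isSquare_one_add_sqrt_two_iff [Fact p.Prime] (hp8 : p % 8 = 1) {m : ZMod p}
    (hm : m * m = 2) : IsSquare (1 + m) ↔ quartSym p 2 = (-1) ^ ((p - 1) / 8) := by
  have hne : (-1 : ZMod p) ≠ 1 := ZMod.neg_one_ne_one' (by omega)
  have h20 : (2 : ZMod p) ≠ 0 := fun h => hne (by linear_combination -h)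
  have hζ : ∃ ζ : ZMod p, ζ ^ 4 = -1 ∧ m = ζ - ζ ^ 3 := by
    obtain ⟨ζ, hζ⟩ := ZMod.exists_pow_four_eq_neg_one hp8
    have : m * m = (ζ - ζ ^ 3) * (ζ - ζ ^ 3) := by linear_combination hm - (ζ ^ 2 - 2) * hζ
    rcases mul_self_eq_mul_self_iff.1 this with h | h
    · exact ⟨ζ, hζ, h⟩
    · exact ⟨-ζ, by rw [← hζ]; ring, by rw [h]; ring⟩
  obtain ⟨ζ, hζ, rfl⟩ := hζ
  rw [← isSquare_one_add_sqrt_neg_one_iff hp8 hζ]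
  have hprod : (1 + ζ ^ 2) * (1 + (ζ - ζ ^ 3)) = (1 + ζ) ^ 2 := by
    linear_combination (-ζ) * hζ
  have hm0 : ζ - ζ ^ 3 ≠ 0 := by
    intro h
    rw [h] at hm
    exact h20 (by rw [← hm]; ring)
  have hζ0 : ζ ≠ 0 := by
    rintro rfl
    simp at hζ
  have he : 1 + ζ ^ 2 = ζ * (ζ - ζ ^ 3) := by linear_combination hζ
  have he0 : 1 + ζ ^ 2 ≠ 0 := he ▸ mul_ne_zero hζ0 hm0
  have he1 : 1 + (ζ - ζ ^ 3) ≠ 0 := by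
    intro h
    have h1 : (ζ - ζ ^ 3) = -1 := by linear_combination h
    rw [h1] at hm
    exact one_ne_zero (α := ZMod p) (by linear_combination -hm)
  have key : ∀ a b c : ZMod p, a ≠ 0 → a * b = c ^ 2 → IsSquare a → IsSquare b := by
    rintro a b c ha h ⟨r, rfl⟩
    have hr : r ≠ 0 := by rintro rfl; simp at ha
    exact ⟨c / r, by field_simp; linear_combination h⟩
  exact ⟨key _ _ _ he1 (by rw [mul_comm, hprod]), key _ _ _ he0 hprod⟩

theorem exists_sqrt_neg_one_isSquare_one_add [Fact p.Prime]
    (h : p % 8 = 5 ∨ p % 8 = 1 ∧ quartSym p 2 = (-1) ^ ((p - 1) / 8)) :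
    ∃ i : ZMod p, i * i = -1 ∧ IsSquare (1 + i) := by
  rcases h with h5 | ⟨h1, hq⟩
  · obtain ⟨i, hi⟩ := (ZMod.exists_sq_eq_neg_one_iff (p := p)).2 (by omega)
    by_cases h : IsSquare (1 + i)
    · exact ⟨i, hi.symm, h⟩
    · refine ⟨-i, by rw [neg_mul_neg, ← hi], ?_⟩
      by_contra h'
      have h2 : (1 + i) * (1 + -i) = 2 := by linear_combination hi
      have hns := (ZMod.exists_sq_eq_two_iff (p := p) (by omega)).not.2 (by omega)
      have h0 : 1 + i ≠ 0 := fun h0 => h ⟨0, by simpa using h0⟩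
      have h0' : 1 + -i ≠ 0 := fun h0 => h' ⟨0, by simpa using h0⟩
      have h20 : (2 : ZMod p) ≠ 0 := h2 ▸ mul_ne_zero h0 h0'
      rw [ZMod.euler_criterion p h0] at h
      rw [ZMod.euler_criterion p h0'] at h'
      rw [ZMod.euler_criterion p h20, ← h2, mul_pow,
        (ZMod.pow_div_two_eq_neg_one_or_one p h0).resolve_left h,
        (ZMod.pow_div_two_eq_neg_one_or_one p h0').resolve_left h'] at hns
      exact hns (by ring)
  · obtain ⟨ζ, hζ⟩ := ZMod.exists_pow_four_eq_neg_one h1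
    exact ⟨ζ ^ 2, by rw [← hζ]; ring, (isSquare_one_add_sqrt_neg_one_iff h1 hζ).2 hq⟩

end Residues

namespace Zsqrtd

theorem not_isNormFrom_fundUnit_of_mod_eight_eq_one {n p : ℕ} (hodd : Odd n)
    (hsq : Squarefree n) (hp : p.Prime) (hp8 : p % 8 = 1) (hpn : p ∣ n)
    (hq : quartSym p 2 ≠ (-1) ^ ((p - 1) / 8)) :
    ¬ IsNormFrom (radicand n) (fundUnit : ℤ√2) := by
  intro h
  have := Fact.mk hp
  obtain ⟨m, hm⟩ := (ZMod.exists_sq_eq_two_iff (p := p) (by omega)).2 (Or.inl hp8)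
  apply hq
  rw [← isSquare_one_add_sqrt_two_iff hp8 hm.symm]
  simpa [coe_fundUnit] using
    h.isSquare_lift hodd hsq hp hpn (m := m) (by rw [← hm]; norm_num)

end Zsqrtd

theorem Int.isNormFrom_neg_two (α : ℕ) : ∀ z : ℤ, (α : ℤ) ∣ z ^ 2 + 2 →
    IsNormFrom (-2 : ℤ) α := by
  induction α using Nat.strong_induction_on with
  | _ α ih =>
  intro z hz
  rcases Nat.lt_or_ge α 3 with h3 | h3
  · interval_cases α
    · rw [Nat.cast_zero, zero_dvd_iff] at hz
      nlinarith [sq_nonneg z]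
    · exact .one _
    · exact ⟨0, 1, 1, by norm_num⟩
  obtain ⟨q, hq⟩ := Int.exists_two_mul_abs_sub_le z (b := α) (by omega)
  have hdvd : (α : ℤ) ∣ (z - α * q) ^ 2 + 2 := by
    obtain ⟨c, hc⟩ := hz
    exact ⟨c - 2 * z * q + α * q ^ 2, by linear_combination hc⟩
  generalize z - α * q = y at hq hdvd
  obtain ⟨m, hm⟩ := hdvd
  have hα : (3 : ℤ) ≤ α := by exact_mod_cast h3
  have hm0 : 0 < m := by nlinarith [sq_nonneg y]
  rw [abs_of_pos (by omega : (0 : ℤ) < α)] at hq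
  have hmα : m < α := by
    have e : y ^ 2 = |y| ^ 2 := (sq_abs y).symm
    have := abs_nonneg y
    nlinarith
  lift m to ℕ using hm0.le
  refine IsNormFrom.of_mul_right (v := (m : ℤ)) ?_ (ih m (by exact_mod_cast hmα) y
    ⟨α, by rw [hm, mul_comm]⟩) hm0.ne'
  exact ⟨y, 1, 1, one_ne_zero, by linear_combination -hm⟩

namespace GaussianInt

theorem isNormFrom_one_add_I (M : ℕ) : ∀ α : GaussianInt, α ≠ 0 → α.norm.natAbs = M →
    ∀ z : GaussianInt, α ∣ z ^ 2 - ⟨1, 1⟩ → IsNormFrom (⟨1, 1⟩ : GaussianInt) α := by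
  induction M using Nat.strong_induction_on with
  | _ M ih =>
  intro α hα hM z hz
  have hnn : ∀ x : GaussianInt, x.norm = x.re ^ 2 + x.im ^ 2 := fun x => by
    rw [Zsqrtd.norm_def]; ring
  have hM' : (M : ℤ) = α.norm := by
    rw [← hM, Int.natAbs_of_nonneg]
    rw [hnn]; positivity
  have hα0 : α.norm ≠ 0 := fun h => hα ((Zsqrtd.norm_eq_zero_iff (by norm_num) α).1 h)
  rcases Nat.lt_or_ge M 3 with h3 | h3
  · obtain ⟨a, b⟩ := α
    rw [hnn] at hM'
    simp only at hM'
    have h3' : (M : ℤ) < 3 := by exact_mod_cast h3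
    have ha1 : a < 2 := by nlinarith [sq_nonneg b]
    have ha2 : -2 < a := by nlinarith [sq_nonneg b]
    have hb1 : b < 2 := by nlinarith [sq_nonneg a]
    have hb2 : -2 < b := by nlinarith [sq_nonneg a]
    interval_cases a <;> interval_cases b
    · exact ⟨0, 1, 1, one_ne_zero, by ext <;> rfl⟩
    · exact ⟨⟨0, 1⟩, 0, 1, one_ne_zero, by ext <;> rfl⟩
    · exact ⟨⟨-1, -1⟩, -1, 1, one_ne_zero, by ext <;> rfl⟩
    · exact ⟨-1, -1, 1, one_ne_zero, by ext <;> rfl⟩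
    · exact absurd rfl hα
    · exact ⟨⟨0, 1⟩, ⟨0, 1⟩, 1, one_ne_zero, by ext <;> rfl⟩
    · exact ⟨⟨-1, 1⟩, ⟨0, 1⟩, 1, one_ne_zero, by ext <;> rfl⟩
    · exact ⟨1, 0, 1, one_ne_zero, by ext <;> rfl⟩
    · exact ⟨0, ⟨0, 1⟩, 1, one_ne_zero, by ext <;> rfl⟩
  obtain ⟨q, s, t, hs, ht, hst⟩ := Zsqrtd.exists_rounded_quotient hα0 z
  have hdvd : α ∣ (z - α * q) ^ 2 - ⟨1, 1⟩ := by
    obtain ⟨c, hc⟩ := hz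
    exact ⟨c - 2 * z * q + α * q ^ 2, by linear_combination hc⟩
  generalize z - α * q = y at hst hdvd
  obtain ⟨m, hm⟩ := hdvd
  rw [← hM'] at hs ht hst
  have h3' : (3 : ℤ) ≤ M := by exact_mod_cast h3
  have hy : 2 * y.norm ≤ M := by
    have e1 : s ^ 2 = |s| ^ 2 := (sq_abs s).symm
    have e2 : t ^ 2 = |t| ^ 2 := (sq_abs t).symm
    have := abs_nonneg s
    have := abs_nonneg t
    rw [abs_of_nonneg (by omega : (0 : ℤ) ≤ M)] at hs ht
    nlinarith
  have hy0 : 0 ≤ y.norm := by rw [hnn]; positivity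
  have hm0 : m ≠ 0 := by
    rintro rfl
    have h := congrArg Zsqrtd.norm (sub_eq_zero.1 (hm.trans (mul_zero _)))
    rw [sq, Zsqrtd.norm_mul, hnn ⟨1, 1⟩] at h
    simp only at h
    exact Zsqrtd.two_ne_mul_self y.norm (by rw [h]; norm_num)
  have hnm : m.norm * M < M * M := by
    have h := congrArg Zsqrtd.norm hm
    rw [Zsqrtd.norm_mul, ← hM', hnn] at h
    simp only [sq, Zsqrtd.re_sub, Zsqrtd.im_sub, Zsqrtd.re_mul, Zsqrtd.im_mul] at h
    have h2 := hnn y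
    nlinarith [sq_nonneg (y.re * y.re + -1 * y.im * y.im + 1),
      sq_nonneg (y.re * y.im + y.im * y.re + 1)]
  have hnm' : m.norm < M := by nlinarith
  have hm1 : 0 ≤ m.norm := by rw [hnn]; positivity
  refine IsNormFrom.of_mul_right (v := m) ?_ (ih m.norm.natAbs (by omega) m hm0 rfl y
    ⟨α, by rw [hm, mul_comm]⟩) hm0
  exact ⟨y, 1, 1, one_ne_zero, by linear_combination -hm⟩

theorem exists_norm_eq_isNormFrom {p : ℕ} [Fact p.Prime] {i : ZMod p} (hi : i * i = -1)
    (hsq : IsSquare (1 + i)) :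
    ∃ π : GaussianInt, π.norm = p ∧ IsNormFrom (⟨1, 1⟩ : GaussianInt) π := by
  have hp : p.Prime := Fact.out
  set ψ : GaussianInt →+* ZMod p := Zsqrtd.lift ⟨i, by rw [hi]; norm_num⟩ with hψ
  have hψa : ∀ x, ψ x = x.re + x.im * i := fun x => rfl
  obtain ⟨π, hπ⟩ := (IsPrincipalIdealRing.principal (RingHom.ker ψ)).principal
  have hker : ∀ x, ψ x = 0 ↔ π ∣ x := fun x => by
    rw [← RingHom.mem_ker, hπ, Ideal.submodule_span_eq, Ideal.mem_span_singleton]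
  have hnn : ∀ x : GaussianInt, x.norm = x.re ^ 2 + x.im ^ 2 := fun x => by
    rw [Zsqrtd.norm_def]; ring
  have hπp : π ∣ p := by rw [← hker, map_natCast, ZMod.natCast_self]
  have hp0 : (p : GaussianInt) ≠ 0 := Nat.cast_ne_zero.2 hp.ne_zero
  have hπ0 : π ≠ 0 := fun h => hp0 (by rwa [h, zero_dvd_iff] at hπp)
  refine ⟨π, ?_, ?_⟩
  · obtain ⟨c, hc⟩ := hπp
    have h := congrArg Zsqrtd.norm hc
    rw [Zsqrtd.norm_natCast, Zsqrtd.norm_mul] at h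
    have hdiv : π.norm.natAbs ∣ p ^ 2 := by
      rw [← Int.natCast_dvd_natCast, Int.natAbs_dvd]
      exact ⟨c.norm, by rw [← h]; push_cast; ring⟩
    obtain ⟨k, hk, hk'⟩ := (Nat.dvd_prime_pow hp).1 hdiv
    have hn0 : 0 ≤ π.norm := by rw [hnn]; positivity
    interval_cases k
    · exfalso
      have : IsUnit π := Zsqrtd.norm_eq_one_iff.1 (by simpa using hk')
      have h1 := (hker 1).2 this.dvd
      rw [map_one] at h1
      exact one_ne_zero h1
    · rw [pow_one] at hk'
      omega
    · exfalso
      have hπn : π.norm = p * p := by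
        rw [← Int.natAbs_of_nonneg hn0, hk']; push_cast; ring
      rw [hπn] at h
      have hpp : (p : ℤ) * p ≠ 0 := by
        have : (p : ℤ) ≠ 0 := by exact_mod_cast hp.ne_zero
        positivity
      have hcu : IsUnit c := Zsqrtd.norm_eq_one_iff.1 (by
        rw [mul_right_eq_self₀.1 h.symm |>.resolve_right hpp]; rfl)
      obtain ⟨u, rfl⟩ := hcu
      have hz : ψ ⟨-i.val, 1⟩ = 0 := by
        rw [hψa]; simp
      rw [hker, ← Units.mul_right_dvd (u := u), ← hc] at hz
      obtain ⟨e, he⟩ := hz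
      have := congrArg Zsqrtd.im he
      simp at this
      have h1 : (p : ℤ) ∣ 1 := ⟨_, this⟩
      exact hp.one_lt.ne' (by exact_mod_cast Int.eq_one_of_dvd_one (by omega) h1)
  · obtain ⟨r, hr⟩ := hsq
    refine isNormFrom_one_add_I _ π hπ0 rfl (r.val : GaussianInt) ?_
    rw [← hker, map_sub, map_pow, map_natCast, ZMod.natCast_zmod_val, sq, ← hr, hψa]
    simp

end GaussianInt

namespace Zsqrtd

theorem norm_radicand (n : ℕ) : (radicand n).norm = 2 * n ^ 2 := by
  rw [radicand_eq, norm_def]; ring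

theorem _root_.IsNormFrom.radicand_symm {n : ℕ} (hn : n ≠ 0) {u : ℤ√2}
    (h : IsNormFrom u (radicand n)) : IsNormFrom (radicand n) u := by
  obtain ⟨x, y, w, hw, h⟩ := h
  refine ⟨x, w, y, ?_, by linear_combination h⟩
  rintro rfl
  have h1 := congrArg norm (h.trans (by ring : _ = x * x))
  rw [sq, norm_mul, norm_mul, norm_mul, norm_radicand] at h1
  have h2 : norm (⟨x.norm, n * w.norm⟩ : ℤ√2) = 0 := by
    rw [norm_def]; linear_combination -h1
  rw [norm_eq_zero_two] at h2
  have h3 := congrArg im h2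
  simp only [im_zero, mul_eq_zero, norm_eq_zero_two] at h3
  rcases h3 with h3 | h3
  · exact hn (by exact_mod_cast h3)
  · exact hw h3

theorem isNormFrom_neg_one_natCast {p : ℕ} (hp : p.Prime) (hp8 : p % 8 ≠ 7) (h2 : p ≠ 2) :
    IsNormFrom (-1 : ℤ√2) p := by
  have := Fact.mk hp
  by_cases h4 : p % 4 = 3
  · obtain ⟨r, hr⟩ := (ZMod.exists_sq_eq_neg_two_iff (p := p) h2).2 (by omega)
    obtain ⟨x, y, w, hw, h⟩ := Int.isNormFrom_neg_two p r.val (by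
      rw [← ZMod.intCast_zmod_eq_zero_iff_dvd]
      push_cast
      rw [ZMod.natCast_zmod_val, sq, ← hr]
      ring)
    refine ⟨x, sqrtTwo * y, w, by exact_mod_cast hw, ?_⟩
    have h' := congrArg (Int.cast : ℤ → ℤ√2) h
    push_cast at h'
    linear_combination h' - (y : ℤ√2) ^ 2 * sqrtTwo_mul_self
  · obtain ⟨a, b, hab⟩ := Nat.Prime.sq_add_sq (p := p) h4
    refine ⟨a, b, 1, one_ne_zero, ?_⟩
    rw [← hab]; push_cast; ring

theorem isNormFrom_neg_one {n : ℕ} (hodd : Odd n) (hsq : Squarefree n)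
    (h : ∀ p ∈ n.primeFactors, p % 8 ≠ 7) : IsNormFrom (radicand n) (-1) := by
  refine IsNormFrom.radicand_symm hsq.ne_zero (IsNormFrom.mul ?_ ?_)
  · rw [← Nat.prod_primeFactors_of_squarefree hsq, Nat.cast_prod]
    refine .prod _ _ fun p hp => isNormFrom_neg_one_natCast (Nat.prime_of_mem_primeFactors hp)
      (h p hp) ?_
    rintro rfl
    exact (Nat.not_even_iff_odd.2 hodd) (even_iff_two_dvd.2 (Nat.dvd_of_mem_primeFactors hp))
  · exact ⟨⟨2, 1⟩, ⟨0, 1⟩, 2, fun h => by simpa using congrArg re h, by ext <;> rfl⟩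

theorem isNormFrom_fundUnit_natCast {p : ℕ} (hp : p.Prime)
    (h : p % 8 = 5 ∨ p % 8 = 1 ∧ quartSym p 2 = (-1) ^ ((p - 1) / 8)) :
    IsNormFrom (fundUnit : ℤ√2) p := by
  have := Fact.mk hp
  obtain ⟨i, hi, hs⟩ := exists_sqrt_neg_one_isSquare_one_add h
  obtain ⟨π, hπ, x, y, w, hw, he⟩ := GaussianInt.exists_norm_eq_isNormFrom hi hs
  have hw0 : w.norm ≠ 0 := fun h => hw ((norm_eq_zero_iff (by norm_num) w).1 h)
  have he' := congrArg norm he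
  rw [sq, norm_mul, norm_mul, hπ] at he'
  obtain ⟨a, b⟩ := x
  obtain ⟨c, e⟩ := y
  simp only [norm_def, sq, re_sub, im_sub, re_mul, im_mul] at he'
  refine ⟨⟨2, 1⟩ * ⟨a ^ 2 + b ^ 2, c ^ 2 + e ^ 2⟩,
    2 * (⟨1, 1⟩ * ((a * c + b * e : ℤ) : ℤ√2) - ((a * e - b * c : ℤ) : ℤ√2)),
    ⟨2, 1⟩ * ((w.norm : ℤ) : ℤ√2), mul_ne_zero (fun h => by simpa using congrArg im h)
      (by exact_mod_cast hw0), ?_⟩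
  rw [coe_fundUnit, norm_def]
  ext
  · simp [sq]
    linear_combination 6 * he'
  · simp [sq]
    linear_combination 4 * he'

theorem isNormFrom_fundUnit {n : ℕ} (hsq : Squarefree n)
    (h : ∀ p ∈ n.primeFactors,
      p % 8 = 5 ∨ p % 8 = 1 ∧ quartSym p 2 = (-1) ^ ((p - 1) / 8)) :
    IsNormFrom (radicand n) (fundUnit : ℤ√2) := by
  refine IsNormFrom.radicand_symm hsq.ne_zero (IsNormFrom.mul ?_ ?_)
  · rw [← Nat.prod_primeFactors_of_squarefree hsq, Nat.cast_prod]
    exact .prod _ _ fun p hp => isNormFrom_fundUnit_natCast (Nat.prime_of_mem_primeFactors hp)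
      (h p hp)
  · exact ⟨⟨1, 1⟩, 1, 1, one_ne_zero, by ext <;> rfl⟩

end Zsqrtd

namespace NumberField

variable {K : Type*} [Field K]

theorem comap_unitSquares_integralUnits :
    (unitSquares K).comap (Units.map (algebraMap (𝓞 K) K : 𝓞 K →* K)) =
      (powMonoidHom 2 : (𝓞 K)ˣ →* (𝓞 K)ˣ).range := by
  ext x
  constructor
  · rintro ⟨y, hy⟩
    have hy' : (y : K) ^ 2 = algebraMap (𝓞 K) K x := by
      simpa using congrArg Units.val hy
    have hyint : IsIntegral ℤ (y : K) :=
      IsIntegral.of_pow (n := 2) (by norm_num) (hy' ▸ RingOfIntegers.isIntegral_coe _)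
    obtain ⟨z, hz⟩ : ∃ z : 𝓞 K, algebraMap (𝓞 K) K z = y := ⟨⟨y, hyint⟩, rfl⟩
    have he : z ^ 2 = (x : 𝓞 K) := by
      apply RingOfIntegers.coe_injective
      rw [map_pow, hz]
      exact hy'
    obtain ⟨u, rfl⟩ := (isUnit_pow_iff (n := 2) two_ne_zero).1 (he ▸ x.isUnit)
    exact ⟨u, Units.ext (by rw [powMonoidHom_apply, Units.val_pow_eq_pow_val, he])⟩
  · rintro ⟨y, rfl⟩
    exact ⟨Units.map (algebraMap (𝓞 K) K : 𝓞 K →* K) y, by simp⟩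

variable [NumberField K]

theorem Units.mem_torsion_iff_of_real (φ : K →+* ℝ) {x : (𝓞 K)ˣ} :
    x ∈ Units.torsion K ↔ x = 1 ∨ x = -1 := by
  constructor
  · intro hx
    obtain ⟨m, hm, hx⟩ := isOfFinOrder_iff_pow_eq_one.1 ((CommGroup.mem_torsion _).1 hx)
    have h1 : φ (x : 𝓞 K) ^ m = 1 := by
      have := congrArg (fun u : (𝓞 K)ˣ => φ (u : 𝓞 K)) hx
      simpa using this
    have hinj : ∀ y : (𝓞 K)ˣ, φ (x : 𝓞 K) = φ (y : 𝓞 K) → x = y := fun y h =>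
      Units.ext (RingOfIntegers.coe_injective (φ.injective h))
    rcases (pow_eq_one_iff_cases).1 h1 with h | h | ⟨h, -⟩
    · omega
    · exact Or.inl (hinj 1 (by simpa using h))
    · exact Or.inr (hinj (-1) (by simpa using h))
  · rintro (rfl | rfl)
    · exact one_mem _
    · exact (CommGroup.mem_torsion _).2 (isOfFinOrder_iff_pow_eq_one.2 ⟨2, by norm_num, by simp⟩)

theorem index_pow_two_units (φ : K →+* ℝ) :
    (powMonoidHom 2 : (𝓞 K)ˣ →* (𝓞 K)ˣ).range.index = 2 ^ (Units.rank K + 1) := by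
  set N := (powMonoidHom 2 : (𝓞 K)ˣ →* (𝓞 K)ˣ).range with hN
  have h1 : N.relIndex (N ⊔ Subgroup.zpowers (-1)) = 2 := by
    refine Subgroup.relIndex_sup_zpowers_eq_two ?_ ⟨-1, rfl⟩
    rintro ⟨y, hy⟩
    have := congrArg (fun u : (𝓞 K)ˣ => φ (u : 𝓞 K)) hy
    simp at this
    nlinarith [sq_nonneg (φ (y : 𝓞 K))]
  have h2 : N ⊔ Subgroup.zpowers (-1) =
      (powMonoidHom (α := (𝓞 K)ˣ ⧸ Units.torsion K) 2).range.comap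
        (QuotientGroup.mk' (Units.torsion K)) := by
    apply le_antisymm
    · rw [sup_le_iff, Subgroup.zpowers_le]
      refine ⟨?_, 1, ?_⟩
      · rintro _ ⟨y, rfl⟩
        exact ⟨QuotientGroup.mk' _ y, rfl⟩
      · rw [map_one]
        exact ((QuotientGroup.eq_one_iff _).2 ((Units.mem_torsion_iff_of_real φ).2 (.inr rfl))).symm
    · rintro x ⟨y, hy⟩
      obtain ⟨y, rfl⟩ := QuotientGroup.mk'_surjective _ y
      have : (y ^ 2)⁻¹ * x ∈ Units.torsion K := QuotientGroup.eq.1 hy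
      rw [show x = y ^ 2 * ((y ^ 2)⁻¹ * x) by group]
      refine mul_mem (Subgroup.mem_sup_left ⟨y, rfl⟩) ?_
      rcases (Units.mem_torsion_iff_of_real φ).1 this with h | h <;> rw [h]
      · exact one_mem _
      · exact Subgroup.mem_sup_right (Subgroup.mem_zpowers _)
  have h3 : (powMonoidHom (α := (𝓞 K)ˣ ⧸ Units.torsion K) 2).range.index =
      2 ^ Units.rank K := by
    rw [← Units.finrank_modTorsion, ← Subgroup.index_toAddSubgroup]
    exact AddSubgroup.index_range_nsmul (M := Additive ((𝓞 K)ˣ ⧸ Units.torsion K)) 2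
  rw [← Subgroup.relIndex_mul_index (le_sup_left : N ≤ N ⊔ Subgroup.zpowers (-1)), h1, h2,
    Subgroup.index_comap_of_surjective _ (QuotientGroup.mk'_surjective _), h3, pow_succ']

/-- The index of the squares in the unit group of a totally real number field. -/
theorem relIndex_unitSquares_integralUnits [IsTotallyReal K] (φ : K →+* ℝ) :
    (unitSquares K).relIndex (integralUnits (𝓞 K) K) = 2 ^ Module.finrank ℚ K := by
  rw [integralUnits, ← Subgroup.index_comap, comap_unitSquares_integralUnits,
    index_pow_two_units φ, Units.rank, InfinitePlace.card_eq_nrRealPlaces_add_nrComplexPlaces,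
    IsTotallyReal.finrank, IsTotallyReal.nrComplexPlaces_eq_zero, add_zero,
    Nat.sub_add_cancel]
  rw [← IsTotallyReal.finrank (K := K)]
  exact Module.finrank_pos

end NumberField

open Polynomial in
/-- The minimal polynomial of `√(n(2 + √2))` is irreducible, by Eisenstein's criterion at `2`. -/
theorem Polynomial.irreducible_quartic {n : ℕ} (hn : Odd n) :
    Irreducible (X ^ 4 - C (4 * n : ℚ) * X ^ 2 + C (2 * n ^ 2 : ℚ)) := by
  obtain ⟨a, ha⟩ : ∃ a : ℤ, a = 4 * n := ⟨_, rfl⟩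
  obtain ⟨b, hb⟩ : ∃ b : ℤ, b = 2 * n ^ 2 := ⟨_, rfl⟩
  set f : ℤ[X] := X ^ 4 - C a * X ^ 2 + C b with hf
  have hdeg : f.natDegree = 4 := by rw [hf]; compute_degree!
  have hmonic : f.Monic := by rw [hf]; monicity!
  have hirr : Irreducible f := by
    have h2 : (Ideal.span {(2 : ℤ)}).IsPrime :=
      (Ideal.span_singleton_prime two_ne_zero).2 Int.prime_two
    refine IsEisensteinAt.irreducible (𝓟 := Ideal.span {(2 : ℤ)}) ⟨?_, fun {m} hm => ?_, ?_⟩ h2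
      hmonic.isPrimitive (by omega)
    · rw [hmonic.leadingCoeff]
      exact (Ideal.ne_top_iff_one _).1 h2.ne_top
    · rw [hdeg] at hm
      rw [Ideal.mem_span_singleton]
      have h2a : 2 ∣ a := ⟨2 * n, by rw [ha]; ring⟩
      have h2b : 2 ∣ b := ⟨n ^ 2, hb⟩
      simp only [hf, coeff_add, coeff_sub, coeff_C_mul, coeff_X_pow, coeff_C]
      interval_cases m <;> simp [h2a, h2b]
    · have h0 : f.coeff 0 = b := by simp [hf]
      rw [h0, Ideal.span_singleton_pow, Ideal.mem_span_singleton]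
      rintro ⟨c, hc⟩
      have h1 : (n : ℤ) ^ 2 = 2 * c := by linarith
      have h3 : Even ((n : ℤ) ^ 2) := ⟨c, by rw [h1]; ring⟩
      rw [Int.even_pow' two_ne_zero, Int.even_coe_nat] at h3
      exact (Nat.not_even_iff_odd.2 hn) h3
  have := (hmonic.irreducible_iff_irreducible_map_fraction_map (K := ℚ)).1 hirr
  rw [hf, Polynomial.map_add, Polynomial.map_sub, Polynomial.map_mul, Polynomial.map_pow,
    Polynomial.map_pow, map_X, map_C, map_C, ha, hb] at this
  push_cast [eq_intCast] at this ⊢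
  exact this

namespace NumberField

variable {K : Type*} [Field K] [NumberField K] {n : ℕ} {ρ θ : 𝓞 K}

theorem coe_mul_self_eq_two (hρ : ρ * ρ = (2 : ℤ)) : (ρ : K) * ρ = 2 := by
  have := congrArg (algebraMap (𝓞 K) K) hρ
  rwa [map_mul, map_intCast, Int.cast_ofNat] at this

theorem coe_sq_eq (hθ : θ ^ 2 = n * (2 + ρ)) : (θ : K) ^ 2 = n * (2 + ρ) := by
  have := congrArg (algebraMap (𝓞 K) K) hθ
  rwa [map_pow, map_mul, map_natCast, map_add, map_ofNat] at this

theorem aeval_quartic (hρ : ρ * ρ = (2 : ℤ)) (hθ : θ ^ 2 = n * (2 + ρ)) :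
    Polynomial.aeval (θ : K) (.X ^ 4 - .C (4 * n : ℚ) * .X ^ 2 + .C (2 * n ^ 2 : ℚ)) = 0 := by
  have h1 := coe_mul_self_eq_two hρ
  have h2 := coe_sq_eq hθ
  simp only [map_add, map_sub, map_mul, map_pow, Polynomial.aeval_X, map_natCast, map_ofNat]
  linear_combination (θ ^ 2 - 2 * n + n * ρ : K) * h2 + (n : K) ^ 2 * h1

theorem minpoly_theta (hn : Odd n) (hρ : ρ * ρ = (2 : ℤ)) (hθ : θ ^ 2 = n * (2 + ρ)) :
    minpoly ℚ (θ : K) = .X ^ 4 - .C (4 * n : ℚ) * .X ^ 2 + .C (2 * n ^ 2 : ℚ) :=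
  (minpoly.eq_of_irreducible_of_monic (Polynomial.irreducible_quartic hn)
    (aeval_quartic hρ hθ) (by monicity!)).symm

theorem finrank_eq_four (hn : Odd n) (hρ : ρ * ρ = (2 : ℤ)) (hθ : θ ^ 2 = n * (2 + ρ))
    (hgen : IntermediateField.adjoin ℚ {(θ : K)} = ⊤) : Module.finrank ℚ K = 4 := by
  rw [← IntermediateField.finrank_top', ← hgen,
    IntermediateField.adjoin.finrank (Algebra.IsIntegral.isIntegral _), minpoly_theta hn hρ hθ]
  compute_degree!

theorem algebra_adjoin_theta (hgen : IntermediateField.adjoin ℚ {(θ : K)} = ⊤) :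
    Algebra.adjoin ℚ {(θ : K)} = ⊤ := by
  rw [← IntermediateField.adjoin_simple_toSubalgebra_of_isAlgebraic
    (Algebra.IsAlgebraic.isAlgebraic _), hgen]
  rfl

theorem exists_conj (hn : Odd n) (hρ : ρ * ρ = (2 : ℤ)) (hθ : θ ^ 2 = n * (2 + ρ))
    (hgen : IntermediateField.adjoin ℚ {(θ : K)} = ⊤) : ∃ σ : K →ₐ[ℚ] K, σ θ = -θ := by
  let pb := PowerBasis.ofAdjoinEqTop (Algebra.IsIntegral.isIntegral (R := ℚ) (θ : K))
    (algebra_adjoin_theta hgen)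
  have hpb : pb.gen = θ := PowerBasis.ofAdjoinEqTop_gen _ _
  have h0 : Polynomial.aeval (-(θ : K)) (minpoly ℚ pb.gen) = 0 := by
    rw [hpb, minpoly_theta hn hρ hθ, ← aeval_quartic hρ hθ]
    simp only [map_add, map_sub, map_mul, map_pow, Polynomial.aeval_X, Polynomial.aeval_C]
    ring
  exact ⟨pb.lift _ h0, by simpa only [hpb] using pb.lift_gen _ h0⟩

theorem exists_rat_coord (hn : Odd n) (hρ : ρ * ρ = (2 : ℤ)) (hθ : θ ^ 2 = n * (2 + ρ))
    (hgen : IntermediateField.adjoin ℚ {(θ : K)} = ⊤) (x : K) :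
    ∃ a b c e : ℚ, x = (a + b * ρ) + (c + e * ρ) * θ := by
  let pb := PowerBasis.ofAdjoinEqTop (Algebra.IsIntegral.isIntegral (R := ℚ) (θ : K))
    (algebra_adjoin_theta hgen)
  have hpb : pb.gen = θ := PowerBasis.ofAdjoinEqTop_gen _ _
  obtain ⟨f, hf, rfl⟩ := pb.exists_eq_aeval x
  have hdim : pb.dim = 4 := by rw [← pb.finrank, finrank_eq_four hn hρ hθ hgen]
  rw [hdim] at hf
  refine ⟨f.coeff 0 + 2 * n * f.coeff 2, n * f.coeff 2, f.coeff 1 + 2 * n * f.coeff 3,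
    n * f.coeff 3, ?_⟩
  rw [Polynomial.aeval_eq_sum_range' hf, hpb]
  simp only [Finset.sum_range_succ, Finset.sum_range_zero, Algebra.smul_def, eq_ratCast]
  push_cast
  linear_combination (f.coeff 2 + f.coeff 3 * θ : K) * coe_sq_eq hθ

theorem isTotallyReal_of_coord (hn : Odd n) (hρ : ρ * ρ = (2 : ℤ)) (hθ : θ ^ 2 = n * (2 + ρ))
    (hgen : IntermediateField.adjoin ℚ {(θ : K)} = ⊤) : IsTotallyReal K := by
  have key (φ : K →+* ℂ) : ComplexEmbedding.IsReal φ := by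
    -- `φ` maps `ρ` and `θ` to square roots of nonnegative reals
    have real_of_sq {z : ℂ} {a : ℝ} (ha : 0 ≤ a) (hz : z ^ 2 = a) :
        ∃ r : ℝ, z = r ∧ r ^ 2 = a := by
      have h1 : z ^ 2 = (Real.sqrt a : ℂ) ^ 2 := by
        rw [hz]; exact_mod_cast (Real.sq_sqrt ha).symm
      rcases sq_eq_sq_iff_eq_or_eq_neg.1 h1 with h | h
      · exact ⟨_, h, Real.sq_sqrt ha⟩
      · exact ⟨-Real.sqrt a, by rw [h]; push_cast; rfl, by rw [neg_sq, Real.sq_sqrt ha]⟩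
    obtain ⟨r, hr, hr2⟩ := real_of_sq (z := φ ρ) (a := 2) zero_le_two (by
      rw [← map_pow, sq, coe_mul_self_eq_two hρ, map_ofNat]; norm_cast)
    have hr0 : 0 ≤ n * (2 + r) := mul_nonneg n.cast_nonneg (by nlinarith)
    obtain ⟨t, ht, -⟩ := real_of_sq (z := φ θ) (a := n * (2 + r)) hr0 (by
      rw [← map_pow, coe_sq_eq hθ, map_mul, map_natCast, map_add, map_ofNat, hr]; push_cast; rfl)
    rw [ComplexEmbedding.isReal_iff]
    ext x
    obtain ⟨a, b, c, e, rfl⟩ := exists_rat_coord hn hρ hθ hgen x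
    simp [ComplexEmbedding.conjugate_coe_eq, hr, ht]
  exact ⟨fun v => by
    rw [← InfinitePlace.mk_embedding v]
    exact InfinitePlace.isReal_mk_iff.2 (key _)⟩

end NumberField

namespace IsQuadraticInvolution

section

variable {R O K : Type*} [CommRing R] [IsDomain R] [CommRing O] [IsDedekindDomain O] [Field K]
  [Algebra R O] [Algebra O K] [Algebra R K] [IsScalarTower R O K] [IsFractionRing O K]
  {σ : K →+* K} {τ : O →+* O} {θ : O} {d : R}

theorem mem_range_involutionNorm_iff (h : IsQuadraticInvolution (R := R) σ τ θ d) {u : R} {x : Kˣ}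
    (hx : (x : K) = algebraMap R K u) : x ∈ (involutionNorm σ).range ↔ IsNormFrom d u := by
  have hθ := h.sigma_theta
  have hθ2 : algebraMap O K θ ^ 2 = algebraMap R K d := by
    rw [← map_pow, h.theta_sq, ← IsScalarTower.algebraMap_apply]
  have hinj {r : R} (hr : r ≠ 0) : algebraMap R K r ≠ 0 := by
    simpa using h.inj.ne hr
  constructor
  · rintro ⟨z, hz⟩
    have hz' : (z : K) * σ z = algebraMap R K u := by rw [← hx, ← hz, coe_involutionNorm]
    obtain ⟨r₁, s₁, hs₁, h₁⟩ := (h.fixed_iff (z + σ z)).1 (by rw [map_add, h.invol, add_comm])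
    obtain ⟨r₂, s₂, hs₂, h₂⟩ := (h.fixed_iff ((z - σ z) * algebraMap O K θ)).1 (by
      rw [map_mul, map_sub, h.invol, hθ]; ring)
    refine ⟨d * (r₁ * s₂), r₂ * s₁, 2 * d * (s₁ * s₂),
      mul_ne_zero (mul_ne_zero h.two_ne h.d_ne) (mul_ne_zero hs₁ hs₂), h.inj ?_⟩
    simp only [map_mul, map_sub, map_pow, map_ofNat, ← h₁, ← h₂, ← hz', ← hθ2]
    ring
  · rintro ⟨r, s, z, hz, hu⟩
    have hu' := congrArg (algebraMap R K) hu
    simp only [map_mul, map_sub, map_pow, ← hx] at hu'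
    have hz' := hinj hz
    set y : K := (algebraMap R K r + algebraMap R K s * algebraMap O K θ) / algebraMap R K z with hy
    have hN : y * σ y = x := by
      rw [hy, map_div₀, map_add, map_mul, h.sigma_algebraMap, h.sigma_algebraMap,
        h.sigma_algebraMap, hθ]
      field_simp
      linear_combination -hu' - algebraMap R K s ^ 2 * hθ2
    have hy0 : y ≠ 0 := by
      rintro h0
      rw [h0, zero_mul] at hN
      exact x.ne_zero hN.symm
    exact ⟨Units.mk0 y hy0, Units.ext hN⟩

end

section

open Zsqrtd

variable {O K : Type*} [CommRing O] [IsDedekindDomain O] [Field K]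
  [Algebra (ℤ√2) O] [Algebra O K] [Algebra (ℤ√2) K] [IsScalarTower (ℤ√2) O K] [IsFractionRing O K]
  [IsIntegralClosure O (ℤ√2) K]
  {σ : K →+* K} {τ : O →+* O} {θ : O} {d : ℤ√2}

variable (h : IsQuadraticInvolution (R := ℤ√2) σ τ θ d)
include h

/-- A fixed unit is, up to the norm of a fixed unit, one of `±1`, `±ε`. -/
theorem exists_unit_representative {x : Kˣ} (hx : x ∈ integralUnits O K ⊓ fixedUnits σ) :
    ∃ q ∈ fixedSquares σ, q ∈ (involutionNorm σ).range ∧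
      (x = q ∨ x = q * -1 ∨ x = q * baseUnit K (fundUnit : ℤ√2) ∨
        x = q * (-1 * baseUnit K (fundUnit : ℤ√2))) := by
  obtain ⟨u, hu⟩ := h.exists_unit_of_fixed hx
  obtain ⟨w, hw⟩ := unit_eq_mul_sq u
  have hwK := h.coe_baseUnit w.ne_zero
  have hfix := mem_fixedUnits.1 (h.baseUnit_mem w.ne_zero)
  refine ⟨baseUnit K (w : ℤ√2) ^ 2, mem_fixedSquares.2 ⟨_, hfix, Units.val_pow_eq_pow_val _ _⟩,
    ⟨baseUnit K (w : ℤ√2), Units.ext ?_⟩, ?_⟩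
  · rw [coe_involutionNorm, hfix, Units.val_pow_eq_pow_val, sq]
  · simp only [Units.ext_iff, Units.val_mul, Units.val_neg, Units.val_one, Units.val_pow_eq_pow_val,
      h.coe_baseUnit w.ne_zero, h.coe_baseUnit fundUnit.ne_zero, hu]
    rcases hw with rfl | rfl | rfl | rfl
    · left; simp
    · right; left; simp
    · right; right; left; simp [mul_comm]
    · right; right; right; simp [mul_comm]

theorem exists_mul_sq_eq_sq_of_mem_fixedSquares {u : ℤ√2} {x : Kˣ}
    (hx : (x : K) = algebraMap (ℤ√2) K u) (hmem : x ∈ fixedSquares σ) :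
    ∃ r s : ℤ√2, s ≠ 0 ∧ u * s ^ 2 = r ^ 2 := by
  obtain ⟨y, hy, hxy⟩ := mem_fixedSquares.1 hmem
  obtain ⟨r, s, hs, hrs⟩ := (h.fixed_iff _).1 hy
  refine ⟨r, s, hs, h.inj ?_⟩
  rw [map_mul, map_pow, map_pow, ← hrs, ← hx, hxy]
  ring

theorem neg_one_notMem_fixedSquares : (-1 : Kˣ) ∉ fixedSquares σ := by
  intro hmem
  obtain ⟨r, s, hs, hrs⟩ := h.exists_mul_sq_eq_sq_of_mem_fixedSquares (u := -1) (by simp) hmem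
  have hre := congrArg Zsqrtd.re hrs
  simp [sq] at hre
  apply hs
  have h1 : s.re = 0 := by nlinarith [sq_nonneg s.im, sq_nonneg r.re, sq_nonneg r.im]
  have h2 : s.im = 0 := by nlinarith [sq_nonneg s.re, sq_nonneg r.re, sq_nonneg r.im]
  exact Zsqrtd.ext h1 h2

theorem notMem_fixedSquares_of_norm {u : ℤ√2} (hu : u.norm = -1) {x : Kˣ}
    (hx : (x : K) = algebraMap (ℤ√2) K u) : x ∉ fixedSquares σ := by
  intro hmem
  obtain ⟨r, s, hs, hrs⟩ := h.exists_mul_sq_eq_sq_of_mem_fixedSquares hx hmem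
  have hn := congrArg Zsqrtd.norm hrs
  rw [sq, sq, Zsqrtd.norm_mul, Zsqrtd.norm_mul, Zsqrtd.norm_mul, hu] at hn
  exact hs (norm_eq_zero_two.1 (by nlinarith [sq_nonneg s.norm, sq_nonneg r.norm]))

theorem relIndex_sup_neg_one :
    (fixedSquares σ).relIndex (fixedSquares σ ⊔ Subgroup.zpowers (-1)) = 2 :=
  Subgroup.relIndex_sup_zpowers_eq_two h.neg_one_notMem_fixedSquares (by simp)

theorem neg_one_mem : (-1 : Kˣ) ∈ integralUnits O K ⊓ fixedUnits σ := by
  have := h.baseUnit_unit_mem (isUnit_one.neg)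
  convert this
  apply Units.ext
  rw [h.coe_baseUnit (by simp)]
  simp

theorem relIndex_fixedSquares_integralUnits :
    (fixedSquares σ).relIndex (integralUnits O K ⊓ fixedUnits σ) = 4 := by
  set e := baseUnit K (fundUnit : ℤ√2) with he
  have heK : (e : K) = algebraMap (ℤ√2) K fundUnit := h.coe_baseUnit fundUnit.ne_zero
  have heE : e ∈ integralUnits O K ⊓ fixedUnits σ := h.baseUnit_unit_mem fundUnit.isUnit
  have hsup : fixedSquares σ ⊔ (integralUnits O K ⊓ fixedUnits σ) =
      fixedSquares σ ⊔ Subgroup.zpowers (-1) ⊔ Subgroup.zpowers e := by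
    apply _root_.le_antisymm
    · refine sup_le (le_sup_of_le_left le_sup_left) fun x hx => ?_
      obtain ⟨q, hq, -, hxq⟩ := h.exists_unit_representative hx
      have h1 : q ∈ fixedSquares σ ⊔ Subgroup.zpowers (-1) ⊔ Subgroup.zpowers e :=
        Subgroup.mem_sup_left (Subgroup.mem_sup_left hq)
      have h2 : -1 ∈ fixedSquares σ ⊔ Subgroup.zpowers (-1) ⊔ Subgroup.zpowers e :=
        Subgroup.mem_sup_left (Subgroup.mem_sup_right (Subgroup.mem_zpowers _))
      have h3 : e ∈ fixedSquares σ ⊔ Subgroup.zpowers (-1) ⊔ Subgroup.zpowers e :=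
        Subgroup.mem_sup_right (Subgroup.mem_zpowers _)
      rcases hxq with rfl | rfl | rfl | rfl
      · exact h1
      · exact mul_mem h1 h2
      · exact mul_mem h1 h3
      · exact mul_mem h1 (mul_mem h2 h3)
    · rw [sup_le_iff, sup_le_iff, Subgroup.zpowers_le, Subgroup.zpowers_le]
      exact ⟨⟨le_sup_left, Subgroup.mem_sup_right h.neg_one_mem⟩, Subgroup.mem_sup_right heE⟩
  rw [← Subgroup.relIndex_sup_left, hsup, ← Subgroup.relIndex_mul_relIndex _ _ _ le_sup_left
    le_sup_left, h.relIndex_sup_neg_one, Subgroup.relIndex_sup_zpowers_eq_two]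
  · intro hmem
    obtain ⟨q, hq, z, hz, hqz⟩ := Subgroup.mem_sup.1 hmem
    have hz' : z = 1 ∨ z = -1 := by
      obtain ⟨k, rfl⟩ := Subgroup.mem_zpowers_iff.1 hz
      rcases Int.even_or_odd k with hk | hk
      · left; exact hk.neg_one_zpow
      · right; exact hk.neg_one_zpow
    rcases hz' with rfl | rfl
    · rw [mul_one] at hqz
      exact h.notMem_fixedSquares_of_norm norm_fundUnit heK (hqz ▸ hq)
    · refine h.notMem_fixedSquares_of_norm (u := -fundUnit) (x := q)
        (by rw [Zsqrtd.norm_neg, norm_fundUnit]) ?_ hq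
      rw [map_neg, ← heK, ← hqz]
      simp
  · refine Subgroup.mem_sup_left (mem_fixedSquares.2 ⟨e, ?_, Units.val_pow_eq_pow_val _ _⟩)
    exact mem_fixedUnits.1 heE.2

theorem neg_one_mem_range_iff : (-1 : Kˣ) ∈ (involutionNorm σ).range ↔ IsNormFrom d (-1) :=
  h.mem_range_involutionNorm_iff (by simp)

theorem baseUnit_mem_range_iff : baseUnit K (fundUnit : ℤ√2) ∈ (involutionNorm σ).range ↔
    IsNormFrom d (fundUnit : ℤ√2) :=
  h.mem_range_involutionNorm_iff (h.coe_baseUnit fundUnit.ne_zero)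

theorem neg_baseUnit_mem_range_iff : -1 * baseUnit K (fundUnit : ℤ√2) ∈ (involutionNorm σ).range ↔
    IsNormFrom d (-fundUnit : ℤ√2) :=
  h.mem_range_involutionNorm_iff (by simp [h.coe_baseUnit fundUnit.ne_zero])

theorem relIndex_norm_eq_four (h1 : IsNormFrom d (-1)) (h2 : IsNormFrom d (fundUnit : ℤ√2)) :
    (fixedSquares σ).relIndex
      (integralUnits O K ⊓ fixedUnits σ ⊓ (involutionNorm σ).range) = 4 := by
  rw [inf_eq_left.2, h.relIndex_fixedSquares_integralUnits]
  intro x hx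
  obtain ⟨q, -, hq, hxq⟩ := h.exists_unit_representative hx
  rw [← h.neg_one_mem_range_iff] at h1
  rw [← h.baseUnit_mem_range_iff] at h2
  rcases hxq with rfl | rfl | rfl | rfl
  · exact hq
  · exact mul_mem hq h1
  · exact mul_mem hq h2
  · exact mul_mem hq (mul_mem h1 h2)

theorem relIndex_norm_eq_two (h1 : IsNormFrom d (-1)) (h2 : ¬IsNormFrom d (fundUnit : ℤ√2)) :
    (fixedSquares σ).relIndex
      (integralUnits O K ⊓ fixedUnits σ ⊓ (involutionNorm σ).range) = 2 := by
  rw [← h.neg_one_mem_range_iff] at h1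
  rw [← h.baseUnit_mem_range_iff] at h2
  rw [← Subgroup.relIndex_sup_left, ← h.relIndex_sup_neg_one]
  congr 1
  apply _root_.le_antisymm
  · refine sup_le le_sup_left fun x hx => ?_
    obtain ⟨q, hqQ, hq, hxq⟩ := h.exists_unit_representative hx.1
    rcases hxq with rfl | rfl | rfl | rfl
    · exact Subgroup.mem_sup_left hqQ
    · exact mul_mem (Subgroup.mem_sup_left hqQ) (Subgroup.mem_sup_right (Subgroup.mem_zpowers _))
    · exact absurd ((Subgroup.mul_mem_cancel_left _ hq).1 hx.2) h2
    · exact absurd ((Subgroup.mul_mem_cancel_left _ h1).1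
        ((Subgroup.mul_mem_cancel_left _ hq).1 hx.2)) h2
  · rw [sup_le_iff, Subgroup.zpowers_le]
    exact ⟨le_sup_left, Subgroup.mem_sup_right ⟨h.neg_one_mem, h1⟩⟩

theorem relIndex_norm_eq_one (h1 : ¬IsNormFrom d (-1)) (h2 : ¬IsNormFrom d (fundUnit : ℤ√2))
    (h3 : ¬IsNormFrom d (-fundUnit : ℤ√2)) :
    (fixedSquares σ).relIndex
      (integralUnits O K ⊓ fixedUnits σ ⊓ (involutionNorm σ).range) = 1 := by
  rw [← h.neg_one_mem_range_iff] at h1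
  rw [← h.baseUnit_mem_range_iff] at h2
  rw [← h.neg_baseUnit_mem_range_iff] at h3
  rw [Subgroup.relIndex_eq_one]
  intro x hx
  obtain ⟨q, hqQ, hq, hxq⟩ := h.exists_unit_representative hx.1
  rcases hxq with rfl | rfl | rfl | rfl
  · exact hqQ
  · exact absurd ((Subgroup.mul_mem_cancel_left _ hq).1 hx.2) h1
  · exact absurd ((Subgroup.mul_mem_cancel_left _ hq).1 hx.2) h2
  · exact absurd ((Subgroup.mul_mem_cancel_left _ hq).1 hx.2) h3

end

end IsQuadraticInvolution

section

open Zsqrtd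

theorem Zsqrtd.isIntegral_int_two : Algebra.IsIntegral ℤ (ℤ√2) where
  isIntegral z := by
    have h : IsIntegral ℤ (sqrtTwo : ℤ√2) := by
      refine IsIntegral.of_pow (n := 2) two_pos ?_
      rw [sq, sqrtTwo_mul_self]
      exact isIntegral_algebraMap (x := 2)
    have hz : z = z.re + z.im * sqrtTwo := by ext <;> simp [sqrtTwo]
    rw [hz]
    exact (isIntegral_algebraMap (x := z.re)).add ((isIntegral_algebraMap (x := z.im)).mul h)

namespace NumberField

variable {K : Type*} [Field K] [NumberField K] {n : ℕ} {ρ θ : 𝓞 K}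

/-- A number field generated by a square root `θ` of `n * (2 + √2)` is a quadratic extension of
the fraction field of `ℤ[√2]`. -/
theorem exists_isQuadraticInvolution (hn : Odd n) (hρ : ρ * ρ = (2 : ℤ))
    (hθ : θ ^ 2 = n * (2 + ρ)) (hgen : IntermediateField.adjoin ℚ {(θ : K)} = ⊤) :
    ∃ (_ : Algebra (ℤ√2) (𝓞 K)) (_ : Algebra (ℤ√2) K) (_ : IsScalarTower (ℤ√2) (𝓞 K) K)
      (_ : IsIntegralClosure (𝓞 K) (ℤ√2) K) (σ : K →+* K) (τ : 𝓞 K →+* 𝓞 K),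
      IsQuadraticInvolution (R := ℤ√2) σ τ θ (radicand n) := by
  obtain ⟨σ, hσ⟩ := exists_conj hn hρ hθ hgen
  let f : ℤ√2 →+* 𝓞 K := Zsqrtd.lift ⟨ρ, hρ⟩
  have hf (r : ℤ√2) : f r = r.re + r.im * ρ := rfl
  have hfinj : Function.Injective f := Zsqrtd.lift_injective _ two_ne_mul_self
  let : Algebra (ℤ√2) (𝓞 K) := f.toAlgebra
  let : Algebra (ℤ√2) K := ((algebraMap (𝓞 K) K).comp f).toAlgebra
  have : IsScalarTower (ℤ√2) (𝓞 K) K := IsScalarTower.of_algebraMap_eq fun _ => rfl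
  have hfK (r : ℤ√2) : algebraMap (ℤ√2) K r = r.re + r.im * ρ := by
    rw [IsScalarTower.algebraMap_apply (ℤ√2) (𝓞 K) K]
    exact (congrArg (algebraMap (𝓞 K) K) (hf r)).trans (by simp)
  have hinj : Function.Injective (algebraMap (ℤ√2) K) :=
    RingOfIntegers.coe_injective.comp hfinj
  have h1 := coe_mul_self_eq_two hρ
  have h2 := coe_sq_eq hθ
  have hn0 : (n : K) ≠ 0 := Nat.cast_ne_zero.2 hn.pos.ne'
  have hσρ : σ ρ = ρ := by
    have h3 := congrArg σ h2
    rw [map_pow, hσ, neg_sq, h2, map_mul, map_natCast, map_add, map_ofNat] at h3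
    exact (add_left_cancel (mul_left_cancel₀ hn0 h3)).symm
  have hθ0 : (θ : K) ≠ 0 := by
    intro h0
    rw [h0, zero_pow two_ne_zero, eq_comm, mul_eq_zero, or_iff_right hn0] at h2
    have h3 : (2 : K) = 0 := by linear_combination h1 - (ρ - 2 : K) * h2
    exact two_ne_zero h3
  refine ⟨inferInstance, inferInstance, inferInstance, ⟨RingOfIntegers.coe_injective, ?_⟩, σ,
    RingOfIntegers.mapRingHom (σ : K →+* K), hinj, fun y => rfl, fun x => ?_, fun x => ?_, ?_, ?_,
    ?_, ?_⟩
  · intro x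
    constructor
    · intro hx
      have : Algebra.IsIntegral ℤ (ℤ√2) := isIntegral_int_two
      exact ⟨⟨x, isIntegral_trans (R := ℤ) x hx⟩, rfl⟩
    · rintro ⟨y, rfl⟩
      exact (RingOfIntegers.isIntegral_coe y).tower_top
  · obtain ⟨a, b, c, e, rfl⟩ := exists_rat_coord hn hρ hθ hgen x
    simp [hσ, hσρ]
  · obtain ⟨a, b, c, e, rfl⟩ := exists_rat_coord hn hρ hθ hgen x
    constructor
    · intro hx
      have h3 : (2 : K) * ((c + e * ρ) * θ) = 0 := by
        simp only [RingHom.coe_coe, map_add, map_mul, map_ratCast, hσ, hσρ] at hx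
        linear_combination -hx
      rw [mul_eq_zero, or_iff_right two_ne_zero] at h3
      refine ⟨⟨a.num * b.den, b.num * a.den⟩, (a.den * b.den : ℕ), ?_, ?_⟩
      · exact_mod_cast mul_ne_zero a.den_ne_zero b.den_ne_zero
      · have ha : (a : K) * a.den = a.num := by exact_mod_cast Rat.mul_den_eq_num a
        have hb : (b : K) * b.den = b.num := by exact_mod_cast Rat.mul_den_eq_num b
        rw [h3, map_natCast, hfK]
        push_cast
        linear_combination (b.den : K) * ha + (a.den : K) * ρ * hb
    · rintro ⟨r, s, hs, hrs⟩
      have hs' : algebraMap (ℤ√2) K s ≠ 0 := by simpa using hinj.ne hs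
      have hfix (r : ℤ√2) : σ (algebraMap (ℤ√2) K r) = algebraMap (ℤ√2) K r := by
        rw [hfK, map_add, map_mul, map_intCast, map_intCast, hσρ]
      rw [eq_div_of_mul_eq hs' hrs]
      simp [hfix]
  · exact RingOfIntegers.coe_injective (by simpa using hσ)
  · rw [radicand_eq, hθ]
    exact ((hf _).trans (by push_cast; ring)).symm
  · rw [radicand_eq]
    intro h0
    have := congrArg Zsqrtd.im h0
    simp only [Zsqrtd.im_zero, Nat.cast_eq_zero] at this
    exact hn.pos.ne' this
  · intro h0
    have := congrArg Zsqrtd.re h0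
    norm_num at this

end NumberField

end

/-- The index of the squares of `ℚ(√2)` in the group of the units of `ℤ[√2]` which are norms, up to
squares, from the quadratic extension of `ℚ(√2)` generated by a square root of `n * (2 + √2)`. -/
def unitNormIndex (n : ℕ) : ℕ := by
  classical exact if ∃ p ∈ n.primeFactors, p % 8 = 7 then 1
    else if ∀ p ∈ n.primeFactors, p % 8 = 5 ∨ p % 8 = 1 ∧ quartSym p 2 = (-1) ^ ((p - 1) / 8) then 4
    else 2

namespace NumberField

variable {K : Type*} [Field K] [NumberField K] {n : ℕ} {ρ θ : 𝓞 K}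

open Zsqrtd in
theorem card_two_torsion_mul_four (hodd : Odd n) (hsq : Squarefree n) (hρ : ρ * ρ = (2 : ℤ))
    (hθ : θ ^ 2 = n * (2 + ρ)) (hgen : IntermediateField.adjoin ℚ {(θ : K)} = ⊤) (φ : K →+* ℝ) :
    Nat.card {x : ClassGroup (𝓞 K) // x ^ 2 = 1} * 4 =
      2 ^ (∑ p ∈ n.primeFactors, primeWeight p) * unitNormIndex n := by
  have := isTotallyReal_of_coord hodd hρ hθ hgen
  obtain ⟨P, hP, hPP, hPd, hP2, hcard⟩ := exists_ramified_primes hodd hsq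
  obtain ⟨_, _, _, _, σ, τ, h⟩ := exists_isQuadraticInvolution hodd hρ hθ hgen
  have hv : (fixedSquares σ).relIndex
      (integralUnits (𝓞 K) K ⊓ fixedUnits σ ⊓ (involutionNorm σ).range) = unitNormIndex n := by
    rw [unitNormIndex]
    split_ifs with h7 hgood
    · obtain ⟨p, hp, hp8⟩ := h7
      have hpp := Nat.prime_of_mem_primeFactors hp
      have hpn := Nat.dvd_of_mem_primeFactors hp
      exact h.relIndex_norm_eq_one
        (not_isNormFrom_neg_one_of_mod_eight_eq_seven hodd hsq hpp hp8 hpn)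
        (not_isNormFrom_of_mod_eight_eq_seven hodd hsq hpp hp8 hpn norm_fundUnit)
        (not_isNormFrom_of_mod_eight_eq_seven hodd hsq hpp hp8 hpn
          (by rw [Zsqrtd.norm_neg, norm_fundUnit]))
    · exact h.relIndex_norm_eq_four
        (isNormFrom_neg_one hodd hsq fun p hp h' => h7 ⟨p, hp, h'⟩) (isNormFrom_fundUnit hsq hgood)
    · refine h.relIndex_norm_eq_two (isNormFrom_neg_one hodd hsq fun p hp h' => h7 ⟨p, hp, h'⟩) ?_
      push Not at h7 hgood
      obtain ⟨p, hp, hp5, hp1⟩ := hgood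
      have hpp := Nat.prime_of_mem_primeFactors hp
      have hpn := Nat.dvd_of_mem_primeFactors hp
      have hpodd := Nat.odd_iff.1 (hodd.of_dvd_nat hpn)
      have := h7 p hp
      rcases (by omega : p % 8 = 1 ∨ p % 8 = 3) with hp8 | hp8
      · exact not_isNormFrom_fundUnit_of_mod_eight_eq_one hodd hsq hpp hp8 hpn (hp1 hp8)
      · exact not_isNormFrom_of_mod_eight_eq_three hodd hsq hpp hp8 hpn norm_fundUnit
  have hmain := h.ambiguous_class_number P hP hPP hPd hP2
  rw [h.relIndex_fixedSquares_integralUnits, hv, hcard, relIndex_unitSquares_integralUnits φ,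
    finrank_eq_four hodd hρ hθ hgen, pow_add] at hmain
  linarith

end NumberField

open NumberField in
theorem twoTorsCard_mul_four {n : ℕ} (hodd : Odd n) (hsq : Squarefree n)
    (K : IntermediateField ℚ ℝ) (hK : K = IntermediateField.adjoin ℚ
      {Real.sqrt ((n : ℝ) * ((1 : ℝ) + Real.sqrt 2) * Real.sqrt 2)}) [NumberField K] :
    twoTorsCard K * 4 = 2 ^ (∑ p ∈ n.primeFactors, primeWeight p) * unitNormIndex n := by
  have hn0 : (n : ℝ) ≠ 0 := Nat.cast_ne_zero.2 hodd.pos.ne'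
  have h2 : Real.sqrt 2 ^ 2 = 2 := Real.sq_sqrt zero_le_two
  obtain ⟨t, ht⟩ : ∃ t, t = Real.sqrt ((n : ℝ) * ((1 : ℝ) + Real.sqrt 2) * Real.sqrt 2) := ⟨_, rfl⟩
  have ht2 : t ^ 2 = n * (2 + Real.sqrt 2) := by
    rw [ht, Real.sq_sqrt (by positivity)]
    linear_combination (n : ℝ) * h2
  rw [← ht] at hK
  have htK : t ∈ K := hK ▸ IntermediateField.mem_adjoin_simple_self ℚ t
  have hrK : Real.sqrt 2 ∈ K := by
    have : Real.sqrt 2 = t ^ 2 / n - 2 := by rw [ht2]; field_simp; ring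
    rw [this]
    exact sub_mem (div_mem (pow_mem htK 2) (natCast_mem K n)) (ofNat_mem K 2)
  have hri : IsIntegral ℤ (⟨Real.sqrt 2, hrK⟩ : K) := by
    refine IsIntegral.of_pow (n := 2) two_pos ?_
    rw [show (⟨Real.sqrt 2, hrK⟩ : K) ^ 2 = algebraMap ℤ K 2 from Subtype.ext (by simp; norm_cast)]
    exact isIntegral_algebraMap
  have hti : IsIntegral ℤ (⟨t, htK⟩ : K) := by
    refine IsIntegral.of_pow (n := 2) two_pos ?_
    rw [show (⟨t, htK⟩ : K) ^ 2 =
      algebraMap ℤ K n * (algebraMap ℤ K 2 + ⟨Real.sqrt 2, hrK⟩) from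
      Subtype.ext (by simp [ht2]; left; norm_cast)]
    exact isIntegral_algebraMap.mul (isIntegral_algebraMap.add hri)
  obtain ⟨ρ, hρ⟩ : ∃ ρ : 𝓞 K, algebraMap (𝓞 K) K ρ = ⟨Real.sqrt 2, hrK⟩ := ⟨⟨_, hri⟩, rfl⟩
  obtain ⟨θ, hθ⟩ : ∃ θ : 𝓞 K, algebraMap (𝓞 K) K θ = ⟨t, htK⟩ := ⟨⟨_, hti⟩, rfl⟩
  have hadj : ∀ i : Algebra ℚ K, @IntermediateField.adjoin ℚ _ K _ i {⟨t, htK⟩} = ⊤ := by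
    intro i
    obtain rfl : i = K.algebra' := Subsingleton.elim _ _
    apply IntermediateField.lift_injective
    rw [IntermediateField.lift_adjoin_simple, IntermediateField.lift_top]
    exact hK.symm
  refine card_two_torsion_mul_four (ρ := ρ) (θ := θ) hodd hsq ?_ ?_ ?_ (algebraMap K ℝ)
  · apply RingOfIntegers.coe_injective
    rw [map_mul, map_intCast, hρ]
    exact Subtype.ext (by simp; norm_cast)
  · apply RingOfIntegers.coe_injective
    rw [map_pow, map_mul, map_natCast, map_add, map_ofNat, hθ, hρ]
    exact Subtype.ext (by push_cast; exact ht2)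
  · rw [show RingOfIntegers.val θ = ⟨t, htK⟩ from hθ]
    exact hadj _

theorem legSym_two {p : ℕ} (hp : p.Prime) (hp2 : p % 2 = 1) :
    legSym p 2 = if p % 8 = 1 ∨ p % 8 = 7 then 1 else -1 := by
  have := Fact.mk hp
  have hne : p ≠ 2 := by rintro rfl; omega
  have h2 : (2 : ZMod p) ≠ 0 := by
    intro h
    have : (p : ℕ) ∣ 2 := (ZMod.natCast_eq_zero_iff 2 p).1 (by exact_mod_cast h)
    exact hne ((Nat.prime_dvd_prime_iff_eq hp Nat.prime_two).1 this)
  have hdiv : (p - 1) / 2 = p / 2 := by omega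
  have h := (ZMod.euler_criterion p h2).symm.trans (ZMod.exists_sq_eq_two_iff hne)
  rw [legSym, hdiv, Int.cast_ofNat, if_neg h2]
  exact if_congr h rfl rfl

theorem legSym_two_eq_one_iff {p : ℕ} (hp : p.Prime) (hp2 : p % 2 = 1) :
    legSym p 2 = 1 ↔ p % 8 = 1 ∨ p % 8 = 7 := by
  rw [legSym_two hp hp2]
  split_ifs with h <;> simp [h]

theorem legSym_two_eq_neg_one_iff {p : ℕ} (hp : p.Prime) (hp2 : p % 2 = 1) :
    legSym p 2 = -1 ↔ p % 8 = 3 ∨ p % 8 = 5 := by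
  rw [legSym_two hp hp2]
  split_ifs with h <;> simp <;> omega

theorem primeWeight_eq_two {p : ℕ} (h : p % 8 = 1 ∨ p % 8 = 7) : primeWeight p = 2 := if_pos h

theorem primeWeight_eq_one {p : ℕ} (h : p % 8 = 3 ∨ p % 8 = 5) : primeWeight p = 1 :=
  if_neg (by omega)

theorem primeWeight_pos (p : ℕ) : 1 ≤ primeWeight p := by
  rw [primeWeight]; split_ifs <;> norm_num

theorem card_le_sum_primeWeight (S : Finset ℕ) : S.card ≤ ∑ p ∈ S, primeWeight p := by
  simpa using Finset.sum_le_sum fun p (_ : p ∈ S) => primeWeight_pos p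

theorem eq_singleton_of_sum_primeWeight_eq_one {S : Finset ℕ} (hodd : ∀ p ∈ S, p % 2 = 1)
    (hS : ∑ p ∈ S, primeWeight p = 1) : ∃ a, S = {a} ∧ (a % 8 = 3 ∨ a % 8 = 5) := by
  have hcard := card_le_sum_primeWeight S
  have hne : S.card ≠ 0 := by
    rintro h0
    rw [Finset.card_eq_zero] at h0
    simp [h0] at hS
  obtain ⟨a, rfl⟩ := Finset.card_eq_one.1 (show S.card = 1 by omega)
  have := hodd a (Finset.mem_singleton_self a)
  rw [Finset.sum_singleton] at hS
  refine ⟨a, rfl, ?_⟩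
  by_contra h
  rw [primeWeight_eq_two (by omega)] at hS
  omega

theorem eq_of_sum_primeWeight_eq_two {S : Finset ℕ} (hodd : ∀ p ∈ S, p % 2 = 1)
    (hS : ∑ p ∈ S, primeWeight p = 2) : (∃ a, S = {a} ∧ (a % 8 = 1 ∨ a % 8 = 7)) ∨
      ∃ a b, a ≠ b ∧ S = {a, b} ∧ (a % 8 = 3 ∨ a % 8 = 5) ∧ (b % 8 = 3 ∨ b % 8 = 5) := by
  obtain ⟨a, ha⟩ : S.Nonempty := by
    rw [Finset.nonempty_iff_ne_empty]
    rintro rfl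
    simp at hS
  have haodd := hodd a ha
  rw [← Finset.add_sum_erase S _ ha] at hS
  by_cases h : a % 8 = 1 ∨ a % 8 = 7
  · left
    refine ⟨a, ?_, h⟩
    rw [primeWeight_eq_two h] at hS
    have := card_le_sum_primeWeight (S.erase a)
    have h0 : S.erase a = ∅ := Finset.card_eq_zero.1 (by omega)
    rw [← Finset.insert_erase ha, h0, insert_empty_eq]
  · right
    rw [primeWeight_eq_one (by omega)] at hS
    obtain ⟨b, hb, hb8⟩ := eq_singleton_of_sum_primeWeight_eq_one
      (fun p hp => hodd p (Finset.mem_of_mem_erase hp))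
        (by omega : ∑ p ∈ S.erase a, primeWeight p = 1)
    have hba : b ∈ S.erase a := by rw [hb]; exact Finset.mem_singleton_self b
    exact ⟨a, b, (Finset.ne_of_mem_erase hba).symm, by rw [← Finset.insert_erase ha, hb],
      by omega, hb8⟩

section

variable {n : ℕ}

theorem unitNormIndex_eq_one {p : ℕ} (hp : p ∈ n.primeFactors) (hp8 : p % 8 = 7) :
    unitNormIndex n = 1 := by
  rw [unitNormIndex, if_pos ⟨p, hp, hp8⟩]

theorem unitNormIndex_eq_two (h7 : ∀ p ∈ n.primeFactors, p % 8 ≠ 7) {p : ℕ}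
    (hp : p ∈ n.primeFactors)
    (hp8 : p % 8 = 3 ∨ p % 8 = 1 ∧ quartSym p 2 ≠ (-1) ^ ((p - 1) / 8)) :
    unitNormIndex n = 2 := by
  rw [unitNormIndex, if_neg (fun ⟨p, hp, h⟩ => h7 p hp h), if_neg]
  intro h
  rcases h p hp with h | h
  · omega
  · rcases hp8 with h' | h'
    · omega
    · exact h'.2 h.2

theorem unitNormIndex_eq_four
    (h : ∀ p ∈ n.primeFactors, p % 8 = 5 ∨ p % 8 = 1 ∧ quartSym p 2 = (-1) ^ ((p - 1) / 8)) :
    unitNormIndex n = 4 := by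
  rw [unitNormIndex, if_neg, if_pos h]
  rintro ⟨p, hp, hp8⟩
  have := h p hp
  omega

end

theorem Nat.Prime.primeFactors_mul {p q : ℕ} (hp : p.Prime) (hq : q.Prime) :
    (p * q).primeFactors = {p, q} := by
  rw [Nat.primeFactors_mul hp.ne_zero hq.ne_zero, hp.primeFactors, hq.primeFactors,
    ← Finset.insert_eq]

theorem Nat.Prime.primeFactors_mul_mul {p q r : ℕ} (hp : p.Prime) (hq : q.Prime) (hr : r.Prime) :
    (p * (q * r)).primeFactors = {p, q, r} := by
  rw [Nat.primeFactors_mul hp.ne_zero (mul_ne_zero hq.ne_zero hr.ne_zero), hp.primeFactors,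
    hq.primeFactors_mul hr, ← Finset.insert_eq]

theorem sum_primeWeight_triple {p q r : ℕ} (hpq : p ≠ q) (hpr : p ≠ r) (hqr : q ≠ r) :
    ∑ l ∈ {p, q, r}, primeWeight l = primeWeight p + (primeWeight q + primeWeight r) := by
  rw [Finset.sum_insert (by simp [hpq, hpr]), Finset.sum_pair hqr]

section

variable {p q r : ℕ}

theorem normIndex_prime (hp : p.Prime) (hp8 : p % 8 = 1)
    (hq : quartSym p 2 = (-1) ^ ((p - 1) / 8)) :
    2 ^ (∑ l ∈ p.primeFactors, primeWeight l) * unitNormIndex p = 16 := by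
  rw [unitNormIndex_eq_four, hp.primeFactors, Finset.sum_singleton,
    primeWeight_eq_two (Or.inl hp8)]
  · norm_num
  · simp [hp.primeFactors, hp8, hq]

/-- The products of two primes which are counted. -/
theorem normIndex_mul (hp : p.Prime) (hq : q.Prime) (hpq : p ≠ q)
    (h : p % 8 = 5 ∧ q % 8 = 5 ∨
      p % 8 = 1 ∧ quartSym p 2 ≠ (-1) ^ ((p - 1) / 8) ∧ q % 8 = 5 ∨
      p % 8 = 7 ∧ (q % 8 = 1 ∨ q % 8 = 7) ∨ p % 8 = 3 ∧ q % 8 = 1) :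
    2 ^ (∑ l ∈ (p * q).primeFactors, primeWeight l) * unitNormIndex (p * q) = 16 := by
  rw [hp.primeFactors_mul hq, Finset.sum_pair hpq]
  have hmem {P : ℕ → Prop} (h1 : P p) (h2 : P q) : ∀ l ∈ (p * q).primeFactors, P l := by
    simp [hp.primeFactors_mul hq, h1, h2]
  have hpm : p ∈ (p * q).primeFactors := by simp [hp.primeFactors_mul hq]
  rcases h with ⟨h1, h2⟩ | ⟨h1, h3, h2⟩ | ⟨h1, h2⟩ | ⟨h1, h2⟩
  · rw [unitNormIndex_eq_four (hmem (.inl h1) (.inl h2)), primeWeight_eq_one (.inr h1),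
      primeWeight_eq_one (.inr h2)]
    norm_num
  · rw [unitNormIndex_eq_two (hmem (by omega) (by omega)) hpm (.inr ⟨h1, h3⟩),
      primeWeight_eq_two (.inl h1), primeWeight_eq_one (.inr h2)]
    norm_num
  · rw [unitNormIndex_eq_one hpm h1, primeWeight_eq_two (.inr h1), primeWeight_eq_two h2]
    norm_num
  · rw [unitNormIndex_eq_two (hmem (by omega) (by omega)) hpm (.inl h1),
      primeWeight_eq_one (.inl h1), primeWeight_eq_two (.inl h2)]
    norm_num

theorem normIndex_mul_mul (hp : p.Prime) (hq : q.Prime) (hr : r.Prime) (hpq : p ≠ q) (hpr : p ≠ r)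
    (hqr : q ≠ r) (hp8 : p % 8 = 3 ∨ p % 8 = 7) (hq8 : q % 8 = 3 ∨ q % 8 = 5)
    (hr8 : r % 8 = 3 ∨ r % 8 = 5) :
    2 ^ (∑ l ∈ (p * (q * r)).primeFactors, primeWeight l) * unitNormIndex (p * (q * r)) = 16 := by
  have hpm : p ∈ (p * (q * r)).primeFactors := by simp [hp.primeFactors_mul_mul hq hr]
  rcases hp8 with hp8 | hp8
  · rw [unitNormIndex_eq_two (p := p) ?_ hpm (.inl hp8), hp.primeFactors_mul_mul hq hr,
      sum_primeWeight_triple hpq hpr hqr, primeWeight_eq_one (.inl hp8), primeWeight_eq_one hq8,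
      primeWeight_eq_one hr8]
    · norm_num
    · intro l hl
      rw [hp.primeFactors_mul_mul hq hr] at hl
      simp only [Finset.mem_insert, Finset.mem_singleton] at hl
      rcases hl with rfl | rfl | rfl <;> omega
  · rw [unitNormIndex_eq_one hpm hp8, hp.primeFactors_mul_mul hq hr,
      sum_primeWeight_triple hpq hpr hqr, primeWeight_eq_two (.inr hp8), primeWeight_eq_one hq8,
      primeWeight_eq_one hr8]
    norm_num

/-- The squarefree products of odd primes which are counted. -/
theorem eq_of_normIndex {n : ℕ} (hodd : Odd n) (hsq : Squarefree n)
    (h : 2 ^ (∑ l ∈ n.primeFactors, primeWeight l) * unitNormIndex n = 16) :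
    (∃ p, p.Prime ∧ n = p ∧ p % 8 = 1 ∧ quartSym p 2 = (-1) ^ ((p - 1) / 8)) ∨
    (∃ p q, p.Prime ∧ q.Prime ∧ p ≠ q ∧ n = p * q ∧
      (p % 8 = 5 ∧ q % 8 = 5 ∨ p % 8 = 1 ∧ quartSym p 2 ≠ (-1) ^ ((p - 1) / 8) ∧ q % 8 = 5 ∨
        p % 8 = 7 ∧ (q % 8 = 1 ∨ q % 8 = 7) ∨ p % 8 = 3 ∧ q % 8 = 1)) ∨
    ∃ p q r, p.Prime ∧ q.Prime ∧ r.Prime ∧ p ≠ q ∧ p ≠ r ∧ q ≠ r ∧ n = p * (q * r) ∧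
      (p % 8 = 3 ∨ p % 8 = 7) ∧ (q % 8 = 3 ∨ q % 8 = 5) ∧ (r % 8 = 3 ∨ r % 8 = 5) := by
  have hn := Nat.prod_primeFactors_of_squarefree hsq
  have hprime (p : ℕ) (hp : p ∈ n.primeFactors) : p.Prime := Nat.prime_of_mem_primeFactors hp
  have hpodd (p : ℕ) (hp : p ∈ n.primeFactors) : p % 2 = 1 :=
    Nat.odd_iff.1 (hodd.of_dvd_nat (Nat.dvd_of_mem_primeFactors hp))
  set S := n.primeFactors with hS
  have hodd' (p : ℕ) : ∀ l ∈ S.erase p, l % 2 = 1 := fun l hl =>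
    hpodd l (Finset.mem_of_mem_erase hl)
  have herase {p : ℕ} (hp : p ∈ S) : n = p * ∏ l ∈ S.erase p, l :=
    hn.symm.trans (Finset.mul_prod_erase S (fun l => l) hp).symm
  have hsum {p : ℕ} (hp : p ∈ S) :
      ∑ l ∈ S, primeWeight l = primeWeight p + ∑ l ∈ S.erase p, primeWeight l :=
    (Finset.add_sum_erase S _ hp).symm
  have hpow {a b : ℕ} (hab : 2 ^ a = 2 ^ b) : a = b := Nat.pow_right_injective le_rfl hab
  have htwo {p : ℕ} (hp : p ∈ S) {a : ℕ} (ha : S.erase p = {a}) :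
      a.Prime ∧ p ≠ a ∧ n = p * a := by
    have haS : a ∈ S.erase p := by rw [ha]; exact Finset.mem_singleton_self a
    exact ⟨hprime a (Finset.mem_of_mem_erase haS), (Finset.ne_of_mem_erase haS).symm, by
      rw [herase hp, ha, Finset.prod_singleton]⟩
  have hthree {p : ℕ} (hp : p ∈ S) {a b : ℕ} (hab : a ≠ b) (ha : S.erase p = {a, b}) :
      a.Prime ∧ b.Prime ∧ p ≠ a ∧ p ≠ b ∧ n = p * (a * b) := by
    have haS : a ∈ S.erase p := by rw [ha]; simp
    have hbS : b ∈ S.erase p := by rw [ha]; simp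
    exact ⟨hprime a (Finset.mem_of_mem_erase haS), hprime b (Finset.mem_of_mem_erase hbS),
      (Finset.ne_of_mem_erase haS).symm, (Finset.ne_of_mem_erase hbS).symm, by
      rw [herase hp, ha, Finset.prod_pair hab]⟩
  rw [unitNormIndex] at h
  split_ifs at h with h7 hgood
  · obtain ⟨p, hp, hp8⟩ := h7
    have hA := hpow (a := ∑ l ∈ S, primeWeight l) (b := 4) (by omega)
    rw [hsum hp, primeWeight_eq_two (.inr hp8)] at hA
    rcases eq_of_sum_primeWeight_eq_two (hodd' p) (by omega) with ⟨a, ha, ha8⟩ |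
      ⟨a, b, hab, hTab, ha8, hb8⟩
    · obtain ⟨h1, h2, h3⟩ := htwo hp ha
      exact .inr (.inl ⟨p, a, hprime p hp, h1, h2, h3, .inr (.inr (.inl ⟨hp8, ha8⟩))⟩)
    · obtain ⟨h1, h2, h3, h4, h5⟩ := hthree hp hab hTab
      exact .inr (.inr ⟨p, a, b, hprime p hp, h1, h2, h3, h4, hab, h5, .inr hp8, ha8, hb8⟩)
  · have hA := hpow (a := ∑ l ∈ S, primeWeight l) (b := 2) (by omega)
    rcases eq_of_sum_primeWeight_eq_two hpodd hA with ⟨a, ha, ha8⟩ | ⟨a, b, hab, hTab, ha8, hb8⟩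
    · have haS : a ∈ S := by rw [ha]; exact Finset.mem_singleton_self a
      have h1 := hgood a haS
      exact .inl ⟨a, hprime a haS, by rw [← hn, ha, Finset.prod_singleton], by omega,
        (h1.resolve_left (by omega)).2⟩
    · have haS : a ∈ S := by rw [hTab]; simp
      have hbS : b ∈ S := by rw [hTab]; simp
      have h1 := hgood a haS
      have h2 := hgood b hbS
      exact .inr (.inl ⟨a, b, hprime a haS, hprime b hbS, hab,
        by rw [← hn, hTab, Finset.prod_pair hab], .inl ⟨by omega, by omega⟩⟩)
  · have hA := hpow (a := ∑ l ∈ S, primeWeight l) (b := 3) (by omega)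
    push Not at h7 hgood
    obtain ⟨p, hp, hp5, hp1⟩ := hgood
    have hp7 := h7 p hp
    have hp2 := hpodd p hp
    rw [hsum hp] at hA
    rcases (by omega : p % 8 = 1 ∨ p % 8 = 3) with hp8 | hp8
    · rw [primeWeight_eq_two (.inl hp8)] at hA
      obtain ⟨a, ha, ha8⟩ := eq_singleton_of_sum_primeWeight_eq_one (hodd' p) (by omega)
      obtain ⟨h1, h2, h3⟩ := htwo hp ha
      rcases ha8 with ha8 | ha8
      · exact .inr (.inl ⟨a, p, h1, hprime p hp, h2.symm, by rw [h3, mul_comm],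
          .inr (.inr (.inr ⟨ha8, hp8⟩))⟩)
      · exact .inr (.inl ⟨p, a, hprime p hp, h1, h2, h3, .inr (.inl ⟨hp8, hp1 hp8, ha8⟩)⟩)
    · rw [primeWeight_eq_one (.inl hp8)] at hA
      rcases eq_of_sum_primeWeight_eq_two (hodd' p) (by omega) with ⟨a, ha, ha8⟩ |
        ⟨a, b, hab, hTab, ha8, hb8⟩
      · obtain ⟨h1, h2, h3⟩ := htwo hp ha
        have haS : a ∈ S := Finset.mem_of_mem_erase (ha ▸ Finset.mem_singleton_self a)
        have := h7 a haS
        exact .inr (.inl ⟨p, a, hprime p hp, h1, h2, h3,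
          .inr (.inr (.inr ⟨hp8, by omega⟩))⟩)
      · obtain ⟨h1, h2, h3, h4, h5⟩ := hthree hp hab hTab
        exact .inr (.inr ⟨p, a, b, hprime p hp, h1, h2, h3, h4, hab, h5, .inl hp8, ha8, hb8⟩)

end

/-- `n` odd squarefree positive, `𝕂 = ℚ(√(n·(1+√2)·√2))`.
One has `r₂(H) = 2` (i.e. the 2-torsion of the class group has exactly `2² = 4`
elements) iff `n` has one of the listed forms (`p, p₁, p₂` distinct primes
`≡ 1 (mod 4)`, `q, q₁, q₂, q₃` distinct primes `≡ 3 (mod 4)`; "for some ordering"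
clauses are absorbed by the symmetric existential quantifiers). -/
theorem stmt_18
    (n : ℕ) (hnodd : Odd n) (hnsq : Squarefree n) (hn0 : 0 < n)
    (K : IntermediateField ℚ ℝ)
    (hK : K = IntermediateField.adjoin ℚ
      ({Real.sqrt ((n : ℝ) * ((1 : ℝ) + Real.sqrt 2) * Real.sqrt 2)} : Set ℝ))
    [NumberField K] :
    twoTorsCard K = 2 ^ 2 ↔
      ((∃ p : ℕ, p.Prime ∧ p % 4 = 1 ∧ n = p ∧ legSym p 2 = 1 ∧
          quartSym p 2 = (-1 : ℤ) ^ ((p - 1) / 8)) ∨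
        (∃ p₁ p₂ : ℕ, p₁.Prime ∧ p₂.Prime ∧ p₁ % 4 = 1 ∧ p₂ % 4 = 1 ∧ p₁ ≠ p₂ ∧
          n = p₁ * p₂ ∧
          ((legSym p₁ 2 = -1 ∧ legSym p₂ 2 = -1) ∨
            (legSym p₁ 2 = -1 ∧ legSym p₂ 2 = 1 ∧
              quartSym p₂ 2 ≠ (-1 : ℤ) ^ ((p₂ - 1) / 8)))) ∨
        (∃ q₁ q₂ : ℕ, q₁.Prime ∧ q₂.Prime ∧ q₁ % 4 = 3 ∧ q₂ % 4 = 3 ∧ q₁ ≠ q₂ ∧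
          n = q₁ * q₂ ∧ legSym q₁ 2 = 1 ∧ legSym q₂ 2 = 1) ∨
        (∃ q₁ q₂ q₃ : ℕ, q₁.Prime ∧ q₂.Prime ∧ q₃.Prime ∧
          q₁ % 4 = 3 ∧ q₂ % 4 = 3 ∧ q₃ % 4 = 3 ∧ q₁ ≠ q₂ ∧ q₁ ≠ q₃ ∧ q₂ ≠ q₃ ∧
          n = q₁ * q₂ * q₃ ∧
          (Finset.filter (fun x : ℕ => legSym x 2 = 1)
            ({q₁, q₂, q₃} : Finset ℕ)).card ≤ 1) ∨
        (∃ p₁ p₂ q : ℕ, p₁.Prime ∧ p₂.Prime ∧ p₁ % 4 = 1 ∧ p₂ % 4 = 1 ∧ p₁ ≠ p₂ ∧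
          q.Prime ∧ q % 4 = 3 ∧ n = p₁ * p₂ * q ∧
          legSym p₁ 2 = -1 ∧ legSym p₂ 2 = -1) ∨
        (∃ p q : ℕ, p.Prime ∧ p % 4 = 1 ∧ q.Prime ∧ q % 4 = 3 ∧ n = p * q ∧
          legSym p 2 = 1) ∨
        (∃ p q₁ q₂ : ℕ, p.Prime ∧ p % 4 = 1 ∧ q₁.Prime ∧ q₂.Prime ∧
          q₁ % 4 = 3 ∧ q₂ % 4 = 3 ∧ q₁ ≠ q₂ ∧ n = p * (q₁ * q₂) ∧
          legSym p 2 = -1 ∧ (legSym q₁ 2 = -1 ∨ legSym q₂ 2 = -1))) := by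
  have h16 : twoTorsCard K = 2 ^ 2 ↔
      2 ^ (∑ p ∈ n.primeFactors, primeWeight p) * unitNormIndex n = 16 := by
    rw [← twoTorsCard_mul_four hnodd hnsq K hK]
    omega
  have legSym_one {p : ℕ} (hp : p.Prime) (h : p % 2 = 1) := legSym_two_eq_one_iff hp h
  have legSym_neg {p : ℕ} (hp : p.Prime) (h : p % 2 = 1) := legSym_two_eq_neg_one_iff hp h
  rw [h16]
  constructor
  · intro h
    rcases eq_of_normIndex hnodd hnsq h with ⟨p, hp, hn, hp8, hp4⟩ |
      ⟨p, q, hp, hq, hpq, hn, ⟨hp8, hq8⟩ | ⟨hp8, hp4, hq8⟩ | ⟨hp8, hq8 | hq8⟩ | ⟨hp8, hq8⟩⟩ |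
      ⟨p, q, r, hp, hq, hr, hpq, hpr, hqr, hn, hp8, hq8, hr8⟩
    · exact .inl ⟨p, hp, by omega, hn, (legSym_one hp (by omega)).2 (by omega), hp4⟩
    · exact .inr (.inl ⟨p, q, hp, hq, by omega, by omega, hpq, hn,
        .inl ⟨(legSym_neg hp (by omega)).2 (by omega), (legSym_neg hq (by omega)).2 (by omega)⟩⟩)
    · exact .inr (.inl ⟨q, p, hq, hp, by omega, by omega, hpq.symm, by rw [hn, mul_comm],
        .inr ⟨(legSym_neg hq (by omega)).2 (by omega), (legSym_one hp (by omega)).2 (by omega),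
          hp4⟩⟩)
    · exact .inr (.inr (.inr (.inr (.inr (.inl ⟨q, p, hq, by omega, hp, by omega,
        by rw [hn, mul_comm], (legSym_one hq (by omega)).2 (by omega)⟩)))))
    · exact .inr (.inr (.inl ⟨p, q, hp, hq, by omega, by omega, hpq, hn,
        (legSym_one hp (by omega)).2 (by omega), (legSym_one hq (by omega)).2 (by omega)⟩))
    · exact .inr (.inr (.inr (.inr (.inr (.inl ⟨q, p, hq, by omega, hp, by omega,
        by rw [hn, mul_comm], (legSym_one hq (by omega)).2 (by omega)⟩)))))
    · rcases hq8 with hq8 | hq8 <;> rcases hr8 with hr8 | hr8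
      · refine .inr (.inr (.inr (.inl ⟨p, q, r, hp, hq, hr, by omega, by omega, by omega, hpq, hpr,
          hqr, by rw [hn, mul_assoc], ?_⟩)))
        refine (Finset.card_le_card (t := {p}) fun l hl => ?_).trans (Finset.card_singleton p).le
        simp only [Finset.mem_filter, Finset.mem_insert, Finset.mem_singleton] at hl ⊢
        rcases hl with ⟨rfl | rfl | rfl, hl⟩
        · rfl
        · rw [legSym_one hq (by omega)] at hl
          omega
        · rw [legSym_one hr (by omega)] at hl
          omega
      · exact .inr (.inr (.inr (.inr (.inr (.inr ⟨r, q, p, hr, by omega, hq, hp, by omega, by omega,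
          hpq.symm, by rw [hn]; ring, (legSym_neg hr (by omega)).2 (by omega),
          .inl ((legSym_neg hq (by omega)).2 (by omega))⟩)))))
      · exact .inr (.inr (.inr (.inr (.inr (.inr ⟨q, r, p, hq, by omega, hr, hp, by omega, by omega,
          hpr.symm, by rw [hn]; ring, (legSym_neg hq (by omega)).2 (by omega),
          .inl ((legSym_neg hr (by omega)).2 (by omega))⟩)))))
      · exact .inr (.inr (.inr (.inr (.inl ⟨q, r, p, hq, hr, by omega, by omega, hqr, hp, by omega,
          by rw [hn]; ring, (legSym_neg hq (by omega)).2 (by omega),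
          (legSym_neg hr (by omega)).2 (by omega)⟩))))
  · rintro (⟨p, hp, hp4, rfl, hp8, hp'⟩ | ⟨p, q, hp, hq, hp4, hq4, hpq, rfl, h⟩ |
      ⟨p, q, hp, hq, hp4, hq4, hpq, rfl, hp8, hq8⟩ |
      ⟨p, q, r, hp, hq, hr, hp4, hq4, hr4, hpq, hpr, hqr, rfl, h⟩ |
      ⟨p, q, r, hp, hq, hp4, hq4, hpq, hr, hr4, rfl, hp8, hq8⟩ |
      ⟨p, q, hp, hp4, hq, hq4, rfl, hp8⟩ |
      ⟨p, q, r, hp, hp4, hq, hr, hq4, hr4, hqr, rfl, hp8, h⟩)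
    · rw [legSym_one hp (by omega)] at hp8
      exact normIndex_prime hp (by omega) hp'
    · rw [legSym_one hq (by omega), legSym_neg hp (by omega), legSym_neg hq (by omega)] at h
      rcases h with h | ⟨hp8, hq8, hq'⟩
      · exact normIndex_mul hp hq hpq (.inl (by omega))
      · rw [mul_comm p q]
        exact normIndex_mul hq hp hpq.symm (.inr (.inl ⟨by omega, hq', by omega⟩))
    · rw [legSym_one hp (by omega)] at hp8
      rw [legSym_one hq (by omega)] at hq8
      exact normIndex_mul hp hq hpq (.inr (.inr (.inl (by omega))))
    · have hpair {a b : ℕ} (ha : a ∈ ({p, q, r} : Finset ℕ)) (hb : b ∈ ({p, q, r} : Finset ℕ))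
          (hap : a.Prime) (hbp : b.Prime) (ha7 : a % 8 = 7) (hb7 : b % 8 = 7) : a = b :=
        Finset.card_le_one.1 h a
          (Finset.mem_filter.2 ⟨ha, (legSym_one hap (by omega)).2 (by omega)⟩) b
          (Finset.mem_filter.2 ⟨hb, (legSym_one hbp (by omega)).2 (by omega)⟩)
      have h1 (h7 : p % 8 = 7) : q % 8 ≠ 7 := fun h7' =>
        hpq (hpair (by simp) (by simp) hp hq h7 h7')
      have h2 (h7 : p % 8 = 7) : r % 8 ≠ 7 := fun h7' =>
        hpr (hpair (by simp) (by simp) hp hr h7 h7')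
      have h3 (h7 : q % 8 = 7) : r % 8 ≠ 7 := fun h7' =>
        hqr (hpair (by simp) (by simp) hq hr h7 h7')
      by_cases hp7 : p % 8 = 7
      · rw [mul_assoc]
        exact normIndex_mul_mul hp hq hr hpq hpr hqr (by omega) (by omega) (by omega)
      by_cases hq7 : q % 8 = 7
      · rw [show p * q * r = q * (p * r) by ring]
        exact normIndex_mul_mul hq hp hr hpq.symm hqr hpr (by omega) (by omega) (by omega)
      · rw [mul_comm (p * q) r]
        exact normIndex_mul_mul hr hp hq hpr.symm hqr.symm hpq (by omega) (by omega) (by omega)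
    · rw [legSym_neg hp (by omega)] at hp8
      rw [legSym_neg hq (by omega)] at hq8
      rw [mul_comm (p * q) r]
      exact normIndex_mul_mul hr hp hq (by rintro rfl; omega) (by rintro rfl; omega) hpq
        (by omega) (by omega) (by omega)
    · rw [legSym_one hp (by omega)] at hp8
      rw [mul_comm p q]
      exact normIndex_mul hq hp (by rintro rfl; omega) (.inr (.inr (by omega)))
    · rw [legSym_neg hp (by omega)] at hp8
      rw [legSym_neg hq (by omega), legSym_neg hr (by omega)] at h
      rcases h with h | h
      · rw [show p * (q * r) = r * (p * q) by ring]
        exact normIndex_mul_mul hr hp hq (by rintro rfl; omega) hqr.symm (by rintro rfl; omega)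
          (by omega) (by omega) (by omega)
      · rw [show p * (q * r) = q * (p * r) by ring]
        exact normIndex_mul_mul hq hp hr (by rintro rfl; omega) hqr (by rintro rfl; omega)
          (by omega) (by omega) (by omega)
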